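/- Fix n ≥ 1, p ∈ (0,1], and λ ∈ (0, 1/2], and let F_λ be the class of measurable symmetric functions f: [0,1]² → [-1,1] whose associated integral operator admits a spectral decomposition with nonzero eigenvalues all of absolute value at least λ, the minimum absolute value being exactly λ. Then in the centered graphon model with observation density p: (i) for every estimator Ŷ there exists f ∈ F_λ such that P(max_{i,j} |Ŷ_ij - f(θ_i, θ_j)| ≥ 1/2) ≥ (1/2)·exp(-2λ²(4λ² + 1)·pn); and (ii) for every estimator Ŷ there exists f ∈ F_λ such that E[(1/n²)·Σ_{i,j} (Ŷ_ij - f(θ_i, θ_j))²] ≥ (1/(4n))·exp(-2λ²(4λ² + 1)·pn). -/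

import Mathlib

open MeasureTheory

/-- A spectral decomposition of a kernel `f` on `[0,1]²`: nonzero eigenvalues `ev k` and
eigenfunctions `q k`, indexed by `k ∈ K`, orthonormal in `L²([0,1])`, with
`f x y = ∑_{k ∈ K} ev k · q k x · q k y`. -/
def IsSpectralDecomp (f : ℝ → ℝ → ℝ) (K : Set ℕ) (ev : ℕ → ℝ) (q : ℕ → ℝ → ℝ) : Prop :=
  (∀ k ∈ K, ev k ≠ 0) ∧
  (∀ k ∈ K, Measurable (q k)) ∧
  (∀ k ∈ K, ∀ k' ∈ K,
    (∫ θ in Set.Icc (0:ℝ) 1, q k θ * q k' θ) = if k = k' then 1 else 0) ∧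
  (∀ x ∈ Set.Icc (0:ℝ) 1, ∀ y ∈ Set.Icc (0:ℝ) 1,
    HasSum (fun k : K => ev k * q k x * q k y) (f x y))

/-- A graphon kernel: a measurable symmetric function `[0,1]² → [−1,1]`. -/
def IsGraphonKernel (f : ℝ → ℝ → ℝ) : Prop :=
  Measurable (Function.uncurry f) ∧ (∀ x y, f x y = f y x) ∧
  (∀ x ∈ Set.Icc (0:ℝ) 1, ∀ y ∈ Set.Icc (0:ℝ) 1, f x y ∈ Set.Icc (-1:ℝ) 1)

/-- The class `F_λ`: graphon kernels admitting a spectral decomposition whose nonzero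
eigenvalues all have absolute value at least `lam`, the minimum being exactly `lam`. -/
def MemFLam (lam : ℝ) (f : ℝ → ℝ → ℝ) : Prop :=
  IsGraphonKernel f ∧
  ∃ K ev q, IsSpectralDecomp f K ev q ∧
    (∀ k ∈ K, lam ≤ |ev k|) ∧ (∃ k ∈ K, |ev k| = lam)

/-- Sample space of the centered graphon model: latent variables `θ i`, auxiliary uniforms used
to generate the `±1` entries `Y i j`, and auxiliary uniforms used to generate the Bernoulli(p)
observation mask. -/
abbrev GraphonSpace (n : ℕ) :=
  (Fin n → ℝ) × ((Fin n × Fin n) → ℝ) × ((Fin n × Fin n) → ℝ)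

/-- The canonical probability measure of the centered graphon model: all coordinates are
i.i.d. uniform on `[0,1]`. -/
noncomputable def graphonMeasure (n : ℕ) : Measure (GraphonSpace n) :=
  (Measure.pi fun _ : Fin n => volume.restrict (Set.Icc (0:ℝ) 1)).prod
    ((Measure.pi fun _ : Fin n × Fin n => volume.restrict (Set.Icc (0:ℝ) 1)).prod
      (Measure.pi fun _ : Fin n × Fin n => volume.restrict (Set.Icc (0:ℝ) 1)))

/-- The (centered) data matrix entry: `+1` with conditional probability `(1 + f(θ_i,θ_j))/2`
and `−1` otherwise. -/
noncomputable def graphonY {n : ℕ} (f : ℝ → ℝ → ℝ) (ω : GraphonSpace n) (i j : Fin n) : ℝ :=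
  if ω.2.1 (i, j) ≤ (1 + f (ω.1 i) (ω.1 j)) / 2 then 1 else -1

/-- The observation available to the estimator at entry `(i,j)`: each entry is observed
independently with probability `p`; an observed entry is reported as `(true, Y i j)` and an
unobserved one as `(false, 0)`. -/
noncomputable def graphonObs {n : ℕ} (p : ℝ) (f : ℝ → ℝ → ℝ) (ω : GraphonSpace n) :
    Fin n → Fin n → Bool × ℝ :=
  fun i j => if ω.2.2 (i, j) ≤ p then (true, graphonY f ω i j) else (false, 0)


section
open MeasureTheory

namespace GLB

instance instMSOptBool : MeasurableSpace (Option Bool) := ⊤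

instance instMSCOptBool : DiscreteMeasurableSpace (Option Bool) := ⟨fun _ => trivial⟩

/-- likelihood of an observation symbol given kernel value `m` -/
noncomputable def lik (p m : ℝ) : Option Bool → ℝ
  | none => 1 - p
  | some true => p * (1 + m) / 2
  | some false => p * (1 - m) / 2

noncomputable def dec : Option Bool → Bool × ℝ
  | none => (false, 0)
  | some true => (true, 1)
  | some false => (true, -1)

open Classical in
noncomputable def enc {n : ℕ} (p : ℝ) (f : ℝ → ℝ → ℝ) (ω : GraphonSpace n) :
    Fin n × Fin n → Option Bool :=
  fun e => if ω.2.2 e ≤ p then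
    some (decide (ω.2.1 e ≤ (1 + f (ω.1 e.1) (ω.1 e.2)) / 2)) else none

lemma obs_eq {n : ℕ} (p : ℝ) (f : ℝ → ℝ → ℝ) (ω : GraphonSpace n) :
    graphonObs p f ω = fun i j => dec (enc p f ω (i, j)) := by
  funext i j
  unfold graphonObs graphonY enc
  by_cases h : ω.2.2 (i, j) ≤ p
  · by_cases h' : ω.2.1 (i, j) ≤ (1 + f (ω.1 i) (ω.1 j)) / 2
    · simp [h, h', dec]
    · simp [h, h', dec]
  · simp [h, dec]

noncomputable abbrev U01 : Measure ℝ := volume.restrict (Set.Icc (0:ℝ) 1)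

instance : IsProbabilityMeasure U01 := ⟨by simp [U01]⟩

lemma U01_le {a : ℝ} (h0 : 0 ≤ a) (h1 : a ≤ 1) : U01.real {u | u ≤ a} = a := by
  have : ({u : ℝ | u ≤ a} ∩ Set.Icc (0:ℝ) 1) = Set.Icc 0 a := by
    ext x; simp only [Set.mem_inter_iff, Set.mem_ofPred_eq, Set.mem_Icc]
    constructor
    · rintro ⟨h, h', _⟩; exact ⟨h', h⟩
    · rintro ⟨h, h'⟩; exact ⟨h', h, h'.trans h1⟩
  rw [measureReal_def, Measure.restrict_apply (by exact measurableSet_Iic), this]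
  simp [h0]

lemma U01_gt {a : ℝ} (h0 : 0 ≤ a) (h1 : a ≤ 1) : U01.real {u | ¬ u ≤ a} = 1 - a := by
  have := probReal_compl_eq_one_sub (μ := U01) (s := {u | u ≤ a}) measurableSet_Iic
  rw [U01_le h0 h1] at this
  exact this

/-- existence of a discretising map -/
lemma exists_tau {T : Type} [Fintype T] [DecidableEq T] [Nonempty T] [MeasurableSpace T]
    [MeasurableSingletonClass T]
    (π : T → ℝ) (h0 : ∀ t, 0 ≤ π t) (h1 : ∑ t, π t = 1) :
    ∃ τ : ℝ → T, Measurable τ ∧ ∀ t, U01.real (τ ⁻¹' {t}) = π t := by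
  classical
  let μ : Measure T := ∑ t, ENNReal.ofReal (π t) • Measure.dirac t
  have hμ : ∀ t, μ {t} = ENNReal.ofReal (π t) := by
    intro t
    simp [μ, Measure.finsetSum_apply, Set.indicator_apply]
  have : IsProbabilityMeasure μ := ⟨by
    have : μ Set.univ = ∑ t, ENNReal.ofReal (π t) := by
      simp [μ, Measure.finsetSum_apply]
    rw [this, ← ENNReal.ofReal_sum_of_nonneg (fun t _ => h0 t), h1]; simp⟩
  have : StandardBorelSpace T := inferInstance
  obtain ⟨g, hg, hgm⟩ := Measure.exists_measurable_map_eq μ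
  refine ⟨fun x => g (Set.projIcc 0 1 zero_le_one x), ?_, ?_⟩
  · exact hg.comp (continuous_projIcc.measurable)
  · intro t
    have e1 : μ {t} = volume (g ⁻¹' {t}) := by
      rw [← hgm, Measure.map_apply hg (measurableSet_singleton t)]
    have hm : MeasurableSet (g ⁻¹' {t}) := hg (measurableSet_singleton t)
    have e2 : volume (g ⁻¹' {t}) = volume (Subtype.val '' (g ⁻¹' {t}) : Set ℝ) := by
      rw [Measure.Subtype.volume_def]
      exact comap_subtype_coe_apply measurableSet_Icc _ _
    have hm2 : MeasurableSet ((fun x => g (Set.projIcc 0 1 zero_le_one x)) ⁻¹' {t}) :=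
      (hg.comp (continuous_projIcc.measurable)) (measurableSet_singleton t)
    have e3 : ((fun x => g (Set.projIcc 0 1 zero_le_one x)) ⁻¹' {t}) ∩ Set.Icc (0:ℝ) 1
        = Subtype.val '' (g ⁻¹' {t}) := by
      ext x
      constructor
      · rintro ⟨h, hx⟩
        refine ⟨⟨x, hx⟩, ?_, rfl⟩
        simpa [Set.projIcc_of_mem zero_le_one hx] using h
      · rintro ⟨y, hy, rfl⟩
        refine ⟨?_, y.2⟩
        simpa using hy
    rw [measureReal_def, Measure.restrict_apply hm2, e3, ← e2, ← e1, hμ, ENNReal.toReal_ofReal (h0 t)]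

/-- product expression of the finite model -/
noncomputable def wt {T : Type} {n : ℕ} (π : T → ℝ) (p : ℝ) (M : T → T → ℝ)
    (t : Fin n → T) (o : Fin n × Fin n → Option Bool) : ℝ :=
  (∏ i, π (t i)) * ∏ e : Fin n × Fin n, lik p (M (t e.1) (t e.2)) (o e)

lemma enc_measurable {n : ℕ} (p : ℝ) (f : ℝ → ℝ → ℝ) (hf : Measurable (Function.uncurry f)) :
    Measurable (enc p f : GraphonSpace n → _) := by
  classical
  refine measurable_pi_lambda _ fun e => ?_
  have hf' : Measurable fun ω : GraphonSpace n => f (ω.1 e.1) (ω.1 e.2) := by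
    have : (fun ω : GraphonSpace n => f (ω.1 e.1) (ω.1 e.2)) =
      Function.uncurry f ∘ fun ω : GraphonSpace n => (ω.1 e.1, ω.1 e.2) := rfl
    rw [this]; exact hf.comp (by fun_prop)
  unfold enc
  refine Measurable.ite (measurableSet_le (by fun_prop) measurable_const) ?_ measurable_const
  have : Measurable fun ω : GraphonSpace n => decide (ω.2.1 e ≤ (1 + f (ω.1 e.1) (ω.1 e.2)) / 2) := by
    have h := measurableSet_le (f := fun ω : GraphonSpace n => ω.2.1 e)
      (g := fun ω : GraphonSpace n => (1 + f (ω.1 e.1) (ω.1 e.2)) / 2) (by fun_prop) (by fun_prop)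
    refine measurable_to_bool ?_
    convert h using 1
    ext ω; simp
  exact (Measurable.of_discrete (f := (some : Bool → Option Bool))).comp this

theorem reduce {T : Type} [Fintype T] [DecidableEq T] [MeasurableSpace T]
    [MeasurableSingletonClass T] {n : ℕ} {p : ℝ} (hp : p ∈ Set.Ioc (0:ℝ) 1)
    (π : T → ℝ) (τ : ℝ → T) (hτ : Measurable τ) (hπ : ∀ t, U01.real (τ ⁻¹' {t}) = π t)
    (M : T → T → ℝ) (hM : ∀ x y, |M x y| ≤ 1)
    (G : (Fin n → T) → (Fin n × Fin n → Option Bool) → ℝ) :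
    ∫ ω, G (fun i => τ (ω.1 i)) (enc p (fun x y => M (τ x) (τ y)) ω) ∂(graphonMeasure n)
      = ∑ t, ∑ o, wt π p M t o * G t o := by
  classical
  set f : ℝ → ℝ → ℝ := fun x y => M (τ x) (τ y) with hf
  have hfm : Measurable (Function.uncurry f) := by
    have : Function.uncurry f = (fun x : T × T => M x.1 x.2) ∘ (fun x : ℝ × ℝ => (τ x.1, τ x.2)) := rfl
    rw [this]
    exact (Measurable.of_discrete).comp (by fun_prop)
  let Φ : GraphonSpace n → (Fin n → T) × (Fin n × Fin n → Option Bool) :=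
    fun ω => (fun i => τ (ω.1 i), enc p f ω)
  have hΦ : Measurable Φ := by
    refine Measurable.prodMk ?_ (enc_measurable p f hfm)
    fun_prop
  have : IsProbabilityMeasure (graphonMeasure n) := by unfold graphonMeasure; infer_instance
  have key : ∀ x, (Measure.map Φ (graphonMeasure n)).real {x} = wt π p M x.1 x.2 := by
    rintro ⟨t, o⟩
    rw [measureReal_def, Measure.map_apply hΦ (measurableSet_singleton _), ]
    have hset : Φ ⁻¹' {(t, o)} = (Set.univ.pi fun i => τ ⁻¹' {t i}) ×ˢ
        ((Set.univ.pi fun e : Fin n × Fin n => 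
            match o e with
            | none => Set.univ
            | some true => {u : ℝ | u ≤ (1 + M (t e.1) (t e.2)) / 2}
            | some false => {u : ℝ | ¬ u ≤ (1 + M (t e.1) (t e.2)) / 2}) ×ˢ
          (Set.univ.pi fun e : Fin n × Fin n => 
            match o e with
            | none => {u : ℝ | ¬ u ≤ p}
            | some _ => {u : ℝ | u ≤ p})) := by
      ext ω
      simp only [Set.mem_preimage, Set.mem_singleton_iff, Set.mem_prod, Set.mem_univ_pi, Φ,
        Prod.mk.injEq]
      constructor
      · rintro ⟨h1, h2⟩
        have h1' : ∀ i, τ (ω.1 i) = t i := fun i => congrFun h1 i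
        refine ⟨h1', ?_, ?_⟩
        · intro e
          have := congrFun h2 e
          rw [← this]
          simp only [enc, hf, h1']
          by_cases a : ω.2.2 e ≤ p
          · by_cases b : ω.2.1 e ≤ (1 + M (t e.1) (t e.2)) / 2
            · simp [a, b]
            · simpa [a, b] using lt_of_not_ge b
          · simp [a]
        · intro e
          have := congrFun h2 e
          rw [← this]
          simp only [enc, hf, h1']
          by_cases a : ω.2.2 e ≤ p
          · simp [a]
          · simpa [a] using lt_of_not_ge a
      · rintro ⟨h1, h2, h3⟩
        refine ⟨funext h1, funext fun e => ?_⟩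
        have h2 := h2 e
        have h3 := h3 e
        simp only [enc, hf, h1]
        rcases ho : o e with _ | b
        · rw [ho] at h2 h3; simp only [Set.mem_ofPred_eq] at h3
          simp [h3]
        · rcases b with _ | _
          · rw [ho] at h2 h3; simp only [Set.mem_ofPred_eq] at h2 h3
            simp [h3, h2]
          · rw [ho] at h2 h3; simp only [Set.mem_ofPred_eq] at h2 h3
            simp [h3, h2]
    rw [hset]
    unfold graphonMeasure
    rw [Measure.prod_prod, Measure.prod_prod, Measure.pi_pi, Measure.pi_pi, Measure.pi_pi]
    rw [ENNReal.toReal_mul, ENNReal.toReal_mul, ENNReal.toReal_prod, ENNReal.toReal_prod,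
      ENNReal.toReal_prod, ← Finset.prod_mul_distrib]
    unfold wt
    congr 1
    · exact Finset.prod_congr rfl fun i _ => hπ _
    · refine Finset.prod_congr rfl fun e _ => ?_
      have hm := abs_le.1 (hM (t e.1) (t e.2))
      have ha : 0 ≤ (1 + M (t e.1) (t e.2)) / 2 := by linarith
      have hb : (1 + M (t e.1) (t e.2)) / 2 ≤ 1 := by linarith
      simp only [← measureReal_def]
      rcases ho : o e with _ | b
      · simp only [lik]
        rw [U01_gt hp.1.le hp.2]; simp
      · rcases b with _ | _
        · simp only [lik]; rw [U01_gt ha hb, U01_le hp.1.le hp.2]; ring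
        · simp only [lik]; rw [U01_le ha hb, U01_le hp.1.le hp.2]; ring
  have h1 : ∫ ω, G (fun i => τ (ω.1 i)) (enc p f ω) ∂(graphonMeasure n)
      = ∫ x, G x.1 x.2 ∂(Measure.map Φ (graphonMeasure n)) := by
    rw [integral_map hΦ.aemeasurable]
    exact (Measurable.of_discrete).aestronglyMeasurable
  rw [h1, integral_fintype, Fintype.sum_prod_type]
  · refine Finset.sum_congr rfl fun t _ => Finset.sum_congr rfl fun o _ => ?_
    rw [key]; rfl
  · have : IsProbabilityMeasure (Measure.map Φ (graphonMeasure n)) :=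
      Measure.isProbabilityMeasure_map hΦ.aemeasurable
    exact Integrable.of_finite

end GLB

end

section
open MeasureTheory

namespace GLB

section spectral
variable {T : Type} [Fintype T] [DecidableEq T] [MeasurableSpace T] [MeasurableSingletonClass T]

lemma int_tau (π : T → ℝ) (τ : ℝ → T) (hτ : Measurable τ)
    (hπ : ∀ t, U01.real (τ ⁻¹' {t}) = π t) (g : T → ℝ) :
    ∫ θ in Set.Icc (0:ℝ) 1, g (τ θ) = ∑ t, π t * g t := by
  have h1 : ∫ θ in Set.Icc (0:ℝ) 1, g (τ θ) = ∫ x, g x ∂(Measure.map τ U01) := by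
    rw [integral_map hτ.aemeasurable]
    exact (Measurable.of_discrete).aestronglyMeasurable
  have : IsProbabilityMeasure (Measure.map τ U01) :=
      Measure.isProbabilityMeasure_map hτ.aemeasurable
  rw [h1, integral_fintype Integrable.of_finite]
  refine Finset.sum_congr rfl fun t _ => ?_
  rw [measureReal_def, Measure.map_apply hτ (measurableSet_singleton _), ← measureReal_def, hπ]
  rfl

lemma memFLam_of_eigen (π : T → ℝ) (τ : ℝ → T) (hτ : Measurable τ)
    (hπ : ∀ t, U01.real (τ ⁻¹' {t}) = π t) (M : T → T → ℝ) (hM : ∀ x y, |M x y| ≤ 1)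
    (hsym : ∀ x y, M x y = M y x) (lam : ℝ) (hlam : 0 < lam)
    {ι : Type} [Fintype ι] [DecidableEq ι] (ev : ι → ℝ) (q : ι → T → ℝ)
    (hdec : ∀ x y, M x y = ∑ k, ev k * q k x * q k y)
    (horth : ∀ k k', ev k ≠ 0 → ev k' ≠ 0 → ∑ t, π t * (q k t * q k' t) = if k = k' then 1 else 0)
    (hev : ∀ k, ev k = 0 ∨ lam ≤ |ev k|) (hex : ∃ k, |ev k| = lam) :
    MemFLam lam (fun x y => M (τ x) (τ y)) := by
  classical
  refine ⟨⟨?_, fun x y => hsym _ _, fun x _ y _ => abs_le.1 (hM _ _)⟩, ?_⟩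
  · have : (Function.uncurry fun x y => M (τ x) (τ y))
      = (fun x : T × T => M x.1 x.2) ∘ (fun x : ℝ × ℝ => (τ x.1, τ x.2)) := rfl
    rw [this]
    exact (Measurable.of_discrete).comp (by fun_prop)
  · let g : ι → ℕ := fun k => (Fintype.equivFin ι k : ℕ)
    have hg : Function.Injective g := fun a b h =>
      (Fintype.equivFin ι).injective (Fin.ext h)
    obtain ⟨k0, hk0⟩ := hex
    let inv : ℕ → ι := fun m => if h : ∃ k, g k = m then h.choose else k0
    have hinv : ∀ k, inv (g k) = k := by
      intro k
      have h : ∃ k', g k' = g k := ⟨k, rfl⟩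
      have : inv (g k) = h.choose := by simp only [inv]; exact dif_pos h
      rw [this]; exact hg h.choose_spec
    let K : Set ℕ := g '' {k | ev k ≠ 0}
    have hk0' : ev k0 ≠ 0 := by
      intro h; rw [h] at hk0; simp at hk0; linarith
    refine ⟨K, fun m => ev (inv m), fun m x => q (inv m) (τ x), ⟨?_, ?_, ?_, ?_⟩, ?_, ?_⟩
    · rintro _ ⟨k, hk, rfl⟩; simpa [hinv] using hk
    · rintro _ ⟨k, hk, rfl⟩
      exact (Measurable.of_discrete (f := q (inv (g k)))).comp hτ
    · rintro _ ⟨k, hk, rfl⟩ _ ⟨k', hk', rfl⟩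
      simp only [hinv]
      rw [int_tau π τ hτ hπ (fun t => q k t * q k' t), horth k k' hk hk']
      simp [hg.eq_iff]
    · intro x _ y _
      let e : {k // ev k ≠ 0} ≃ K := Equiv.Set.image g {k | ev k ≠ 0} hg
      have h2 : HasSum ((fun k : K => ev (inv k) * q (inv k) (τ x) * q (inv k) (τ y)) ∘ e)
          (M (τ x) (τ y)) := by
        have he : ((fun k : K => ev (inv k) * q (inv k) (τ x) * q (inv k) (τ y)) ∘ e)
          = fun k : {k // ev k ≠ 0} => ev k * q k (τ x) * q k (τ y) := by
          funext k
          have : ((e k : K) : ℕ) = g k := rfl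
          simp only [Function.comp, this, hinv]
        rw [he, hdec]
        have hs : ∑ k, ev k * q k (τ x) * q k (τ y)
            = ∑ k : {k // ev k ≠ 0}, ev k * q k (τ x) * q k (τ y) := by
          rw [← Finset.sum_subtype (Finset.univ.filter fun k => ev k ≠ 0) (by simp)
            (fun k => ev k * q k (τ x) * q k (τ y)), Finset.sum_filter]
          refine Finset.sum_congr rfl fun k _ => ?_
          by_cases h : ev k = 0
          · simp [h]
          · simp [h]
        rw [hs]
        exact hasSum_fintype _
      exact (Equiv.hasSum_iff e).1 h2
    · rintro _ ⟨k, hk, rfl⟩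
      simp only [hinv]
      exact (hev k).resolve_left hk
    · exact ⟨g k0, ⟨k0, hk0', rfl⟩, by simpa [hinv] using hk0⟩

/-- spectral lemma for kernels given by orthonormal features -/
lemma memFLam_of_features (π : T → ℝ) (τ : ℝ → T) (hτ : Measurable τ)
    (hπ : ∀ t, U01.real (τ ⁻¹' {t}) = π t) (M : T → T → ℝ) (hM : ∀ x y, |M x y| ≤ 1)
    (lam : ℝ) (hlam : 0 < lam)
    {J I : Type} [Fintype J] [DecidableEq J] [DecidableEq I] (φ : I → T → ℝ)
    (a b : J → I) (ν : J → ℝ)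
    (hdec : ∀ x y, M x y = ∑ j, ν j * (if a j = b j then φ (a j) x * φ (b j) y else
        (φ (a j) x * φ (b j) y + φ (b j) x * φ (a j) y)))
    (horth : ∀ i k, i ≠ k → ∑ t, π t * (φ i t * φ k t) = 0)
    (hna : ∀ j, ν j ≠ 0 → ∑ t, π t * (φ (a j) t * φ (a j) t) = 1)
    (hnb : ∀ j, ν j ≠ 0 → ∑ t, π t * (φ (b j) t * φ (b j) t) = 1)
    (hdis : ∀ j j', j ≠ j' → a j ≠ a j' ∧ a j ≠ b j' ∧ b j ≠ a j' ∧ b j ≠ b j')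
    (hev : ∀ j, ν j = 0 ∨ lam ≤ |ν j|) (hex : ∃ j, |ν j| = lam) :
    MemFLam lam (fun x y => M (τ x) (τ y)) := by
  classical
  let r : ℝ := (Real.sqrt 2)⁻¹
  have hr : r * r = 1 / 2 := by
    simp only [r]; rw [← mul_inv, Real.mul_self_sqrt (by norm_num)]; norm_num
  let ev : J × Bool → ℝ := fun k => if k.2 then ν k.1 else if a k.1 = b k.1 then 0 else - ν k.1
  let q : J × Bool → T → ℝ := fun k x => if a k.1 = b k.1 then φ (a k.1) x else
    r * (φ (a k.1) x + (if k.2 then 1 else -1) * φ (b k.1) x)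
  have bil : ∀ (i k i' k' : I) (s s' : ℝ), ∑ t, π t * ((r * (φ i t + s * φ k t)) *
      (r * (φ i' t + s' * φ k' t))) = 1/2 * (∑ t, π t * (φ i t * φ i' t)
      + s' * ∑ t, π t * (φ i t * φ k' t) + s * ∑ t, π t * (φ k t * φ i' t)
      + s * s' * ∑ t, π t * (φ k t * φ k' t)) := by
    intro i k i' k' s s'
    simp only [Finset.mul_sum, ← Finset.sum_add_distrib]
    refine Finset.sum_congr rfl fun t _ => ?_
    rw [← hr]; ring
  have bil1 : ∀ (i i' k' : I) (s' : ℝ), ∑ t, π t * (φ i t *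
      (r * (φ i' t + s' * φ k' t))) = r * (∑ t, π t * (φ i t * φ i' t)
      + s' * ∑ t, π t * (φ i t * φ k' t)) := by
    intro i i' k' s'
    simp only [Finset.mul_sum, ← Finset.sum_add_distrib]
    refine Finset.sum_congr rfl fun t _ => ?_
    ring
  have bil2 : ∀ (i i' k' : I) (s' : ℝ), ∑ t, π t * ((r * (φ i' t + s' * φ k' t)) * φ i t)
       = r * (∑ t, π t * (φ i t * φ i' t)
      + s' * ∑ t, π t * (φ i t * φ k' t)) := by
    intro i i' k' s'
    rw [← bil1]
    refine Finset.sum_congr rfl fun t _ => ?_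
    ring
  refine memFLam_of_eigen π τ hτ hπ M hM ?_ lam hlam ev q ?_ ?_ ?_ ?_
  · intro x y
    rw [hdec, hdec]
    refine Finset.sum_congr rfl fun j _ => ?_
    split_ifs with h
    · rw [h]; ring
    · ring
  · intro x y
    rw [hdec, Fintype.sum_prod_type]
    refine Finset.sum_congr rfl fun j _ => ?_
    simp only [Fintype.sum_bool, ev, q]
    by_cases h : a j = b j
    · simp [h]; ring
    · simp only [h, if_false, if_true, Bool.false_eq_true]
      have : ∀ A B C D : ℝ, ν j * (r * (A + 1 * B)) * (r * (C + 1 * D)) +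
        -ν j * (r * (A + (-1) * B)) * (r * (C + (-1) * D)) = ν j * (r * r) * 2 * (A * D + B * C) := by
        intros; ring
      rw [this, hr]; ring
  · rintro ⟨j, s⟩ ⟨j', s'⟩ h h'
    have hj : ν j ≠ 0 := by
      intro hh; apply h; simp only [ev, hh]; split_ifs <;> simp
    have hj' : ν j' ≠ 0 := by
      intro hh; apply h'; simp only [ev, hh]; split_ifs <;> simp
    by_cases hjj : j = j'
    · subst hjj
      by_cases hab : a j = b j
      · have hs : s = true := by
          by_contra hs; apply h; simp [ev, hab, hs]
        have hs' : s' = true := by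
          by_contra hs; apply h'; simp [ev, hab, hs]
        subst hs; subst hs'
        simp only [q, if_pos hab, if_true]
        exact hna j hj
      · simp only [q, if_neg hab]
        rw [bil, hna j hj, hnb j hj, horth _ _ hab, horth _ _ (Ne.symm hab)]
        rcases s with _ | _ <;> rcases s' with _ | _ <;> norm_num
    · obtain ⟨h1, h2, h3, h4⟩ := hdis j j' hjj
      rw [if_neg (by intro hh; exact hjj (congrArg Prod.fst hh))]
      simp only [q]
      by_cases hab : a j = b j
      · by_cases hab' : a j' = b j'
        · simp only [if_pos hab, if_pos hab', horth _ _ h1]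
        · simp only [if_pos hab, if_neg hab', bil1, horth _ _ h1, horth _ _ h2]; ring
      · by_cases hab' : a j' = b j'
        · simp only [if_neg hab, if_pos hab', bil2, horth _ _ h1.symm, horth _ _ h3.symm]; ring
        · simp only [if_neg hab, if_neg hab', bil, horth _ _ h1, horth _ _ h2, horth _ _ h3,
            horth _ _ h4]; ring
  · rintro ⟨j, s⟩
    rcases hev j with h | h
    · left; simp only [ev, h]; split_ifs <;> simp
    · simp only [ev]
      split_ifs
      · right; exact h
      · left; rfl
      · right; simpa using h
  · obtain ⟨j, hj⟩ := hex
    exact ⟨(j, true), by simpa [ev] using hj⟩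

end spectral
end GLB

end

section
namespace GLB

section bayes

lemma sum_prod_pi {E A : Type} [Fintype E] [DecidableEq E] [Fintype A] (h : E → A → ℝ) :
    ∑ o : E → A, ∏ e, h e (o e) = ∏ e, ∑ a, h e a := by
  rw [Finset.prod_univ_sum, Fintype.piFinset_univ]

lemma fiber_factor {E A V K : Type} [Fintype E] [DecidableEq E] [Fintype A] [Fintype V]
    [DecidableEq V] [Fintype K]
    (ν : E → V) (c : V → K → ℝ) (g : K → E → A → ℝ) :
    ∑ o : E → A, ∏ v, ∑ k, c v k * ∏ e ∈ Finset.univ.filter (fun e => ν e = v), g k e (o e)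
      = ∏ v, ∑ k, c v k * ∏ e ∈ Finset.univ.filter (fun e => ν e = v), ∑ a, g k e a := by
  have key : ∀ G : K → E → ℝ, ∏ v, ∑ k, c v k * ∏ e ∈ Finset.univ.filter (fun e => ν e = v), G k e
      = ∑ κ : V → K, (∏ v, c v (κ v)) * ∏ e, G (κ (ν e)) e := by
    intro G
    rw [← sum_prod_pi]
    refine Finset.sum_congr rfl fun κ _ => ?_
    rw [Finset.prod_mul_distrib]
    congr 1
    rw [← Finset.prod_fiberwise (Finset.univ) ν (fun e => G (κ (ν e)) e)]
    refine Finset.prod_congr rfl fun v _ => ?_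
    refine Finset.prod_congr rfl fun e he => ?_
    rw [(Finset.mem_filter.1 he).2]
  simp only [key]
  rw [Finset.sum_comm]
  refine Finset.sum_congr rfl fun κ _ => ?_
  rw [← Finset.mul_sum, sum_prod_pi (fun e a => g (κ (ν e)) e a)]

/-- three-point prior -/
noncomputable def pw (w : ℝ) : SignType → ℝ
  | 0 => 1 - w
  | 1 => w / 2
  | -1 => w / 2

lemma sum_sign (f : SignType → ℝ) : ∑ z, f z = f 0 + f (-1) + f 1 := by
  rw [show (Finset.univ : Finset SignType) = {0, -1, 1} from rfl]
  rw [Finset.sum_insert (by decide), Finset.sum_insert (by decide), Finset.sum_singleton]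
  ring

lemma pw_sum (w : ℝ) : ∑ z, pw w z = 1 := by
  rw [sum_sign]; simp only [pw]; ring

lemma pw_nonneg {w : ℝ} (h0 : 0 ≤ w) (h1 : w ≤ 1) (z : SignType) : 0 ≤ pw w z := by
  rcases z with _ | _ | _ <;> simp only [pw] <;> linarith

noncomputable def cons (p s : ℝ) : Option Bool → ℝ
  | none => 1 - p
  | some true => p * (1 + s) / 4
  | some false => p * (1 - s) / 4

noncomputable def nn (p : ℝ) : Option Bool → ℝ
  | none => 1 - p
  | some _ => 0

lemma sum_opt (f : Option Bool → ℝ) : ∑ a, f a = f none + f (some true) + f (some false) := by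
  simp [Fintype.sum_option]; ring

lemma lik_sum (p m : ℝ) : ∑ a, lik p m a = 1 := by
  rw [sum_opt]; simp only [lik]; ring

lemma cons_sum (p m : ℝ) : ∑ a, cons p m a = 1 - p / 2 := by
  rw [sum_opt]; simp only [cons]; ring

lemma nn_sum (p : ℝ) : ∑ a, nn p a = 1 - p := by
  rw [sum_opt]; simp only [nn]; ring

lemma lik_nonneg {p m : ℝ} (h0 : 0 ≤ p) (h1 : p ≤ 1) (hm : |m| ≤ 1) (a) : 0 ≤ lik p m a := by
  have := abs_le.1 hm
  rcases a with _ | _ | _ <;> simp only [lik]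
  · linarith
  · have := mul_nonneg h0 (by linarith : 0 ≤ 1 - m); linarith
  · have := mul_nonneg h0 (by linarith : 0 ≤ 1 + m); linarith

variable {E : Type} [Fintype E] [DecidableEq E]

/-- product facts on a fiber -/
lemma fiber_facts {p : ℝ} (h0 : 0 ≤ p) (h1 : p ≤ 1) (F : Finset E) (s : E → ℝ)
    (hs : ∀ e, s e = 1 ∨ s e = -1) (o : E → Option Bool) (hob : ∃ e ∈ F, o e ≠ none) :
    (∏ e ∈ F, cons p (s e) (o e) = 0 ∨ ∏ e ∈ F, cons p (s e) (o e) = ∏ e ∈ F, lik p 0 (o e)) ∧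
    (∏ e ∈ F, cons p (s e) (o e)) * (∏ e ∈ F, cons p (-s e) (o e)) = 0 ∧
    2 * ∏ e ∈ F, cons p (s e) (o e) ≤ ∏ e ∈ F, lik p (s e) (o e) ∧
    ∏ e ∈ F, nn p (o e) = 0 := by
  obtain ⟨e0, he0, ho⟩ := hob
  have c0 : ∀ e, 0 ≤ cons p (s e) (o e) := by
    intro e
    rcases hs e with h | h <;> rcases o e with _ | _ | _ <;> simp only [cons, h] <;> linarith
  have cl : ∀ e, cons p (s e) (o e) ≤ lik p (s e) (o e) := by
    intro e
    rcases hs e with h | h <;> rcases o e with _ | _ | _ <;> simp only [cons, lik, h] <;> linarith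
  refine ⟨?_, ?_, ?_, ?_⟩
  · by_cases h : ∃ e ∈ F, cons p (s e) (o e) = 0
    · left; obtain ⟨e, he, h⟩ := h; exact Finset.prod_eq_zero he h
    · right
      push Not at h
      refine Finset.prod_congr rfl fun e he => ?_
      have := h e he
      revert this
      rcases hs e with h | h <;> rcases o e with _ | _ | _ <;> simp only [cons, lik, h] <;>
        intro this <;> first | (exfalso; apply this; ring1) | ring1 | trivial
  · rw [← Finset.prod_mul_distrib]
    refine Finset.prod_eq_zero he0 ?_
    revert ho
    rcases hs e0 with h | h <;> rcases o e0 with _ | _ | _ <;> simp [cons, h]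
  · rw [← Finset.mul_prod_erase F _ he0, ← Finset.mul_prod_erase F _ he0, ← mul_assoc]
    have : 2 * cons p (s e0) (o e0) = lik p (s e0) (o e0) := by
      revert ho
      rcases o e0 with _ | _ | _ <;> simp only [cons, lik] 
      · intro h; exact absurd rfl h
      · intro _; ring
      · intro _; ring
    rw [this]
    refine mul_le_mul_of_nonneg_left ?_ ?_
    · exact Finset.prod_le_prod (fun e _ => c0 e) (fun e _ => cl e)
    · rw [← this]; linarith [c0 e0]
  · refine Finset.prod_eq_zero he0 ?_
    revert ho
    rcases o e0 with _ | _ | _ <;> simp [nn]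

noncomputable def eta (w : ℝ) : ℝ := max (w/2) (1-w) - 2*w + 1

/-- 0-1 loss pointwise bound -/
lemma point01 {p w : ℝ} (h0 : 0 ≤ p) (h1 : p ≤ 1) (hw : 1/2 ≤ w) (hw1 : w ≤ 1) (F : Finset E)
    (s : E → ℝ) (hs : ∀ e, s e = 1 ∨ s e = -1) (o : E → Option Bool) (z : SignType) :
    pw w z * ∏ e ∈ F, lik p (s e * (z : ℝ)) (o e) ≤
      w/2 * ∏ e ∈ F, lik p (s e) (o e) + w/2 * ∏ e ∈ F, lik p (- s e) (o e)
      + (1-w) * ∏ e ∈ F, lik p 0 (o e) + (-(1-w)) * ∏ e ∈ F, cons p (s e) (o e)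
      + (-(1-w)) * ∏ e ∈ F, cons p (- s e) (o e) + eta w * ∏ e ∈ F, nn p (o e) := by
  by_cases hob : ∃ e ∈ F, o e ≠ none
  · obtain ⟨a1, a2, a3, a4⟩ := fiber_facts h0 h1 F s hs o hob
    obtain ⟨b1, b2, b3, -⟩ := fiber_facts h0 h1 F (fun e => - s e)
      (fun e => by rcases hs e with h | h <;> simp [h]) o hob
    have l0 : 0 ≤ ∏ e ∈ F, lik p 0 (o e) :=
      Finset.prod_nonneg fun e _ => lik_nonneg h0 h1 (by simp) _
    have l1 : 0 ≤ ∏ e ∈ F, lik p (s e) (o e) :=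
      Finset.prod_nonneg fun e _ => lik_nonneg h0 h1 (by rcases hs e with h | h <;> simp [h]) _
    have l2 : 0 ≤ ∏ e ∈ F, lik p (-s e) (o e) :=
      Finset.prod_nonneg fun e _ => lik_nonneg h0 h1 (by rcases hs e with h | h <;> simp [h]) _
    rw [a4]
    clear a4 b2
    have z0 : pw w 0 = 1 - w := rfl
    have z1 : pw w 1 = w / 2 := rfl
    have z2 : pw w (-1) = w / 2 := rfl
    have hz : z = 0 ∨ z = 1 ∨ z = -1 := by rcases z with _ | _ | _ <;> decide
    generalize ∏ e ∈ F, cons p (s e) (o e) = C1 at *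
    generalize ∏ e ∈ F, cons p (-s e) (o e) = C2 at *
    have hC : C1 + C2 ≤ ∏ e ∈ F, lik p 0 (o e) := by
      rcases a1 with h | h <;> rcases b1 with h' | h' 
      · rw [h, h']; simpa using l0
      · rw [h, h']; simp
      · rw [h, h']; simp
      · rw [h, h'] at a2
        have : ∏ e ∈ F, lik p 0 (o e) = 0 := by simpa using a2
        rw [h, h', this]; simp
    rcases hz with h | h | h
    · subst h
      simp only [SignType.coe_zero, mul_zero, z0]
      nlinarith
    · subst h
      simp only [SignType.coe_one, mul_one, z1]
      nlinarith
    · subst h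
      simp only [SignType.coe_neg_one, mul_neg_one, z2]
      nlinarith
  · push Not at hob
    have e1 : ∀ f : E → Option Bool → ℝ, (∀ e, f e none = 1 - p) →
        ∏ e ∈ F, f e (o e) = ∏ e ∈ F, (1 - p) := fun f hf =>
      Finset.prod_congr rfl fun e he => by rw [hob e he, hf]
    rw [e1 (fun e => lik p (s e * z)) (fun e => rfl), e1 (fun e => lik p (s e)) (fun e => rfl),
      e1 (fun e => lik p (-s e)) (fun e => rfl), e1 (fun e => lik p 0) (fun e => rfl),
      e1 (fun e => cons p (s e)) (fun e => rfl), e1 (fun e => cons p (-s e)) (fun e => rfl),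
      e1 (fun e => nn p) (fun e => rfl)]
    have hX : 0 ≤ ∏ e ∈ F, (1 - p) := Finset.prod_nonneg fun _ _ => by linarith
    generalize ∏ e ∈ F, (1 - p) = X at *
    have : pw w z ≤ max (w/2) (1-w) := by
      rcases z with _ | _ | _ <;> simp [pw]
    have h := mul_le_mul_of_nonneg_right this hX
    unfold eta
    nlinarith

/-- squared loss pointwise bound -/
lemma point2 {p w : ℝ} (h0 : 0 ≤ p) (h1 : p ≤ 1) (hw : 1/2 ≤ w) (hw1 : w ≤ 1) (F : Finset E)
    (s : E → ℝ) (hs : ∀ e, s e = 1 ∨ s e = -1) (o : E → Option Bool) (d t : ℝ)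
    (ht : t = 1 ∨ t = -1) :
     w * (1-w) * ∏ e ∈ F, cons p (s e) (o e)
      + w * (1-w) * ∏ e ∈ F, cons p (- s e) (o e) ≤
    ∑ z : SignType, pw w z * (∏ e ∈ F, lik p (s e * (z : ℝ)) (o e)) * (d - t * z)^2 := by
  rw [sum_sign]
  have z0 : pw w 0 = 1 - w := rfl
  have z1 : pw w 1 = w / 2 := rfl
  have z2 : pw w (-1) = w / 2 := rfl
  simp only [SignType.coe_zero, mul_zero, SignType.coe_one, mul_one, SignType.coe_neg_one,
    mul_neg_one, z0, z1, z2]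
  by_cases hob : ∃ e ∈ F, o e ≠ none
  · obtain ⟨a1, a2, a3, a4⟩ := fiber_facts h0 h1 F s hs o hob
    obtain ⟨b1, b2, b3, -⟩ := fiber_facts h0 h1 F (fun e => - s e)
      (fun e => by rcases hs e with h | h <;> simp [h]) o hob
    have l0 : 0 ≤ ∏ e ∈ F, lik p 0 (o e) :=
      Finset.prod_nonneg fun e _ => lik_nonneg h0 h1 (by simp) _
    have l1 : 0 ≤ ∏ e ∈ F, lik p (s e) (o e) :=
      Finset.prod_nonneg fun e _ => lik_nonneg h0 h1 (by rcases hs e with h | h <;> simp [h]) _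
    have l2 : 0 ≤ ∏ e ∈ F, lik p (-s e) (o e) :=
      Finset.prod_nonneg fun e _ => lik_nonneg h0 h1 (by rcases hs e with h | h <;> simp [h]) _
    clear a4 b2
    generalize ∏ e ∈ F, cons p (s e) (o e) = C1 at *
    generalize ∏ e ∈ F, cons p (-s e) (o e) = C2 at *
    generalize ∏ e ∈ F, lik p (s e) (o e) = L1 at *
    generalize ∏ e ∈ F, lik p (-s e) (o e) = L2 at *
    generalize ∏ e ∈ F, lik p 0 (o e) = L0 at *
    have base : ∀ C L u : ℝ, 0 ≤ C → 2 * C ≤ L → (u = 1 ∨ u = -1) → w * (1-w) * C ≤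
        w/2 * L * (d - u)^2 + (1 - w) * C * d^2 := by
      intro C L u hC hL hu
      have e1 : w * C * (d-u)^2 ≤ w/2 * L * (d - u)^2 := by
        refine mul_le_mul_of_nonneg_right ?_ (sq_nonneg _)
        nlinarith
      have hu2 : u^2 = 1 := by rcases hu with h | h <;> rw [h] <;> norm_num
      have e2 : w * C * (d-u)^2 + (1 - w) * C * d^2 - w * (1-w) * C = C * (d - w*u)^2 := by
        linear_combination (w * C - C * w^2) * hu2
      nlinarith [mul_nonneg hC (sq_nonneg (d-w*u))]
    have n1 : 0 ≤ w/2 * L1 * (d - t)^2 := by positivity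
    have n2 : 0 ≤ w/2 * L2 * (d - -t)^2 := by positivity
    have n3 : 0 ≤ (1-w) * L0 * (d - 0)^2 := mul_nonneg (mul_nonneg (by linarith) l0) (sq_nonneg _)
    simp only [sub_zero] at *
    rcases a1 with h | h <;> rcases b1 with h' | h'
    · subst h; subst h'; linarith
    · subst h; subst h'
      have := base C2 L2 (-t) l0 b3 (by rcases ht with h | h <;> simp [h])
      linarith
    · subst h; subst h'
      have := base C1 L1 t l0 a3 ht
      linarith
    · subst h; subst h'
      have h00 : C2 = 0 := by simpa using a2
      subst h00
      linarith
  · push Not at hob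
    have e1 : ∀ f : E → Option Bool → ℝ, (∀ e, f e none = 1 - p) →
        ∏ e ∈ F, f e (o e) = ∏ e ∈ F, (1 - p) := fun f hf =>
      Finset.prod_congr rfl fun e he => by rw [hob e he, hf]
    rw [e1 (fun e => lik p (s e)) (fun e => rfl),
      e1 (fun e => lik p (-s e)) (fun e => rfl), e1 (fun e => lik p 0) (fun e => rfl),
      e1 (fun e => cons p (s e)) (fun e => rfl), e1 (fun e => cons p (-s e)) (fun e => rfl)]
    have hX : 0 ≤ ∏ e ∈ F, (1 - p) := Finset.prod_nonneg fun _ _ => by linarith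
    generalize ∏ e ∈ F, (1 - p) = X at *
    have ht2 : t^2 = 1 := by rcases ht with h | h <;> rw [h] <;> norm_num
    have : (1 - w) * X * (d - 0) ^ 2 + w / 2 * X * (d - -t) ^ 2 + w / 2 * X * (d - t) ^ 2
      = X * (d^2 + w) := by linear_combination (w * X) * ht2
    rw [this]
    nlinarith [mul_nonneg hX (sq_nonneg d), mul_nonneg hX (by nlinarith : 0 ≤ w * (2*w-1))]

end bayes
end GLB

end

section
namespace GLB

section bayes2
variable {E V : Type} [Fintype E] [DecidableEq E] [Fintype V] [DecidableEq V]

/-- value of an entry given the hidden variables -/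
noncomputable def val (ν : E → Option V) (s c0 : E → ℝ) (z : V → SignType) (e : E) : ℝ :=
  match ν e with
  | some v => s e * (z v : ℝ)
  | none => c0 e

abbrev fib (ν : E → Option V) (x : Option V) : Finset E := Finset.univ.filter fun e => ν e = x

noncomputable def gk (p : ℝ) (ν : E → Option V) (s c0 : E → ℝ) : Fin 6 → E → Option Bool → ℝ
  | 0, e => if ν e = none then lik p (c0 e) else lik p (s e)
  | 1, e => lik p (- s e)
  | 2, _ => lik p 0
  | 3, e => cons p (s e)
  | 4, e => cons p (- s e)
  | 5, _ => nn p

lemma gk0_none {p : ℝ} {ν : E → Option V} {s c0 : E → ℝ} (o : E → Option Bool) :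
    ∏ e ∈ fib ν none, gk p ν s c0 0 e (o e) = ∏ e ∈ fib ν none, lik p (c0 e) (o e) := by
  refine Finset.prod_congr rfl fun e he => ?_
  simp [gk, (Finset.mem_filter.1 he).2]

lemma gk0_some {p : ℝ} {ν : E → Option V} {s c0 : E → ℝ} (o : E → Option Bool) (v : V) :
    ∏ e ∈ fib ν (some v), gk p ν s c0 0 e (o e) = ∏ e ∈ fib ν (some v), lik p (s e) (o e) := by
  refine Finset.prod_congr rfl fun e he => ?_
  simp [gk, (Finset.mem_filter.1 he).2]

lemma gk_sum (p : ℝ) (ν : E → Option V) (s c0 : E → ℝ) (k : Fin 6) (e : E) :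
    ∑ a, gk p ν s c0 k e a = (![1, 1, 1, 1 - p/2, 1 - p/2, 1 - p] : Fin 6 → ℝ) k := by
  fin_cases k
  · simp only [gk]; split_ifs <;> exact lik_sum _ _
  · exact lik_sum _ _
  · exact lik_sum _ _
  · exact cons_sum _ _
  · exact cons_sum _ _
  · exact nn_sum _

/-- factorisation of the likelihood over the fibers -/
lemma lik_factor {p : ℝ} (ν : E → Option V) (s c0 : E → ℝ) (z : V → SignType)
    (o : E → Option Bool) :
    ∏ e, lik p (val ν s c0 z e) (o e) = (∏ e ∈ fib ν none, lik p (c0 e) (o e)) *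
      ∏ v, ∏ e ∈ fib ν (some v), lik p (s e * (z v : ℝ)) (o e) := by
  rw [← Finset.prod_fiberwise Finset.univ ν, Fintype.prod_option]
  congr 1
  · refine Finset.prod_congr rfl fun e he => ?_
    simp [val, (Finset.mem_filter.1 he).2]
  · refine Finset.prod_congr rfl fun v _ => Finset.prod_congr rfl fun e he => ?_
    simp [val, (Finset.mem_filter.1 he).2]

/-- the success factor -/
noncomputable def Sfac (w p : ℝ) (m : ℕ) : ℝ :=
  if m = 0 then 1 else 1 - 2 * (1 - w) * (1 - p/2)^m + eta w * (1 - p)^m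

open Classical in
theorem bayes01 {p : ℝ} (h0 : 0 ≤ p) (h1 : p ≤ 1) (w : V → ℝ) (hw : ∀ v, 1/2 ≤ w v)
    (hw1 : ∀ v, w v ≤ 1) (ν : E → Option V) (s c0 : E → ℝ) (hs : ∀ e, s e = 1 ∨ s e = -1)
    (hc : ∀ e, |c0 e| ≤ 1) (δ : (E → Option Bool) → E → ℝ) :
    1 - ∏ v, Sfac (w v) p (fib ν (some v)).card ≤
    ∑ z : V → SignType, (∏ v, pw (w v) (z v)) * ∑ o : E → Option Bool,
      (∏ e, lik p (val ν s c0 z e) (o e)) *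
        (if ∃ e, 1/2 ≤ |δ o e - val ν s c0 z e| then 1 else 0) := by
  have tot : ∑ z : V → SignType, (∏ v, pw (w v) (z v)) * ∑ o : E → Option Bool,
      (∏ e, lik p (val ν s c0 z e) (o e)) = 1 := by
    have : ∀ z : V → SignType, ∑ o : E → Option Bool, (∏ e, lik p (val ν s c0 z e) (o e)) = 1 := by
      intro z
      rw [sum_prod_pi (fun e a => lik p (val ν s c0 z e) a)]
      exact Finset.prod_eq_one fun e _ => lik_sum _ _
    simp only [this, mul_one]
    rw [sum_prod_pi (fun v a => pw (w v) a)]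
    exact Finset.prod_eq_one fun e _ => pw_sum _
  have hval : ∀ z e, |val ν s c0 z e| ≤ 1 := by
    intro z e
    unfold val
    rcases ν e with _ | v
    · exact hc e
    · simp only []
      rcases hs e with h | h <;> rw [h] <;> rcases z v with _ | _ | _ <;> simp
  -- success mass
  suffices H : ∑ z : V → SignType, (∏ v, pw (w v) (z v)) * ∑ o : E → Option Bool,
      (∏ e, lik p (val ν s c0 z e) (o e)) *
        (if ∃ e, 1/2 ≤ |δ o e - val ν s c0 z e| then 0 else 1)
      ≤ ∏ v, Sfac (w v) p (fib ν (some v)).card by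
    have : ∑ z : V → SignType, (∏ v, pw (w v) (z v)) * ∑ o : E → Option Bool,
      (∏ e, lik p (val ν s c0 z e) (o e)) *
        (if ∃ e, 1/2 ≤ |δ o e - val ν s c0 z e| then (1:ℝ) else 0) = 1 -
      ∑ z : V → SignType, (∏ v, pw (w v) (z v)) * ∑ o : E → Option Bool,
      (∏ e, lik p (val ν s c0 z e) (o e)) *
        (if ∃ e, 1/2 ≤ |δ o e - val ν s c0 z e| then 0 else 1) := by
      rw [eq_sub_iff_add_eq, ← Finset.sum_add_distrib]
      refine Eq.trans (Finset.sum_congr rfl fun z _ => ?_) tot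
      rw [← mul_add, ← Finset.sum_add_distrib]
      congr 1
      refine Finset.sum_congr rfl fun o _ => ?_
      split_ifs <;> ring
    rw [this]; linarith
  simp only [Finset.mul_sum]
  rw [Finset.sum_comm]
  let c : Option V → Fin 6 → ℝ := fun x => match x with
    | none => ![1, 0, 0, 0, 0, 0]
    | some v => if (fib ν (some v)).card = 0 then ![1, 0, 0, 0, 0, 0] else
      ![w v / 2, w v / 2, 1 - w v, -(1 - w v), -(1 - w v), eta (w v)]
  have hfac := fiber_factor ν c (gk p ν s c0)
  have hR : ∏ x : Option V, ∑ k, c x k * ∏ e ∈ fib ν x, ∑ a, gk p ν s c0 k e a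
      = ∏ v, Sfac (w v) p (fib ν (some v)).card := by
    simp only [gk_sum, Finset.prod_const]
    rw [Fintype.prod_option]
    have : ∑ k, c none k * (![1, 1, 1, 1 - p/2, 1 - p/2, 1 - p] : Fin 6 → ℝ) k ^ (fib ν none).card = 1 := by
      simp [c, Fin.sum_univ_six]
    rw [this, one_mul]
    refine Finset.prod_congr rfl fun v _ => ?_
    simp only [c, Sfac]
    split_ifs with h
    · simp [Fin.sum_univ_six, h]
    · simp [Fin.sum_univ_six]; ring
  rw [← hR, ← hfac]
  refine Finset.sum_le_sum fun o _ => ?_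
  -- fixed observation
  let zh : V → SignType := fun v => if h : ∃ z : SignType, ∃ e ∈ fib ν (some v),
    |δ o e - s e * (z : ℝ)| < 1/2 ∧ ∀ e' ∈ fib ν (some v), |δ o e' - s e' * (z : ℝ)| < 1/2
    then h.choose else 0
  let h : V → SignType → ℝ := fun v z => pw (w v) z *
    (∏ e ∈ fib ν (some v), lik p (s e * (z : ℝ)) (o e)) *
    (if (fib ν (some v)).card = 0 then 1 else if z = zh v then 1 else 0)
  have hlik : ∀ v (z : SignType), 0 ≤ ∏ e ∈ fib ν (some v), lik p (s e * (z : ℝ)) (o e) := by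
    intro v z
    refine Finset.prod_nonneg fun e _ => lik_nonneg h0 h1 ?_ _
    rcases hs e with h | h <;> rw [h] <;> rcases z with _ | _ | _ <;> simp
  have hnone : 0 ≤ ∏ e ∈ fib ν none, lik p (c0 e) (o e) :=
    Finset.prod_nonneg fun e _ => lik_nonneg h0 h1 (hc e) _
  have hh0 : ∀ v z, 0 ≤ h v z := by
    intro v z
    refine mul_nonneg (mul_nonneg (pw_nonneg (by linarith [hw v]) (hw1 v) z) (hlik v z)) ?_
    split_ifs <;> norm_num
  have step1 : ∀ z : V → SignType, (∏ v, pw (w v) (z v)) * ((∏ e, lik p (val ν s c0 z e) (o e)) *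
        (if ∃ e, 1/2 ≤ |δ o e - val ν s c0 z e| then 0 else 1))
      ≤ (∏ e ∈ fib ν none, lik p (c0 e) (o e)) * ∏ v, h v (z v) := by
    intro z
    split_ifs with hex
    · rw [mul_zero, mul_zero]
      exact mul_nonneg hnone (Finset.prod_nonneg fun v _ => hh0 v _)
    · push Not at hex
      have hz : ∀ v, (fib ν (some v)).card ≠ 0 → z v = zh v := by
        intro v hv
        obtain ⟨e, he⟩ := Finset.card_ne_zero.1 hv
        have hall : ∀ e' ∈ fib ν (some v), |δ o e' - s e' * (z v : ℝ)| < 1/2 := by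
          intro e' he'
          have := hex e'
          simpa [val, (Finset.mem_filter.1 he').2] using this
        have hh : ∃ z : SignType, ∃ e ∈ fib ν (some v),
          |δ o e - s e * (z : ℝ)| < 1/2 ∧ ∀ e' ∈ fib ν (some v), |δ o e' - s e' * (z : ℝ)| < 1/2 :=
          ⟨z v, e, he, hall e he, hall⟩
        have hzh : zh v = hh.choose := by simp only [zh]; exact dif_pos hh
        obtain ⟨e', he', -, hc'⟩ := hh.choose_spec
        rw [← hzh] at hc'
        have a1 := abs_lt.1 (hall e he)
        have a2 := abs_lt.1 (hc' e he)
        generalize zh v = z2 at *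
        generalize z v = z1 at *
        rcases hs e with h | h <;> rw [h] at a1 a2 <;> rcases z1 with _ | _ | _ <;>
          rcases z2 with _ | _ | _ <;> first | rfl | (exfalso; norm_num at a1 a2; linarith)
      rw [mul_one, lik_factor]
      have : ∏ v, h v (z v) = (∏ v, pw (w v) (z v)) *
          ∏ v, ∏ e ∈ fib ν (some v), lik p (s e * (z v : ℝ)) (o e) := by
        rw [← Finset.prod_mul_distrib]
        refine Finset.prod_congr rfl fun v _ => ?_
        simp only [h]
        by_cases hv : (fib ν (some v)).card = 0
        · rw [if_pos hv, mul_one]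
        · rw [if_neg hv, if_pos (hz v hv), mul_one]
      rw [this]; apply le_of_eq; ring
  refine (Finset.sum_le_sum fun z _ => step1 z).trans ?_
  rw [← Finset.mul_sum, sum_prod_pi h, Fintype.prod_option]
  have hn : ∑ k, c none k * ∏ e ∈ fib ν none, gk p ν s c0 k e (o e) =
      ∏ e ∈ fib ν none, lik p (c0 e) (o e) := by
    rw [← gk0_none (ν := ν) (s := s) (c0 := c0)]
    simp [c, Fin.sum_univ_six]
  rw [hn]
  refine mul_le_mul_of_nonneg_left ?_ hnone
  refine Finset.prod_le_prod (fun v _ => Finset.sum_nonneg fun z _ => hh0 v z) fun v _ => ?_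
  by_cases hv : (fib ν (some v)).card = 0
  · have hv' := Finset.card_eq_zero.1 hv
    have e1 : ∑ z, h v z = 1 := by
      simp only [h, hv', Finset.prod_empty, mul_one, Finset.card_empty, if_true]
      exact pw_sum _
    rw [e1]
    simp only [c, if_pos hv, hv', Finset.prod_empty, mul_one]
    simp [Fin.sum_univ_six]
  · have e1 : ∑ z, h v z = pw (w v) (zh v) * ∏ e ∈ fib ν (some v), lik p (s e * (zh v : ℝ)) (o e) := by
      simp only [h, if_neg hv, mul_ite, mul_one, mul_zero]
      rw [Finset.sum_ite_eq' Finset.univ (zh v)]; simp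
    rw [e1]
    refine (point01 h0 h1 (hw v) (hw1 v) (fib ν (some v)) s hs o (zh v)).trans ?_
    simp only [c, if_neg hv]
    rw [Fin.sum_univ_six, gk0_some]
    apply le_of_eq
    simp [gk]

theorem bayes2 {p : ℝ} (h0 : 0 ≤ p) (h1 : p ≤ 1) (w : V → ℝ) (hw : ∀ v, 1/2 ≤ w v)
    (hw1 : ∀ v, w v ≤ 1) (ν : E → Option V) (s c0 : E → ℝ) (hs : ∀ e, s e = 1 ∨ s e = -1)
    (hc : ∀ e, |c0 e| ≤ 1) (δ : (E → Option Bool) → E → ℝ) :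
    ∑ e, ((ν e).elim 0 fun v => 2 * w v * (1 - w v) * (1 - p/2)^(fib ν (some v)).card) ≤
    ∑ z : V → SignType, (∏ v, pw (w v) (z v)) * ∑ o : E → Option Bool,
      (∏ e, lik p (val ν s c0 z e) (o e)) * ∑ e, (δ o e - val ν s c0 z e)^2 := by
  have hswap : ∑ z : V → SignType, (∏ v, pw (w v) (z v)) * ∑ o : E → Option Bool,
      (∏ e, lik p (val ν s c0 z e) (o e)) * ∑ e, (δ o e - val ν s c0 z e)^2
      = ∑ e0, ∑ o : E → Option Bool, ∑ z : V → SignType, (∏ v, pw (w v) (z v)) *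
        ((∏ e, lik p (val ν s c0 z e) (o e)) * (δ o e0 - val ν s c0 z e0)^2) := by
    simp only [Finset.mul_sum]
    rw [Finset.sum_comm' (t' := Finset.univ) (s' := fun _ => Finset.univ) (by simp)]
    rw [Finset.sum_comm]
    conv_rhs => rw [Finset.sum_comm]
    rw [Finset.sum_comm]
    refine Finset.sum_congr rfl fun o _ => ?_
    rw [Finset.sum_comm]
  rw [hswap]
  refine Finset.sum_le_sum fun e0 _ => ?_
  have hlik : ∀ (o : E → Option Bool) v (z : SignType),
      0 ≤ ∏ e ∈ fib ν (some v), lik p (s e * (z : ℝ)) (o e) := by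
    intro o v z
    refine Finset.prod_nonneg fun e _ => lik_nonneg h0 h1 ?_ _
    rcases hs e with h | h <;> rw [h] <;> rcases z with _ | _ | _ <;> simp
  have hpw : ∀ v z, 0 ≤ pw (w v) z := fun v z => pw_nonneg (by linarith [hw v]) (hw1 v) z
  have hnone : ∀ o : E → Option Bool, 0 ≤ ∏ e ∈ fib ν none, lik p (c0 e) (o e) := fun o =>
    Finset.prod_nonneg fun e _ => lik_nonneg h0 h1 (hc e) _
  rcases hν : ν e0 with _ | v0
  · simp only [Option.elim]
    refine Finset.sum_nonneg fun o _ => Finset.sum_nonneg fun z _ => ?_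
    refine mul_nonneg (Finset.prod_nonneg fun v _ => hpw _ _) (mul_nonneg ?_ (sq_nonneg _))
    rw [lik_factor]
    exact mul_nonneg (hnone o) (Finset.prod_nonneg fun v _ => hlik _ _ _)
  · simp only [Option.elim]
    let c : Option V → Fin 6 → ℝ := fun x => match x with
      | none => ![1, 0, 0, 0, 0, 0]
      | some v => if v = v0 then ![0, 0, 0, w v * (1 - w v), w v * (1 - w v), 0] else
        ![w v / 2, w v / 2, 1 - w v, 0, 0, 0]
    have hfac := fiber_factor ν c (gk p ν s c0)
    have hR : ∏ x : Option V, ∑ k, c x k * ∏ e ∈ fib ν x, ∑ a, gk p ν s c0 k e a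
        = 2 * w v0 * (1 - w v0) * (1 - p/2)^(fib ν (some v0)).card := by
      simp only [gk_sum, Finset.prod_const]
      rw [Fintype.prod_option]
      have : ∑ k, c none k * (![1, 1, 1, 1 - p/2, 1 - p/2, 1 - p] : Fin 6 → ℝ) k ^ (fib ν none).card = 1 := by
        simp [c, Fin.sum_univ_six]
      rw [this, one_mul, Finset.prod_eq_single v0]
      · simp only [c, if_pos]
        simp [Fin.sum_univ_six]; ring
      · intro v _ hv
        simp only [c, if_neg hv]
        simp [Fin.sum_univ_six]
      · simp
    rw [← hR, ← hfac]
    refine Finset.sum_le_sum fun o _ => ?_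
    let h : V → SignType → ℝ := fun v z => pw (w v) z *
      (∏ e ∈ fib ν (some v), lik p (s e * (z : ℝ)) (o e)) *
      (if v = v0 then (δ o e0 - s e0 * z)^2 else 1)
    have step1 : ∀ z : V → SignType, (∏ v, pw (w v) (z v)) *
        ((∏ e, lik p (val ν s c0 z e) (o e)) * (δ o e0 - val ν s c0 z e0)^2)
        = (∏ e ∈ fib ν none, lik p (c0 e) (o e)) * ∏ v, h v (z v) := by
      intro z
      have e2 : ∏ v, h v (z v) = (∏ v, pw (w v) (z v)) *
          (∏ v, ∏ e ∈ fib ν (some v), lik p (s e * (z v : ℝ)) (o e)) * (δ o e0 - s e0 * z v0)^2 := by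
        simp only [h, Finset.prod_mul_distrib]
        congr 1
        rw [Finset.prod_ite_eq' Finset.univ v0 (fun v => (δ o e0 - s e0 * z v)^2)]; simp
      have e3 : val ν s c0 z e0 = s e0 * z v0 := by simp [val, hν]
      rw [e2, lik_factor, e3]; ring
    rw [Finset.sum_congr rfl fun z _ => step1 z, ← Finset.mul_sum, sum_prod_pi h,
      Fintype.prod_option]
    have hn : ∑ k, c none k * ∏ e ∈ fib ν none, gk p ν s c0 k e (o e) =
        ∏ e ∈ fib ν none, lik p (c0 e) (o e) := by
      rw [← gk0_none (ν := ν) (s := s) (c0 := c0)]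
      simp [c, Fin.sum_univ_six]
    rw [hn]
    refine mul_le_mul_of_nonneg_left ?_ (hnone o)
    have consnn : ∀ e, 0 ≤ cons p (s e) (o e) ∧ 0 ≤ cons p (-s e) (o e) := by
      intro e
      rcases hs e with h | h <;> rcases o e with _ | _ | _ <;> simp only [cons, h] <;>
        constructor <;> linarith
    have hval : ∀ v, ∑ k, c (some v) k * ∏ e ∈ fib ν (some v), gk p ν s c0 k e (o e) =
        if v = v0 then w v * (1-w v) * ∏ e ∈ fib ν (some v), cons p (s e) (o e)
      + w v * (1-w v) * ∏ e ∈ fib ν (some v), cons p (- s e) (o e) else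
        ∑ z : SignType, pw (w v) z * ∏ e ∈ fib ν (some v), lik p (s e * (z : ℝ)) (o e) := by
      intro v
      rw [Fin.sum_univ_six, gk0_some]
      simp only [c]
      split_ifs with hv
      · simp [gk]
      · rw [sum_sign]
        simp [gk, pw]; ring
    refine Finset.prod_le_prod (fun v _ => ?_) fun v _ => ?_
    · rw [hval]
      split_ifs with hv
      · have a := Finset.prod_nonneg (s := fib ν (some v)) fun e _ => (consnn e).1
        have b := Finset.prod_nonneg (s := fib ν (some v)) fun e _ => (consnn e).2
        have cc : 0 ≤ w v * (1 - w v) := mul_nonneg (by linarith [hw v]) (by linarith [hw1 v])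
        positivity
      · exact Finset.sum_nonneg fun z _ => mul_nonneg (hpw _ _) (hlik _ _ _)
    · rw [hval]
      by_cases hv : v = v0
      · rw [if_pos hv]
        subst hv
        simp only [h, if_true]
        exact point2 h0 h1 (hw v) (hw1 v) _ s hs o _ _ (hs e0)
      · rw [if_neg hv]
        simp only [h, if_neg hv, mul_one]
        exact le_rfl

end bayes2
end GLB

end

section
open MeasureTheory
namespace GLB

/-! ### From discrete priors to the minimax statements -/

noncomputable def est {n : ℕ} (Yhat : (Fin n → Fin n → Bool × ℝ) → Fin n → Fin n → ℝ)
    (o : Fin n × Fin n → Option Bool) (e : Fin n × Fin n) : ℝ :=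
  Yhat (fun i j => dec (o (i, j))) e.1 e.2

open Classical in
noncomputable def R01 {T : Type} [Fintype T] {n : ℕ} (π : T → ℝ) (p : ℝ) (M : T → T → ℝ)
    (δ : (Fin n × Fin n → Option Bool) → Fin n × Fin n → ℝ) : ℝ :=
  ∑ t : Fin n → T, ∑ o, wt π p M t o *
    (if ∃ e, 1/2 ≤ |δ o e - M (t e.1) (t e.2)| then 1 else 0)

noncomputable def R2 {T : Type} [Fintype T] {n : ℕ} (π : T → ℝ) (p : ℝ) (M : T → T → ℝ)
    (δ : (Fin n × Fin n → Option Bool) → Fin n × Fin n → ℝ) : ℝ :=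
  ∑ t : Fin n → T, ∑ o, wt π p M t o * ∑ e, (δ o e - M (t e.1) (t e.2))^2

def Goal01 (n : ℕ) (p lam : ℝ) (Yhat : (Fin n → Fin n → Bool × ℝ) → Fin n → Fin n → ℝ)
    (r : ℝ) : Prop :=
  ∃ f : ℝ → ℝ → ℝ, MemFLam lam f ∧ ENNReal.ofReal r ≤
        graphonMeasure n {ω | ∃ i j : Fin n,
          (1/2 : ℝ) ≤ |Yhat (graphonObs p f ω) i j - f (ω.1 i) (ω.1 j)|}

def Goal2 (n : ℕ) (p lam : ℝ) (Yhat : (Fin n → Fin n → Bool × ℝ) → Fin n → Fin n → ℝ)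
    (r : ℝ) : Prop :=
  ∃ f : ℝ → ℝ → ℝ, MemFLam lam f ∧ r ≤
        ∫ ω, (1/(n:ℝ)^2) * ∑ i, ∑ j,
          (Yhat (graphonObs p f ω) i j - f (ω.1 i) (ω.1 j))^2 ∂(graphonMeasure n)

section prior
variable {T : Type} [Fintype T] [DecidableEq T] [Nonempty T] [MeasurableSpace T]
  [MeasurableSingletonClass T]

lemma exists_ge {S : Type} [Fintype S] (ρ R : S → ℝ) (h0 : ∀ s, 0 ≤ ρ s) (h1 : ∑ s, ρ s = 1)
    (r : ℝ) (h : r ≤ ∑ s, ρ s * R s) : ∃ s, r ≤ R s := by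
  by_contra hcon
  push Not at hcon
  have : ∑ s, ρ s * R s < ∑ s, ρ s * r := by
    refine Finset.sum_lt_sum (fun s _ => mul_le_mul_of_nonneg_left (hcon s).le (h0 s)) ?_
    by_contra hh
    push Not at hh
    have : ∀ s, ρ s = 0 := by
      intro s
      rcases (h0 s).lt_or_eq with h' | h'
      · have := hh s (Finset.mem_univ s)
        have := lt_of_le_of_lt (le_of_mul_le_mul_left this h') (hcon s)
        exact absurd this (lt_irrefl _)
      · exact h'.symm
    simp [this] at h1
  rw [← Finset.sum_mul, h1, one_mul] at this
  linarith

theorem goal01_of {n : ℕ} {p lam : ℝ} (hp : p ∈ Set.Ioc (0:ℝ) 1)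
    (Yhat : (Fin n → Fin n → Bool × ℝ) → Fin n → Fin n → ℝ)
    (π : T → ℝ) (h0 : ∀ t, 0 ≤ π t) (h1 : ∑ t, π t = 1)
    {S : Type} [Fintype S] (ρ : S → ℝ) (hρ0 : ∀ s, 0 ≤ ρ s) (hρ1 : ∑ s, ρ s = 1)
    (M : S → T → T → ℝ) (hM : ∀ s x y, |M s x y| ≤ 1)
    (hF : ∀ s τ, Measurable τ → (∀ t, U01.real (τ ⁻¹' {t}) = π t) →
      MemFLam lam (fun x y => M s (τ x) (τ y))) (r : ℝ)
    (h : r ≤ ∑ s, ρ s * R01 π p (M s) (est Yhat)) : Goal01 n p lam Yhat r := by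
  classical
  obtain ⟨s, hs⟩ := exists_ge ρ _ hρ0 hρ1 r h
  obtain ⟨τ, hτ, hπ⟩ := exists_tau π h0 h1
  refine ⟨_, hF s τ hτ hπ, ?_⟩
  set f : ℝ → ℝ → ℝ := fun x y => M s (τ x) (τ y) with hf
  have hred := reduce hp π τ hτ hπ (M s) (hM s)
    (fun t o => if ∃ e, 1/2 ≤ |est Yhat o e - M s (t e.1) (t e.2)| then 1 else 0)
  let B : Set (Fin n → T) := Set.univ
  let Φ : GraphonSpace n → (Fin n → T) × (Fin n × Fin n → Option Bool) :=
    fun ω => (fun i => τ (ω.1 i), enc p f ω)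
  have hfm : Measurable (Function.uncurry f) := by
    have : Function.uncurry f = (fun z : T × T => M s z.1 z.2) ∘ fun z : ℝ × ℝ => (τ z.1, τ z.2) := rfl
    rw [this]
    exact Measurable.of_discrete.comp ((hτ.comp measurable_fst).prodMk (hτ.comp measurable_snd))
  have hΦ : Measurable Φ := by
    refine Measurable.prodMk ?_ (enc_measurable p f hfm)
    exact measurable_pi_lambda _ fun i => hτ.comp ((measurable_pi_apply i).comp measurable_fst)
  let Bad : Set ((Fin n → T) × (Fin n × Fin n → Option Bool)) :=
    {z | ∃ e, 1/2 ≤ |est Yhat z.2 e - M s (z.1 e.1) (z.1 e.2)|}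
  have hset : {ω | ∃ i j : Fin n, (1/2 : ℝ) ≤ |Yhat (graphonObs p f ω) i j - f (ω.1 i) (ω.1 j)|}
      = Φ ⁻¹' Bad := by
    ext ω
    simp only [Set.mem_preimage, Bad, Set.mem_ofPred_eq, Φ, Prod.exists, est, obs_eq, hf]
  have hmeas : MeasurableSet (Φ ⁻¹' Bad) := hΦ (Set.toFinite _).measurableSet
  have : R01 π p (M s) (est Yhat) = (graphonMeasure n).real (Φ ⁻¹' Bad) := by
    unfold R01
    rw [← hred, ← integral_indicator_one hmeas]
    refine integral_congr_ae (Filter.Eventually.of_forall fun ω => ?_)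
    simp only [Set.indicator, Set.mem_preimage, Bad, Set.mem_ofPred_eq, Φ, hf, Pi.one_apply]
  rw [hset]
  have hp2 : IsProbabilityMeasure (graphonMeasure n) := by
    unfold graphonMeasure; infer_instance
  rw [this] at hs
  rw [← ENNReal.ofReal_toReal (measure_ne_top (graphonMeasure n) (Φ ⁻¹' Bad))]
  exact ENNReal.ofReal_le_ofReal hs

theorem goal2_of {n : ℕ} {p lam : ℝ} (hp : p ∈ Set.Ioc (0:ℝ) 1)
    (Yhat : (Fin n → Fin n → Bool × ℝ) → Fin n → Fin n → ℝ)
    (π : T → ℝ) (h0 : ∀ t, 0 ≤ π t) (h1 : ∑ t, π t = 1)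
    {S : Type} [Fintype S] (ρ : S → ℝ) (hρ0 : ∀ s, 0 ≤ ρ s) (hρ1 : ∑ s, ρ s = 1)
    (M : S → T → T → ℝ) (hM : ∀ s x y, |M s x y| ≤ 1)
    (hF : ∀ s τ, Measurable τ → (∀ t, U01.real (τ ⁻¹' {t}) = π t) →
      MemFLam lam (fun x y => M s (τ x) (τ y))) (r : ℝ)
    (h : (n:ℝ)^2 * r ≤ ∑ s, ρ s * R2 π p (M s) (est Yhat)) (hn : 1 ≤ n) :
    Goal2 n p lam Yhat r := by
  classical
  obtain ⟨s, hs⟩ := exists_ge ρ _ hρ0 hρ1 _ h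
  obtain ⟨τ, hτ, hπ⟩ := exists_tau π h0 h1
  refine ⟨_, hF s τ hτ hπ, ?_⟩
  have hred := reduce hp π τ hτ hπ (M s) (hM s)
    (fun t o => ∑ e, (est Yhat o e - M s (t e.1) (t e.2))^2)
  have e1 : R2 π p (M s) (est Yhat) = ∫ ω, ∑ i, ∑ j,
      (Yhat (graphonObs p (fun x y => M s (τ x) (τ y)) ω) i j - M s (τ (ω.1 i)) (τ (ω.1 j)))^2
        ∂(graphonMeasure n) := by
    unfold R2
    rw [← hred]
    refine integral_congr_ae (Filter.Eventually.of_forall fun ω => ?_)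
    simp only [est, Fintype.sum_prod_type, obs_eq]
  rw [integral_const_mul, ← e1]
  have : (0:ℝ) < (n:ℝ)^2 := by positivity
  rw [one_div, ← div_eq_inv_mul, le_div_iff₀ this, mul_comm]
  exact hs

end prior
end GLB

end

section
open MeasureTheory
namespace GLB

/-- signs -/
noncomputable def sg (b : Bool) : ℝ := if b then 1 else -1

lemma sg_sq (b : Bool) : sg b * sg b = 1 := by cases b <;> simp [sg]

section famG
variable {L : Type} [Fintype L] [DecidableEq L]

abbrev TT (L : Type) := (L × Bool × Bool) × (L → SignType)

instance : MeasurableSpace (TT L) := ⊤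
instance : MeasurableSingletonClass (TT L) := ⟨fun _ => trivial⟩

/-- a design of family G -/
structure Design (L : Type) [Fintype L] [DecidableEq L] where
  μ : L → ℝ
  D : L → Bool
  A : L → L → Bool
  w : ℝ
  l0 : L
  l1 : L

variable (d : Design L)

noncomputable def Design.μA (b : L) : ℝ := ∑ l, if d.A b l then d.μ l else 0

structure Design.Ok (lam : ℝ) : Prop where
  pos : ∀ l, 0 < d.μ l
  sum : ∑ l, d.μ l = 1
  hD : ∀ l, d.D l = true → lam ≤ d.μ l
  hA : ∀ b l, d.A b l = true → lam^2 ≤ d.w * d.μA b * d.μ b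
  irr : ∀ b, d.A b b = false
  asym : ∀ b l, d.A b l = true → d.A l b = false
  h0 : d.A d.l0 d.l1 = false
  h1 : d.A d.l1 d.l0 = false
  hd : d.l0 = d.l1 → d.D d.l0 = false
  hlam : lam^2 ≤ d.μ d.l0 * d.μ d.l1
  w0 : 1/2 ≤ d.w
  w1 : d.w ≤ 1

noncomputable def Design.pi (t : TT L) : ℝ := d.μ t.1.1 * (1/4) * ∏ b, pw d.w (t.2 b)

/-- the kernel -/
noncomputable def Design.M (lam : ℝ) (s : L → SignType) (x y : TT L) : ℝ :=
  if x.1.1 = y.1.1 ∧ d.D x.1.1 = true then (sg x.1.2.1 * sg y.1.2.1) * s x.1.1 else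
  if d.A y.1.1 x.1.1 = true then x.2 y.1.1 else
  if d.A x.1.1 y.1.1 = true then y.2 x.1.1 else
  if (x.1.1 = d.l0 ∧ y.1.1 = d.l1) ∨ (x.1.1 = d.l1 ∧ y.1.1 = d.l0) then
    lam / Real.sqrt (d.μ d.l0 * d.μ d.l1) * (sg x.1.2.2 * sg y.1.2.2) else 0

lemma sumc (w : ℝ) (F : L → SignType → ℝ) :
    ∑ c : L → SignType, (∏ b, pw w (c b)) * ∏ b, F b (c b) = ∏ b, ∑ z, pw w z * F b z := by
  rw [← sum_prod_pi (fun b z => pw w z * F b z)]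
  exact Finset.sum_congr rfl fun c _ => Finset.prod_mul_distrib.symm

lemma sumc_one (w : ℝ) : ∑ c : L → SignType, (∏ b, pw w (c b)) = 1 := by
  rw [sum_prod_pi (fun _ z => pw w z)]; exact Finset.prod_eq_one fun _ _ => pw_sum w

lemma sumc_b (w : ℝ) (b : L) (g : SignType → ℝ) :
    ∑ c : L → SignType, (∏ b, pw w (c b)) * g (c b) = ∑ z, pw w z * g z := by
  have := sumc w (fun b' z => if b' = b then g z else (1:ℝ))
  have e : ∀ c : L → SignType, ∏ x, (if x = b then g (c x) else (1:ℝ)) = g (c b) := by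
    intro c; rw [Finset.prod_ite_eq' Finset.univ b (fun x => g (c x))]; simp
  simp only [e] at this
  rw [this, Finset.prod_eq_single b]
  · simp
  · intro b' _ hb'; simp [hb', pw_sum]
  · simp

lemma sumc_bb (w : ℝ) (b b' : L) (h : b ≠ b') :
    ∑ c : L → SignType, (∏ b, pw w (c b)) * ((c b : ℝ) * (c b' : ℝ)) = 0 := by
  have := sumc w (fun x z => (if x = b then (z:ℝ) else (1:ℝ)) * (if x = b' then (z:ℝ) else 1))
  simp only [Finset.prod_mul_distrib] at this
  have e : ∀ (b : L) (c : L → SignType), ∏ x, (if x = b then (c x : ℝ) else (1:ℝ)) = c b := by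
    intro b c; rw [Finset.prod_ite_eq' Finset.univ b (fun x => (c x:ℝ))]; simp
  simp only [e] at this
  rw [this]
  refine Finset.prod_eq_zero (Finset.mem_univ b) ?_
  simp [h, sum_sign, pw]

/-- features -/
inductive Feat (L : Type) | e (l : L) | c (l : L) | o (l : L) | r (l : L)

noncomputable instance : DecidableEq (Feat L) := Classical.decEq _

noncomputable def Design.fu : Feat L → L → ℝ
  | .e l, x => if x = l then (Real.sqrt (d.μ l))⁻¹ else 0
  | .c b, x => if d.A b x = true then (Real.sqrt (d.w * d.μA b))⁻¹ else 0
  | .o l, x => if x = l then (Real.sqrt (d.μ l))⁻¹ else 0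
  | .r l, x => if x = l then (Real.sqrt (d.μ l))⁻¹ else 0
noncomputable def fe : Feat L → Bool → ℝ
  | .e _, x => sg x
  | _, _ => 1
noncomputable def fr : Feat L → Bool → ℝ
  | .r _, x => sg x
  | _, _ => 1
noncomputable def fc : Feat L → (L → SignType) → ℝ
  | .c b, x => x b
  | _, _ => 1

noncomputable def Design.φ (i : Feat L) (t : TT L) : ℝ :=
  d.fu i t.1.1 * fe i t.1.2.1 * fr i t.1.2.2 * fc i t.2

lemma sum_T (u : L → ℝ) (f1 f2 : Bool → ℝ) (f3 : (L → SignType) → ℝ) :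
    ∑ t, d.pi t * (u t.1.1 * f1 t.1.2.1 * f2 t.1.2.2 * f3 t.2) =
    (∑ l, d.μ l * u l) * (1/2 * ∑ b, f1 b) * (1/2 * ∑ b, f2 b) *
      ∑ c : L → SignType, (∏ b, pw d.w (c b)) * f3 c := by
  simp only [Fintype.sum_prod_type, Design.pi, Fintype.sum_bool]
  set C := ∑ c : L → SignType, (∏ b, pw d.w (c b)) * f3 c with hC
  have h : ∀ (m a b c : ℝ), ∑ y : L → SignType, m * (1/4) * (∏ b, pw d.w (y b)) *
      (a * b * c * f3 y) = m * a * (1/4 * b * c * C) := by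
    intro m a b c
    rw [hC, Finset.mul_sum, Finset.mul_sum]
    exact Finset.sum_congr rfl fun y _ => by ring
  simp only [h, Finset.sum_mul]
  exact Finset.sum_congr rfl fun l _ => by ring

lemma inner_eq (i k : Feat L) : ∑ t, d.pi t * (d.φ i t * d.φ k t) =
    (∑ l, d.μ l * (d.fu i l * d.fu k l)) * (1/2 * ∑ b, fe i b * fe k b) *
     (1/2 * ∑ b, fr i b * fr k b) *
      ∑ c : L → SignType, (∏ b, pw d.w (c b)) * (fc i c * fc k c) := by
  rw [← sum_T d (fun l => d.fu i l * d.fu k l) (fun b => fe i b * fe k b)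
    (fun b => fr i b * fr k b) (fun c => fc i c * fc k c)]
  refine Finset.sum_congr rfl fun t _ => ?_
  simp only [Design.φ]; ring

lemma pi_sum (h : ∑ l, d.μ l = 1) : ∑ t, d.pi t = 1 := by
  have := sum_T d (fun _ => 1) (fun _ => 1) (fun _ => 1) (fun _ => 1)
  simpa [h, sumc_one] using this

lemma orth (i k : Feat L) (h : i ≠ k) : ∑ t, d.pi t * (d.φ i t * d.φ k t) = 0 := by
  rw [inner_eq]
  have hc : ∀ b : L, ∑ c : L → SignType, (∏ b, pw d.w (c b)) * (c b : ℝ) = 0 := by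
    intro b; rw [sumc_b d.w b (fun z => (z:ℝ))]; simp [sum_sign, pw]
  have hl : ∀ (l l' : L), l ≠ l' → ∀ a b : ℝ,
      ∑ x, d.μ x * ((if x = l then a else 0) * (if x = l' then b else 0)) = 0 := by
    intro l l' hll a b
    refine Finset.sum_eq_zero fun x _ => ?_
    by_cases hx : x = l
    · subst hx; simp [hll]
    · simp [hx]
  rcases i with l | l | l | l <;> rcases k with l' | l' | l' | l' <;>
    first
    | (simp only [fe, sg, Fintype.sum_bool]; norm_num; done)
    | (simp only [fr, sg, Fintype.sum_bool]; norm_num; done)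
    | (simp only [fc, mul_one, one_mul, hc]; norm_num; done)
    | (have hll : l ≠ l' := fun hh => h (by rw [hh])
       simp only [Design.fu, hl l l' hll, zero_mul]; done)
    | (have hll : l ≠ l' := fun hh => h (by rw [hh])
       simp only [fc, sumc_bb d.w l l' hll, mul_zero]; done)

variable {d}

lemma Design.Ok.μA_pos {lam : ℝ} (h : d.Ok lam) {b l : L} (hb : d.A b l = true) : 0 < d.μA b := by
  unfold Design.μA
  refine Finset.sum_pos' (fun x _ => ?_) ⟨l, Finset.mem_univ _, ?_⟩
  · split_ifs
    · exact (h.pos x).le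
    · exact le_rfl
  · rw [if_pos hb]; exact h.pos l

lemma Design.Ok.μA_nonneg {lam : ℝ} (h : d.Ok lam) (b : L) : 0 ≤ d.μA b := by
  unfold Design.μA
  refine Finset.sum_nonneg fun x _ => ?_
  split_ifs
  · exact (h.pos x).le
  · exact le_rfl

lemma Design.Ok.norm1 {lam : ℝ} (h : d.Ok lam) (l : L) :
    ∑ x, d.μ x * ((if x = l then (Real.sqrt (d.μ l))⁻¹ else 0) *
      (if x = l then (Real.sqrt (d.μ l))⁻¹ else 0)) = 1 := by
  rw [Finset.sum_eq_single l]
  · simp only [if_true]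
    rw [← mul_inv, Real.mul_self_sqrt (h.pos l).le]
    exact mul_inv_cancel₀ (h.pos l).ne'
  · intro b _ hb; simp [hb]
  · simp

lemma Design.Ok.norm_e {lam : ℝ} (h : d.Ok lam) (l : L) :
    ∑ t, d.pi t * (d.φ (.e l) t * d.φ (.e l) t) = 1 := by
  rw [inner_eq]
  simp only [Design.fu, h.norm1, fe, fr, fc, sg_sq, mul_one, sumc_one]; norm_num

lemma Design.Ok.norm_o {lam : ℝ} (h : d.Ok lam) (l : L) :
    ∑ t, d.pi t * (d.φ (.o l) t * d.φ (.o l) t) = 1 := by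
  rw [inner_eq]
  simp only [Design.fu, h.norm1, fe, fr, fc, mul_one, sumc_one]; norm_num

lemma Design.Ok.norm_r {lam : ℝ} (h : d.Ok lam) (l : L) :
    ∑ t, d.pi t * (d.φ (.r l) t * d.φ (.r l) t) = 1 := by
  rw [inner_eq]
  simp only [Design.fu, h.norm1, fe, fr, fc, sg_sq, mul_one, sumc_one]; norm_num

lemma Design.Ok.norm_c {lam : ℝ} (h : d.Ok lam) (b : L) (hb : 0 < d.μA b) :
    ∑ t, d.pi t * (d.φ (.c b) t * d.φ (.c b) t) = 1 := by
  rw [inner_eq]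
  have hw : 0 < d.w := by linarith [h.w0]
  have e1 : ∑ c : L → SignType, (∏ b, pw d.w (c b)) * ((c b : ℝ) * (c b : ℝ)) = d.w := by
    rw [sumc_b d.w b (fun z => (z:ℝ) * (z:ℝ))]; simp [sum_sign, pw]
  have e2 : ∑ x, d.μ x * (d.fu (.c b) x * d.fu (.c b) x) = (d.w)⁻¹ := by
    have : ∀ x, d.μ x * (d.fu (.c b) x * d.fu (.c b) x) =
        (if d.A b x = true then d.μ x else 0) * (d.w * d.μA b)⁻¹ := by
      intro x
      simp only [Design.fu]
      split_ifs
      · rw [← mul_inv, Real.mul_self_sqrt (by positivity)]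
      · simp
    simp only [this, ← Finset.sum_mul]
    change d.μA b * _ = _
    field_simp
  rw [e2]
  simp only [fe, fr, fc, mul_one, e1]
  simp only [Fintype.sum_bool]
  field_simp
  norm_num

lemma M_abs {lam : ℝ} (hl : 0 < lam) (h : d.Ok lam) (s : L → SignType) (x y : TT L) :
    |d.M lam s x y| ≤ 1 := by
  have hz : ∀ z : SignType, |(z:ℝ)| ≤ 1 := by intro z; rcases z with _ | _ | _ <;> simp
  have hsg : ∀ b, |sg b| = 1 := by intro b; cases b <;> simp [sg]
  unfold Design.M
  split_ifs
  · rw [abs_mul, abs_mul, hsg, hsg]; simpa using hz _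
  · exact hz _
  · exact hz _
  · have hpos : 0 < d.μ d.l0 * d.μ d.l1 := mul_pos (h.pos _) (h.pos _)
    rw [abs_mul, abs_mul, hsg, hsg, mul_one, mul_one, abs_div, abs_of_pos hl,
      abs_of_nonneg (Real.sqrt_nonneg _), div_le_one (Real.sqrt_pos.2 hpos)]
    exact Real.le_sqrt_of_sq_le h.hlam
  · simp

theorem Design.Ok.mem {lam : ℝ} (hl : 0 < lam) (h : d.Ok lam) (s : L → SignType)
    (τ : ℝ → TT L) (hτ : Measurable τ) (hπ : ∀ t, U01.real (τ ⁻¹' {t}) = d.pi t) :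
    MemFLam lam (fun x y => d.M lam s (τ x) (τ y)) := by
  classical
  have hw : 0 < d.w := by linarith [h.w0]
  refine memFLam_of_features (J := L ⊕ L ⊕ Unit) d.pi τ hτ hπ (d.M lam s) (M_abs hl h s) lam hl d.φ
    (Sum.elim Feat.e (Sum.elim Feat.c fun _ => Feat.r d.l0))
    (Sum.elim Feat.e (Sum.elim Feat.o fun _ => Feat.r d.l1))
    (Sum.elim (fun l => if d.D l = true then d.μ l * s l else 0)
      (Sum.elim (fun b => Real.sqrt (d.w * d.μA b) * Real.sqrt (d.μ b)) fun _ => lam))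
    ?_ (orth d) ?_ ?_ ?_ ?_ ⟨.inr (.inr ()), by simp [abs_of_pos hl]⟩
  · rintro ⟨⟨l, ε, r⟩, c⟩ ⟨⟨l', ε', r'⟩, c'⟩
    simp only [Fintype.sum_sum_type, Sum.elim_inl, Sum.elim_inr, if_true, reduceCtorEq, if_false,
      Finset.univ_unique, Finset.sum_singleton]
    have t1 : ∑ x, (if d.D x = true then d.μ x * (s x : ℝ) else 0) *
        (d.φ (.e x) ((l, ε, r), c) * d.φ (.e x) ((l', ε', r'), c')) =
        if l = l' ∧ d.D l = true then (sg ε * sg ε') * s l else 0 := by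
      rw [Finset.sum_eq_single l]
      · simp only [Design.φ, Design.fu, fe, fr, fc, if_true]
        by_cases hD : d.D l = true
        · by_cases hll : l = l'
          · subst hll
            rw [if_pos hD, if_pos rfl, if_pos ⟨rfl, hD⟩]
            have : (Real.sqrt (d.μ l))⁻¹ * (Real.sqrt (d.μ l))⁻¹ * d.μ l = 1 := by
              rw [← mul_inv, Real.mul_self_sqrt (h.pos l).le]; exact inv_mul_cancel₀ (h.pos l).ne'
            linear_combination (sg ε * sg ε' * s l) * this
          · simp [hll, Ne.symm hll]
        · simp [hD]
      · intro b _ hb; simp [Design.φ, Design.fu, Ne.symm hb]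
      · simp
    have t2 : ∀ x, Real.sqrt (d.w * d.μA x) * Real.sqrt (d.μ x) *
        (d.φ (.c x) ((l, ε, r), c) * d.φ (.o x) ((l', ε', r'), c') +
          d.φ (.o x) ((l, ε, r), c) * d.φ (.c x) ((l', ε', r'), c')) =
        (if l' = x then (if d.A x l = true then (c x : ℝ) else 0) else 0) +
          if l = x then (if d.A x l' = true then (c' x : ℝ) else 0) else 0 := by
      intro x
      have hx : Real.sqrt (d.μ x) * (Real.sqrt (d.μ x))⁻¹ = 1 :=
        mul_inv_cancel₀ (Real.sqrt_pos.2 (h.pos x)).ne'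
      have key : ∀ y, d.A x y = true → Real.sqrt (d.w * d.μA x) * (Real.sqrt (d.w * d.μA x))⁻¹ = 1 := by
        intro y hy
        exact mul_inv_cancel₀ (Real.sqrt_pos.2 (mul_pos hw (h.μA_pos hy))).ne'
      simp only [Design.φ, Design.fu, fe, fr, fc, mul_one]
      rw [mul_add]
      congr 1
      · by_cases h1 : l' = x
        · by_cases h2 : d.A x l = true
          · rw [if_pos h1, if_pos h2, if_pos h1, if_pos h2]
            linear_combination (c x : ℝ) * (Real.sqrt (d.μ x) * (Real.sqrt (d.μ x))⁻¹) * key l h2 + (c x : ℝ) * hx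
          · simp [h2]
        · simp [h1]
      · by_cases h1 : l = x
        · by_cases h2 : d.A x l' = true
          · rw [if_pos h1, if_pos h2, if_pos h1, if_pos h2]
            linear_combination (c' x : ℝ) * (Real.sqrt (d.μ x) * (Real.sqrt (d.μ x))⁻¹) * key l' h2 + (c' x : ℝ) * hx
          · simp [h2]
        · simp [h1]
    have t3 : ∑ x, Real.sqrt (d.w * d.μA x) * Real.sqrt (d.μ x) *
        (d.φ (.c x) ((l, ε, r), c) * d.φ (.o x) ((l', ε', r'), c') +
          d.φ (.o x) ((l, ε, r), c) * d.φ (.c x) ((l', ε', r'), c')) =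
        (if d.A l' l = true then (c l' : ℝ) else 0) + if d.A l l' = true then (c' l : ℝ) else 0 := by
      simp only [t2, Finset.sum_add_distrib, Finset.sum_ite_eq, Finset.mem_univ, if_true]
    have hsq : (Real.sqrt (d.μ d.l0))⁻¹ * (Real.sqrt (d.μ d.l1))⁻¹ =
        (Real.sqrt (d.μ d.l0 * d.μ d.l1))⁻¹ := by
      rw [Real.sqrt_mul (h.pos _).le, mul_inv]
    have t4 : lam * (if (Feat.r d.l0 : Feat L) = Feat.r d.l1 then
          d.φ (.r d.l0) ((l, ε, r), c) * d.φ (.r d.l1) ((l', ε', r'), c') else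
        (d.φ (.r d.l0) ((l, ε, r), c) * d.φ (.r d.l1) ((l', ε', r'), c') +
          d.φ (.r d.l1) ((l, ε, r), c) * d.φ (.r d.l0) ((l', ε', r'), c'))) =
        if (l = d.l0 ∧ l' = d.l1) ∨ (l = d.l1 ∧ l' = d.l0) then
          lam / Real.sqrt (d.μ d.l0 * d.μ d.l1) * (sg r * sg r') else 0 := by
      rw [div_eq_mul_inv, ← hsq]
      simp only [Design.φ, Design.fu, fe, fr, fc, mul_one, Feat.r.injEq]
      by_cases h01 : d.l0 = d.l1
      · rw [if_pos h01, ← h01]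
        by_cases h1 : l = d.l0 <;> by_cases h2 : l' = d.l0 <;> simp [h1, h2] <;> ring
      · have h10 := Ne.symm h01
        rw [if_neg h01]
        by_cases h1 : l = d.l0
        · by_cases h2 : l' = d.l1
          · simp [h1, h2, h01, h10]; ring
          · simp [h1, h2, h01]
        · by_cases h3 : l = d.l1
          · by_cases h4 : l' = d.l0
            · simp [h3, h4, h01, h10]; ring
            · simp [h3, h4, h10]
          · simp [h1, h3]
    rw [t1, t3]
    erw [t4]
    unfold Design.M
    simp only []
    by_cases c1 : l = l' ∧ d.D l = true
    · obtain ⟨rfl, hD⟩ := c1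
      have hne : ¬ ((l = d.l0 ∧ l = d.l1) ∨ (l = d.l1 ∧ l = d.l0)) := by
        rintro (⟨a, b⟩ | ⟨b, a⟩)
        · have := h.hd (a.symm.trans b); rw [← a] at this; simp [this] at hD
        · have := h.hd (a.symm.trans b); rw [← a] at this; simp [this] at hD
      simp [hD, h.irr l, hne]
    · rw [if_neg c1, if_neg c1]
      by_cases c2 : d.A l' l = true
      · have c3 := h.asym _ _ c2
        have hne : ¬ ((l = d.l0 ∧ l' = d.l1) ∨ (l = d.l1 ∧ l' = d.l0)) := by
          rintro (⟨rfl, rfl⟩ | ⟨rfl, rfl⟩)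
          · simp [h.h1] at c2
          · simp [h.h0] at c2
        rw [if_pos c2, if_pos c2, if_neg hne]; simp [c3]
      · rw [if_neg c2, if_neg c2]
        by_cases c3 : d.A l l' = true
        · have hne : ¬ ((l = d.l0 ∧ l' = d.l1) ∨ (l = d.l1 ∧ l' = d.l0)) := by
            rintro (⟨rfl, rfl⟩ | ⟨rfl, rfl⟩)
            · simp [h.h0] at c3
            · simp [h.h1] at c3
          rw [if_pos c3, if_pos c3, if_neg hne]; simp
        · rw [if_neg c3, if_neg c3]; simp
  · rintro (l | b | u) hν
    · exact h.norm_e l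
    · simp only [Sum.elim_inl, Sum.elim_inr] at hν ⊢
      refine h.norm_c b ?_
      rcases (h.μA_nonneg b).lt_or_eq with h' | h'
      · exact h'
      · exact absurd (by rw [← h']; simp) hν
    · exact h.norm_r _
  · rintro (l | b | u) hν
    · exact h.norm_e l
    · exact h.norm_o b
    · exact h.norm_r _
  · rintro (l | b | u) (l' | b' | u') hne <;> simp at hne <;> simp [hne]
  · rintro (l | b | u)
    · simp only [Sum.elim_inl]
      split_ifs with hD
      · rcases s l with _ | _ | _
        · left; simp
        · right; simp [abs_of_pos (h.pos l)]; exact h.hD l hD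
        · right; simp [abs_of_pos (h.pos l)]; exact h.hD l hD
      · exact Or.inl rfl
    · simp only [Sum.elim_inl, Sum.elim_inr]
      by_cases hb : ∃ l, d.A b l = true
      · obtain ⟨l, hb⟩ := hb
        right
        rw [abs_of_nonneg (by positivity), ← Real.sqrt_mul (mul_pos hw (h.μA_pos hb)).le]
        exact Real.le_sqrt_of_sq_le (h.hA b l hb)
      · left
        push Not at hb
        have : d.μA b = 0 := Finset.sum_eq_zero fun x _ => by simp [hb x]
        rw [this]; simp
    · right; simp [abs_of_pos hl]

end famG
end GLB

end

section
open MeasureTheory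
namespace GLB

lemma sum_arrow_prod {I A B : Type} [Fintype I] [DecidableEq I] [Fintype A] [Fintype B]
    (F : (I → A × B) → ℝ) :
    ∑ t, F t = ∑ a : I → A, ∑ b : I → B, F (fun i => (a i, b i)) := by
  rw [← Fintype.sum_prod_type' (f := fun (a : I → A) (b : I → B) => F (fun i => (a i, b i)))]
  exact Fintype.sum_equiv (Equiv.arrowProdEquivProdArrow I (fun _ => A) (fun _ => B)) _ _ fun t => rfl

lemma sum_curry {I L S : Type} [Fintype I] [DecidableEq I] [Fintype L] [DecidableEq L] [Fintype S]
    (F : (L ⊕ (I × L) → S) → ℝ) :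
    ∑ z, F z = ∑ s : L → S, ∑ c : I → L → S, F (Sum.elim s (fun q => c q.1 q.2)) := by
  rw [← Fintype.sum_prod_type' (f := fun (s : L → S) (c : I → L → S) =>
    F (Sum.elim s (fun q => c q.1 q.2)))]
  refine Fintype.sum_equiv ((Equiv.sumArrowEquivProdArrow L (I × L) S).trans
    (Equiv.prodCongr (Equiv.refl _) (Equiv.curry I L S))) _ _ fun z => ?_
  congr 1
  funext v
  rcases v with v | v <;> rfl

section famG
variable {L : Type} [Fintype L] [DecidableEq L] {n : ℕ} (d : Design L)

noncomputable def Design.wv : L ⊕ (Fin n × L) → ℝ := Sum.elim (fun _ => 1/2) (fun _ => d.w)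

def Design.nu (ℓ : Fin n → L) (e : Fin n × Fin n) : Option (L ⊕ (Fin n × L)) :=
  if ℓ e.1 = ℓ e.2 ∧ d.D (ℓ e.1) = true then some (.inl (ℓ e.1)) else
  if d.A (ℓ e.2) (ℓ e.1) = true then some (.inr (e.1, ℓ e.2)) else
  if d.A (ℓ e.1) (ℓ e.2) = true then some (.inr (e.2, ℓ e.1)) else none

noncomputable def Design.sgn (κ : Fin n → L × Bool × Bool) (e : Fin n × Fin n) : ℝ :=
  if (κ e.1).1 = (κ e.2).1 ∧ d.D (κ e.1).1 = true then sg (κ e.1).2.1 * sg (κ e.2).2.1 else 1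

noncomputable def Design.c0 (lam : ℝ) (κ : Fin n → L × Bool × Bool) (e : Fin n × Fin n) : ℝ :=
  if ((κ e.1).1 = d.l0 ∧ (κ e.2).1 = d.l1) ∨ ((κ e.1).1 = d.l1 ∧ (κ e.2).1 = d.l0) then
    lam / Real.sqrt (d.μ d.l0 * d.μ d.l1) * (sg (κ e.1).2.2 * sg (κ e.2).2.2) else 0

lemma M_val (lam : ℝ) (s : L → SignType) (κ : Fin n → L × Bool × Bool)
    (c : Fin n → L → SignType) (e : Fin n × Fin n) :
    d.M lam s (κ e.1, c e.1) (κ e.2, c e.2) =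
      val (d.nu fun i => (κ i).1) (d.sgn κ) (d.c0 lam κ) (Sum.elim s (fun q => c q.1 q.2)) e := by
  unfold Design.M val Design.nu Design.sgn Design.c0
  by_cases h1 : (κ e.1).1 = (κ e.2).1 ∧ d.D (κ e.1).1 = true
  · simp only [if_pos h1, Sum.elim_inl]
  · by_cases h2 : d.A (κ e.2).1 (κ e.1).1 = true
    · simp only [if_neg h1, if_pos h2, Sum.elim_inr, one_mul]
    · by_cases h3 : d.A (κ e.1).1 (κ e.2).1 = true
      · simp only [if_neg h1, if_neg h2, if_pos h3, Sum.elim_inr, one_mul]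
      · simp only [if_neg h1, if_neg h2, if_neg h3]

lemma G_reduce (lam p : ℝ) (Ψ : (Fin n × Fin n → Option Bool) → (Fin n × Fin n → ℝ) → ℝ) :
    ∑ s : L → SignType, (∏ l, pw (1/2) (s l)) * ∑ t : Fin n → TT L, ∑ o, wt d.pi p (d.M lam s) t o *
      Ψ o (fun e => d.M lam s (t e.1) (t e.2)) =
    ∑ κ : Fin n → L × Bool × Bool, (∏ i, d.μ (κ i).1 * (1/4)) *
      ∑ z : L ⊕ (Fin n × L) → SignType, (∏ v, pw (d.wv v) (z v)) * ∑ o,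
        (∏ e, lik p (val (d.nu fun i => (κ i).1) (d.sgn κ) (d.c0 lam κ) z e) (o e)) *
        Ψ o (val (d.nu fun i => (κ i).1) (d.sgn κ) (d.c0 lam κ) z) := by
  simp only [sum_curry (I := Fin n) (L := L) (S := SignType)]
  have h1 : ∀ s : L → SignType, ∑ t : Fin n → TT L, ∑ o, wt d.pi p (d.M lam s) t o *
      Ψ o (fun e => d.M lam s (t e.1) (t e.2)) =
      ∑ κ : Fin n → L × Bool × Bool, ∑ c : Fin n → L → SignType,
       (∏ i, d.μ (κ i).1 * (1/4)) * ((∏ i, ∏ b, pw d.w (c i b)) * ∑ o,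
        (∏ e, lik p (val (d.nu fun i => (κ i).1) (d.sgn κ) (d.c0 lam κ)
          (Sum.elim s (fun q => c q.1 q.2)) e) (o e)) *
        Ψ o (val (d.nu fun i => (κ i).1) (d.sgn κ) (d.c0 lam κ) (Sum.elim s (fun q => c q.1 q.2)))) := by
    intro s
    rw [sum_arrow_prod]
    refine Finset.sum_congr rfl fun κ _ => Finset.sum_congr rfl fun c _ => ?_
    rw [Finset.mul_sum, Finset.mul_sum]
    refine Finset.sum_congr rfl fun o _ => ?_
    unfold wt
    simp only [M_val, Design.pi, Finset.prod_mul_distrib]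
    ring
  have h2 : ∀ (s : L → SignType) (c : Fin n → L → SignType),
      ∏ v, pw (d.wv v) ((Sum.elim s (fun q : Fin n × L => c q.1 q.2)) v) =
      (∏ l, pw (1/2) (s l)) * ∏ i, ∏ b, pw d.w (c i b) := by
    intro s c
    rw [Fintype.prod_sum_type, Fintype.prod_prod_type]; rfl
  simp only [h1, Finset.mul_sum]
  rw [Finset.sum_comm]
  refine Finset.sum_congr rfl fun κ _ => Finset.sum_congr rfl fun s _ => 
    Finset.sum_congr rfl fun c _ => Finset.sum_congr rfl fun o _ => ?_
  rw [h2]; ring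

lemma sum_labels (F : (Fin n → L) → ℝ) :
    ∑ κ : Fin n → L × Bool × Bool, (∏ i, d.μ (κ i).1 * (1/4)) * F (fun i => (κ i).1) =
    ∑ ℓ : Fin n → L, (∏ i, d.μ (ℓ i)) * F ℓ := by
  rw [sum_arrow_prod]
  refine Finset.sum_congr rfl fun ℓ _ => ?_
  simp only [Finset.sum_const, Finset.prod_mul_distrib, Finset.prod_const, Finset.card_univ,
    Fintype.card_pi, Fintype.card_prod, Fintype.card_bool, Fintype.card_fin, nsmul_eq_mul]
  push_cast
  have : (2:ℝ)^n * 2^n * (1/4)^n = 1 := by rw [← mul_pow, ← mul_pow]; norm_num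
  linear_combination ((∏ i, d.μ (ℓ i)) * F ℓ) * this

/-- label counts -/
def kk (ℓ : Fin n → L) (l : L) : ℕ := (Finset.univ.filter fun i => ℓ i = l).card
def Design.kA (ℓ : Fin n → L) (b : L) : ℕ := (Finset.univ.filter fun i => d.A b (ℓ i) = true).card

variable {d}

lemma card_inl {lam : ℝ} (h : d.Ok lam) (ℓ : Fin n → L) (l : L) :
    (fib (d.nu ℓ) (some (.inl l))).card = if d.D l = true then (kk ℓ l)^2 else 0 := by
  have : fib (d.nu ℓ) (some (.inl l)) = if d.D l = true then
      (Finset.univ.filter fun i => ℓ i = l) ×ˢ (Finset.univ.filter fun i => ℓ i = l) else ∅ := by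
    ext e
    simp only [fib, Finset.mem_filter, Finset.mem_univ, true_and, Design.nu]
    split_ifs <;> simp_all <;> grind
  rw [this]
  split_ifs
  · rw [Finset.card_product]; simp [kk, sq]
  · simp

lemma card_inr {lam : ℝ} (h : d.Ok lam) (ℓ : Fin n → L) (i : Fin n) (b : L) :
    (fib (d.nu ℓ) (some (.inr (i, b)))).card = if d.A b (ℓ i) = true then 2 * kk ℓ b else 0 := by
  have : fib (d.nu ℓ) (some (.inr (i, b))) = if d.A b (ℓ i) = true then
      (Finset.univ.filter fun j => ℓ j = b).image (fun j => (i, j)) ∪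
      (Finset.univ.filter fun j => ℓ j = b).image (fun j => (j, i)) else ∅ := by
    have irr := h.irr
    have asym := h.asym
    ext ⟨x, y⟩
    simp only [fib, Finset.mem_filter, Finset.mem_univ, true_and, Design.nu]
    split_ifs <;> simp_all <;> grind
  rw [this]
  split_ifs with hb
  · rw [Finset.card_union_of_disjoint, Finset.card_image_of_injective _ (fun a b h => by simpa using h),
      Finset.card_image_of_injective _ (fun a b h => by simpa using h)]
    · simp only [kk]; ring
    · rw [Finset.disjoint_left]
      rintro ⟨x, y⟩ h1 h2
      simp only [Finset.mem_image, Finset.mem_filter, Finset.mem_univ, true_and, Prod.mk.injEq] at h1 h2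
      obtain ⟨a, ha, rfl, rfl⟩ := h1
      obtain ⟨a', ha', rfl, h3⟩ := h2
      rw [ha', h.irr] at hb
      simp at hb
  · simp

lemma wv_ok {lam : ℝ} (h : d.Ok lam) (v : L ⊕ (Fin n × L)) : 1/2 ≤ d.wv v ∧ d.wv v ≤ 1 := by
  rcases v with v | v
  · simp [Design.wv]; norm_num
  · exact ⟨h.w0, h.w1⟩

lemma sgn_ok (κ : Fin n → L × Bool × Bool) (e) : d.sgn κ e = 1 ∨ d.sgn κ e = -1 := by
  unfold Design.sgn
  split_ifs
  · cases (κ e.1).2.1 <;> cases (κ e.2).2.1 <;> simp [sg]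
  · exact Or.inl rfl

lemma c0_ok {lam : ℝ} (hl : 0 < lam) (h : d.Ok lam) (κ : Fin n → L × Bool × Bool) (e) :
    |d.c0 lam κ e| ≤ 1 := by
  have hsg : ∀ b, |sg b| = 1 := by intro b; cases b <;> simp [sg]
  unfold Design.c0
  split_ifs
  · have hpos : 0 < d.μ d.l0 * d.μ d.l1 := mul_pos (h.pos _) (h.pos _)
    rw [abs_mul, abs_mul, hsg, hsg, mul_one, mul_one, abs_div, abs_of_pos hl,
      abs_of_nonneg (Real.sqrt_nonneg _), div_le_one (Real.sqrt_pos.2 hpos)]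
    exact Real.le_sqrt_of_sq_le h.hlam
  · simp

variable (d) in
lemma prior_sum : ∑ s : L → SignType, ∏ l, pw (1/2) (s l) = 1 := sumc_one _

/-- Family G, uniform risk -/
theorem G01 {p lam : ℝ} (hp : p ∈ Set.Ioc (0:ℝ) 1) (hl : 0 < lam) (h : d.Ok lam)
    (Yhat : (Fin n → Fin n → Bool × ℝ) → Fin n → Fin n → ℝ) (r : ℝ)
    (hr : r ≤ ∑ ℓ : Fin n → L, (∏ i, d.μ (ℓ i)) *
      (1 - (∏ l, if d.D l = true then Sfac (1/2) p (kk ℓ l ^ 2) else 1) *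
        ∏ b, Sfac d.w p (2 * kk ℓ b) ^ (d.kA ℓ b))) : Goal01 n p lam Yhat r := by
  classical
  have : Nonempty (TT L) := ⟨((d.l0, true, true), fun _ => 0)⟩
  have hw : 0 ≤ d.w := by linarith [h.w0]
  refine goal01_of hp Yhat d.pi (fun t => ?_) (pi_sum d h.sum)
    (fun s : L → SignType => ∏ l, pw (1/2) (s l)) (fun s => ?_) (sumc_one _) (d.M lam)
    (M_abs hl h) (fun s τ hτ hπ => h.mem hl s τ hτ hπ) r (hr.trans ?_)
  · exact mul_nonneg (mul_nonneg (h.pos _).le (by norm_num))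
      (Finset.prod_nonneg fun b _ => pw_nonneg hw h.w1 _)
  · exact Finset.prod_nonneg fun b _ => pw_nonneg (by norm_num) (by norm_num) _
  · unfold R01
    have := G_reduce d lam p (fun o v => if ∃ e, 1/2 ≤ |est Yhat o e - v e| then (1:ℝ) else 0)
    refine le_of_le_of_eq ?_ this.symm
    rw [← sum_labels]
    refine Finset.sum_le_sum fun κ _ => mul_le_mul_of_nonneg_left ?_
      (Finset.prod_nonneg fun i _ => mul_nonneg (h.pos _).le (by norm_num))
    refine le_trans (le_of_eq ?_) (bayes01 hp.1.le hp.2 d.wv (fun v => (wv_ok h v).1)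
      (fun v => (wv_ok h v).2) (d.nu fun i => (κ i).1) (d.sgn κ) (d.c0 lam κ) (sgn_ok κ)
      (c0_ok hl h κ) (est Yhat))
    congr 1
    rw [Fintype.prod_sum_type]
    congr 1
    · refine Finset.prod_congr rfl fun l _ => ?_
      rw [card_inl h]
      split_ifs
      · rfl
      · simp [Sfac]
    · rw [Fintype.prod_prod_type_right]
      refine Finset.prod_congr rfl fun b _ => ?_
      have : ∀ i, Sfac (d.wv (.inr (i, b) : L ⊕ Fin n × L)) p
          (fib (d.nu fun i => (κ i).1) (some (.inr (i, b)))).card =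
          if d.A b (κ i).1 = true then Sfac d.w p (2 * kk (fun i => (κ i).1) b) else 1 := by
        intro i
        rw [card_inr h]
        split_ifs
        · rfl
        · simp [Sfac]
      simp only [this]
      rw [Finset.prod_ite, Finset.prod_const, Finset.prod_const_one, mul_one]
      rfl

/-- Family G, squared risk -/
theorem G2 {p lam : ℝ} (hp : p ∈ Set.Ioc (0:ℝ) 1) (hl : 0 < lam) (h : d.Ok lam) (hn : 1 ≤ n)
    (Yhat : (Fin n → Fin n → Bool × ℝ) → Fin n → Fin n → ℝ) (r : ℝ)
    (hr : (n:ℝ)^2 * r ≤ ∑ ℓ : Fin n → L, (∏ i, d.μ (ℓ i)) *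
      ((∑ l, if d.D l = true then (kk ℓ l : ℝ)^2 * (1/2 * (1 - p/2)^(kk ℓ l ^ 2)) else 0) +
        ∑ b, (d.kA ℓ b : ℝ) * (2 * kk ℓ b) * (2 * d.w * (1 - d.w) * (1 - p/2)^(2 * kk ℓ b)))) :
    Goal2 n p lam Yhat r := by
  classical
  have : Nonempty (TT L) := ⟨((d.l0, true, true), fun _ => 0)⟩
  have hw : 0 ≤ d.w := by linarith [h.w0]
  refine goal2_of hp Yhat d.pi (fun t => ?_) (pi_sum d h.sum)
    (fun s : L → SignType => ∏ l, pw (1/2) (s l)) (fun s => ?_) (sumc_one _) (d.M lam)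
    (M_abs hl h) (fun s τ hτ hπ => h.mem hl s τ hτ hπ) r (hr.trans ?_) hn
  · exact mul_nonneg (mul_nonneg (h.pos _).le (by norm_num))
      (Finset.prod_nonneg fun b _ => pw_nonneg hw h.w1 _)
  · exact Finset.prod_nonneg fun b _ => pw_nonneg (by norm_num) (by norm_num) _
  · unfold R2
    have := G_reduce d lam p (fun o v => ∑ e, (est Yhat o e - v e)^2)
    refine le_of_le_of_eq ?_ this.symm
    rw [← sum_labels]
    refine Finset.sum_le_sum fun κ _ => mul_le_mul_of_nonneg_left ?_
      (Finset.prod_nonneg fun i _ => mul_nonneg (h.pos _).le (by norm_num))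
    refine le_trans (le_of_eq ?_) (bayes2 hp.1.le hp.2 d.wv (fun v => (wv_ok h v).1)
      (fun v => (wv_ok h v).2) (d.nu fun i => (κ i).1) (d.sgn κ) (d.c0 lam κ) (sgn_ok κ)
      (c0_ok hl h κ) (est Yhat))
    rw [← Finset.sum_fiberwise Finset.univ (d.nu fun i => (κ i).1), Fintype.sum_option,
      Fintype.sum_sum_type]
    have e0 : ∀ x : Option (L ⊕ (Fin n × L)), ∑ e ∈ fib (d.nu fun i => (κ i).1) x,
        ((d.nu (fun i => (κ i).1) e).elim 0 fun v => 2 * d.wv v * (1 - d.wv v) *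
          (1 - p/2)^(fib (d.nu fun i => (κ i).1) (some v)).card)
        = x.elim 0 fun v => (fib (d.nu fun i => (κ i).1) (some v)).card * (2 * d.wv v * (1 - d.wv v) *
              (1 - p/2)^(fib (d.nu fun i => (κ i).1) (some v)).card) := by
      intro x
      rw [Finset.sum_congr rfl (g := fun _ => x.elim 0 fun v => 2 * d.wv v * (1 - d.wv v) * (1 - p/2)^(fib (d.nu fun i => (κ i).1) (some v)).card)]
      · rcases x with _ | v
        · simp
        · simp only [Finset.sum_const, nsmul_eq_mul, Option.elim]
      · intro e he
        rw [(Finset.mem_filter.1 he).2]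
    refine Eq.trans ?_ (congrArg₂ (· + ·) (e0 none) (congrArg₂ (· + ·)
      (Finset.sum_congr rfl (fun l _ => e0 (some (.inl l))))
      (Finset.sum_congr rfl (fun l _ => e0 (some (.inr l)))))).symm
    simp only [zero_add, Option.elim]
    congr 1
    · refine Finset.sum_congr rfl fun l _ => ?_
      rw [card_inl h]
      split_ifs
      · simp only [Design.wv, Sum.elim_inl]; push_cast; ring
      · simp
    · rw [Fintype.sum_prod_type_right]
      refine Finset.sum_congr rfl fun b _ => ?_
      simp only [card_inr h, Design.wv, Sum.elim_inr]
      rw [Finset.sum_congr rfl (g := fun i => if d.A b (κ i).1 = true then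
        ((2 * kk (fun i => (κ i).1) b : ℕ) : ℝ) * (2 * d.w * (1 - d.w) *
          (1 - p/2)^(2 * kk (fun i => (κ i).1) b)) else 0)]
      · rw [Finset.sum_ite, Finset.sum_const, Finset.sum_const_zero, add_zero, nsmul_eq_mul]
        simp only [Design.kA]; push_cast; ring
      · intro i _
        split_ifs <;> simp

end famG
end GLB

end

section
open MeasureTheory
namespace GLB

/-! ### Family S : rank one kernel -/
section famS

def bM (x y : Bool) : ℝ := if x && y then 1 else 0

noncomputable def bpi (lam : ℝ) (t : Bool) : ℝ := if t then lam else 1 - lam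

lemma bM_abs (x y : Bool) : |bM x y| ≤ 1 := by cases x <;> cases y <;> simp [bM]

lemma bM_mem {lam : ℝ} (h0 : 0 < lam) (τ : ℝ → Bool) (hτ : Measurable τ)
    (hπ : ∀ t, U01.real (τ ⁻¹' {t}) = bpi lam t) :
    MemFLam lam (fun x y => bM (τ x) (τ y)) := by
  have hs : Real.sqrt lam * Real.sqrt lam = lam := Real.mul_self_sqrt h0.le
  have hs0 : Real.sqrt lam ≠ 0 := (Real.sqrt_pos.2 h0).ne'
  refine memFLam_of_eigen (bpi lam) τ hτ hπ bM bM_abs ?_ lam h0 (ι := Unit) (fun _ => lam)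
    (fun _ t => if t then (Real.sqrt lam)⁻¹ else 0) ?_ ?_ ?_ ⟨(), abs_of_pos h0⟩
  · intro x y; cases x <;> cases y <;> simp [bM]
  · intro x y
    have : lam * (Real.sqrt lam)⁻¹ * (Real.sqrt lam)⁻¹ = 1 := by
      rw [mul_assoc, ← mul_inv, hs]; exact mul_inv_cancel₀ h0.ne'
    cases x <;> cases y <;> simp [bM, this]
  · intro k k' _ _
    have : lam * ((Real.sqrt lam)⁻¹ * (Real.sqrt lam)⁻¹) = 1 := by
      rw [← mul_inv, hs]; exact mul_inv_cancel₀ h0.ne'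
    simp [bpi, this]
  · intro k; right; rw [abs_of_pos h0]

noncomputable def qC (p : ℝ) (m1 m0 : ℝ) : Option Bool → ℝ := if m0 = m1 then lik p m1 else cons p 1
noncomputable def qN (p : ℝ) (m1 m0 : ℝ) : Option Bool → ℝ := if m0 = m1 then lik p m1 else nn p

lemma S_point {E : Type} [DecidableEq E] {p : ℝ} (h0 : 0 ≤ p) (h1 : p ≤ 1) (F : Finset E)
    (m1 m0 : E → ℝ) (hm : ∀ e, |m1 e| ≤ 1) (h : ∀ e, m0 e = m1 e ∨ (m0 e = 0 ∧ m1 e = 1))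
    (o : E → Option Bool) :
    0 ≤ ∏ e ∈ F, qN p (m1 e) (m0 e) (o e) ∧
    ∏ e ∈ F, qN p (m1 e) (m0 e) (o e) ≤ ∏ e ∈ F, qC p (m1 e) (m0 e) (o e) ∧
    ∏ e ∈ F, qC p (m1 e) (m0 e) (o e) ≤ ∏ e ∈ F, lik p (m0 e) (o e) ∧
    2 * ∏ e ∈ F, qC p (m1 e) (m0 e) (o e) - ∏ e ∈ F, qN p (m1 e) (m0 e) (o e)
      ≤ ∏ e ∈ F, lik p (m1 e) (o e) := by
  induction F using Finset.induction_on with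
  | empty => simp; norm_num
  | insert a F ha ih =>
    simp only [Finset.prod_insert ha]
    set N := ∏ e ∈ F, qN p (m1 e) (m0 e) (o e)
    set C := ∏ e ∈ F, qC p (m1 e) (m0 e) (o e)
    set L0 := ∏ e ∈ F, lik p (m0 e) (o e)
    set L1 := ∏ e ∈ F, lik p (m1 e) (o e)
    obtain ⟨i1, i2, i3, i4⟩ := ih
    rcases h a with h' | ⟨h', h''⟩
    · have hl := lik_nonneg h0 h1 (hm a) (o a)
      simp only [qN, qC, h', if_true]
      refine ⟨by positivity, mul_le_mul_of_nonneg_left i2 hl, mul_le_mul_of_nonneg_left i3 hl, ?_⟩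
      nlinarith
    · simp only [qN, qC, h', h'']
      rw [if_neg (by norm_num), if_neg (by norm_num)]
      rcases o a with _ | _ | _
      · simp only [cons, nn, lik]
        refine ⟨mul_nonneg (by linarith) i1, mul_le_mul_of_nonneg_left i2 (by linarith),
          mul_le_mul_of_nonneg_left i3 (by linarith), ?_⟩
        nlinarith
      · simp only [cons, nn, lik]
        norm_num
        exact mul_nonneg (by linarith) (by linarith)
      · simp only [cons, nn, lik]
        norm_num
        refine ⟨mul_nonneg (by linarith) (by linarith), ?_, ?_⟩
        · nlinarith
        · nlinarith

lemma qC_sum (p m1 m0 : ℝ) : ∑ a, qC p m1 m0 a = if m0 = m1 then 1 else 1 - p/2 := by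
  unfold qC; split_ifs
  · exact lik_sum _ _
  · exact cons_sum _ _
lemma qN_sum (p m1 m0 : ℝ) : ∑ a, qN p m1 m0 a = if m0 = m1 then 1 else 1 - p := by
  unfold qN; split_ifs
  · exact lik_sum _ _
  · exact nn_sum _

variable {m : ℕ}

abbrev ins (i : Fin (m+1)) (b : Bool) (t : Fin m → Bool) : Fin (m+1) → Bool := Fin.insertNth i b t

lemma sum_ins (i : Fin (m+1)) (F : (Fin (m+1) → Bool) → ℝ) :
    ∑ t, F t = ∑ t : Fin m → Bool, (F (ins i true t) + F (ins i false t)) := by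
  rw [← Equiv.sum_comp (Fin.insertNthEquiv (fun _ => Bool) i), Fintype.sum_prod_type_right]
  refine Finset.sum_congr rfl fun t _ => ?_
  rw [Fintype.sum_bool]; rfl

noncomputable abbrev m1 (i : Fin (m+1)) (t : Fin m → Bool) (e : Fin (m+1) × Fin (m+1)) : ℝ :=
  bM (ins i true t e.1) (ins i true t e.2)
noncomputable abbrev m0 (i : Fin (m+1)) (t : Fin m → Bool) (e : Fin (m+1) × Fin (m+1)) : ℝ :=
  bM (ins i false t e.1) (ins i false t e.2)

lemma m01 (i : Fin (m+1)) (t : Fin m → Bool) (e : Fin (m+1) × Fin (m+1)) :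
    m0 i t e = m1 i t e ∨ (m0 i t e = 0 ∧ m1 i t e = 1) := by
  obtain ⟨x, y⟩ := e
  simp only [m0, m1]
  induction x using Fin.succAboveCases i <;> induction y using Fin.succAboveCases i <;>
    simp [ins, bM]

lemma prod_aff (i : Fin (m+1)) (t : Fin m → Bool) (c : ℝ) :
    ∏ e, (if m0 i t e = m1 i t e then (1:ℝ) else c) = c * ∏ j, (if t j then c^2 else 1) := by
  have inner : ∀ x, ∏ y, (if m0 i t (x, y) = m1 i t (x, y) then (1:ℝ) else c) =
      (if m0 i t (x, i) = m1 i t (x, i) then (1:ℝ) else c) *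
      ∏ k, (if m0 i t (x, i.succAbove k) = m1 i t (x, i.succAbove k) then (1:ℝ) else c) :=
    fun x => Fin.prod_univ_succAbove _ i
  rw [Fintype.prod_prod_type, Fin.prod_univ_succAbove _ i]
  simp only [inner]
  have e1 : (if m0 i t (i, i) = m1 i t (i, i) then (1:ℝ) else c) = c := by simp [m0, m1, bM, ins]
  have e2 : ∀ j, (if m0 i t (i, i.succAbove j) = m1 i t (i, i.succAbove j) then (1:ℝ) else c) =
      if t j then c else 1 := by intro j; cases h : t j <;> simp [m0, m1, bM, ins, h]
  have e3 : ∀ j, (if m0 i t (i.succAbove j, i) = m1 i t (i.succAbove j, i) then (1:ℝ) else c) =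
      if t j then c else 1 := by intro j; cases h : t j <;> simp [m0, m1, bM, ins, h]
  have e4 : ∀ j k, (if m0 i t (i.succAbove j, i.succAbove k) = m1 i t (i.succAbove j, i.succAbove k)
      then (1:ℝ) else c) = 1 := by intro j k; simp [m0, m1, bM, ins]
  simp only [e1, e2, e3, e4, Finset.prod_const_one, mul_one]
  rw [mul_assoc, ← Finset.prod_mul_distrib]
  congr 1
  refine Finset.prod_congr rfl fun j _ => ?_
  split_ifs <;> ring

lemma prior_ins (lam : ℝ) (i : Fin (m+1)) (b : Bool) (t : Fin m → Bool) :
    ∏ k, bpi lam (ins i b t k) = bpi lam b * ∏ j, bpi lam (t j) := by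
  rw [Fin.prod_univ_succAbove _ i]; simp [ins]

lemma others (lam c : ℝ) : ∑ t : Fin m → Bool, (∏ j, bpi lam (t j)) * ∏ j, (if t j then c else 1)
    = (1 - lam + lam * c)^m := by
  simp only [← Finset.prod_mul_distrib]
  rw [sum_prod_pi (fun (_ : Fin m) b => bpi lam b * (if b then c else 1))]
  simp [bpi]; ring

lemma Csum (p : ℝ) (i : Fin (m+1)) (t : Fin m → Bool) :
    ∑ o : Fin (m+1) × Fin (m+1) → Option Bool, ∏ e, qC p (m1 i t e) (m0 i t e) (o e) = (1 - p/2) * ∏ j, (if t j then (1-p/2)^2 else 1) := by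
  rw [sum_prod_pi (fun e a => qC p (m1 i t e) (m0 i t e) a)]
  simp only [qC_sum]; exact prod_aff i t _
lemma Nsum (p : ℝ) (i : Fin (m+1)) (t : Fin m → Bool) :
    ∑ o : Fin (m+1) × Fin (m+1) → Option Bool, ∏ e, qN p (m1 i t e) (m0 i t e) (o e) = (1 - p) * ∏ j, (if t j then (1-p)^2 else 1) := by
  rw [sum_prod_pi (fun e a => qN p (m1 i t e) (m0 i t e) a)]
  simp only [qN_sum]; exact prod_aff i t _

theorem S01 {p lam : ℝ} (hp : p ∈ Set.Ioc (0:ℝ) 1) (hl : 1/3 ≤ lam) (hl2 : lam ≤ 1/2)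
    (Yhat : (Fin (m+1) → Fin (m+1) → Bool × ℝ) → Fin (m+1) → Fin (m+1) → ℝ) (r : ℝ)
    (hr : r ≤ (1 - lam) * (1 - p/2) * (1 - lam + lam * (1-p/2)^2)^m -
      (1 - 2*lam) * (1 - p) * (1 - lam + lam * (1-p)^2)^m) : Goal01 (m+1) p lam Yhat r := by
  classical
  have h0 : 0 < lam := by linarith
  have hb : ∀ b, 0 ≤ bpi lam b := by intro b; cases b <;> simp [bpi] <;> linarith
  refine goal01_of hp Yhat (bpi lam) hb (by simp [bpi]) (S := Unit) (fun _ => 1) (by simp)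
    (by simp) (fun _ => bM) (fun _ => bM_abs) (fun _ τ hτ hπ => bM_mem h0 τ hτ hπ) r (hr.trans ?_)
  simp only [Finset.univ_unique, Finset.sum_singleton, one_mul]
  unfold R01
  rw [sum_ins 0, ← others, ← others, Finset.mul_sum, Finset.mul_sum, ← Finset.sum_sub_distrib]
  refine Finset.sum_le_sum fun t _ => ?_
  have hP : 0 ≤ ∏ j, bpi lam (t j) := Finset.prod_nonneg fun j _ => hb _
  rw [← Finset.sum_add_distrib]
  have e1 : (1 - lam) * (1 - p/2) * ((∏ j, bpi lam (t j)) * ∏ j, (if t j then (1-p/2)^2 else 1)) -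
      (1 - 2*lam) * (1 - p) * ((∏ j, bpi lam (t j)) * ∏ j, (if t j then (1-p)^2 else 1)) =
      ∑ o : Fin (m+1) × Fin (m+1) → Option Bool, (∏ j, bpi lam (t j)) * ((1 - lam) * ∏ e, qC p (m1 0 t e) (m0 0 t e) (o e) -
        (1 - 2*lam) * ∏ e, qN p (m1 0 t e) (m0 0 t e) (o e)) := by
    rw [← Finset.mul_sum, Finset.sum_sub_distrib, ← Finset.mul_sum, ← Finset.mul_sum, Csum, Nsum]
    ring
  rw [e1]
  refine Finset.sum_le_sum fun o _ => ?_
  obtain ⟨a1, a2, a3, a4⟩ := S_point hp.1.le hp.2 Finset.univ (m1 0 t) (m0 0 t)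
    (fun e => bM_abs _ _) (m01 0 t) o
  unfold wt
  rw [prior_ins, prior_ins]
  set P := ∏ j, bpi lam (t j)
  set C := ∏ e, qC p (m1 0 t e) (m0 0 t e) (o e)
  set N := ∏ e, qN p (m1 0 t e) (m0 0 t e) (o e)
  change _ ≤ bpi lam true * P * (∏ e, lik p (m1 0 t e) (o e)) *
     (if ∃ e, 1/2 ≤ |est Yhat o e - m1 0 t e| then 1 else 0) +
     bpi lam false * P * (∏ e, lik p (m0 0 t e) (o e)) *
     (if ∃ e, 1/2 ≤ |est Yhat o e - m0 0 t e| then 1 else 0)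
  set L1 := ∏ e, lik p (m1 0 t e) (o e)
  set L0 := ∏ e, lik p (m0 0 t e) (o e)
  have hL1 : 0 ≤ L1 := by linarith
  have hL0 : 0 ≤ L0 := by linarith
  have b1 : (1 - lam) * C - (1 - 2*lam) * N ≤ lam * L1 := by nlinarith
  have b0 : (1 - lam) * C - (1 - 2*lam) * N ≤ (1 - lam) * L0 := by nlinarith
  simp only [bpi, if_true, Bool.false_eq_true, if_false]
  by_cases c1 : ∃ e, 1/2 ≤ |est Yhat o e - m1 0 t e|
  · rw [if_pos c1]
    have : 0 ≤ (1 - lam) * P * L0 * (if ∃ e, 1/2 ≤ |est Yhat o e - m0 0 t e| then 1 else 0) := by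
      refine mul_nonneg (mul_nonneg (mul_nonneg (by linarith) hP) hL0) ?_
      split_ifs <;> norm_num
    have := mul_le_mul_of_nonneg_left b1 hP
    linarith
  · have c0 : ∃ e, 1/2 ≤ |est Yhat o e - m0 0 t e| := by
      push Not at c1
      refine ⟨(0, 0), ?_⟩
      have := abs_lt.1 (c1 (0, 0))
      simp [m1, m0, ins, bM] at this ⊢
      rw [le_abs]; left; linarith
    rw [if_neg c1, if_pos c0]
    have := mul_le_mul_of_nonneg_left b0 hP
    linarith

theorem S2 {p lam : ℝ} (hp : p ∈ Set.Ioc (0:ℝ) 1) (h0 : 0 < lam) (hl2 : lam ≤ 1/2)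
    (Yhat : (Fin (m+1) → Fin (m+1) → Bool × ℝ) → Fin (m+1) → Fin (m+1) → ℝ) (r : ℝ)
    (hr : ((m+1 : ℕ):ℝ)^2 * r ≤ ((m+1 : ℕ):ℝ) * (lam * (1 - lam) * (1 - p/2) *
      ((1 - lam + lam * (1-p/2)^2)^m +
       m * (lam * (1-p/2)^2 * (1 - lam + lam * (1-p/2)^2)^(m-1))))) : Goal2 (m+1) p lam Yhat r := by
  classical
  have hb : ∀ b, 0 ≤ bpi lam b := by intro b; cases b <;> simp [bpi] <;> linarith
  refine goal2_of hp Yhat (bpi lam) hb (by simp [bpi]) (S := Unit) (fun _ => 1) (by simp)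
    (by simp) (fun _ => bM) (fun _ => bM_abs) (fun _ τ hτ hπ => bM_mem h0 τ hτ hπ) r (hr.trans ?_)
    (by omega)
  simp only [Finset.univ_unique, Finset.sum_singleton, one_mul]
  have hswap : R2 (bpi lam) p bM (est Yhat) = ∑ i : Fin (m+1), ∑ t : Fin (m+1) → Bool,
      ∑ o, ∑ j, wt (bpi lam) p bM t o * (est Yhat o (i, j) - bM (t i) (t j))^2 := by
    unfold R2
    simp only [Finset.mul_sum, Fintype.sum_prod_type]
    conv_lhs => 
      enter [2, t]
      rw [Finset.sum_comm]
    rw [Finset.sum_comm]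
  rw [hswap]
  rw [show ((m+1 : ℕ):ℝ) * (lam * (1 - lam) * (1 - p/2) *
      ((1 - lam + lam * (1-p/2)^2)^m +
       m * (lam * (1-p/2)^2 * (1 - lam + lam * (1-p/2)^2)^(m-1)))) = ∑ i : Fin (m+1), (lam * (1 - lam) * (1 - p/2) *
      ((1 - lam + lam * (1-p/2)^2)^m +
       m * (lam * (1-p/2)^2 * (1 - lam + lam * (1-p/2)^2)^(m-1)))) by simp]
  refine Finset.sum_le_sum fun i _ => ?_
  rw [sum_ins i]
  have key : ∀ t : Fin m → Bool, lam * (1 - lam) * ((∏ j, bpi lam (t j)) *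
      (((1 - p/2) * ∏ j, (if t j then (1-p/2)^2 else 1)) * (1 + ∑ j, if t j then (1:ℝ) else 0))) ≤
      ∑ o, ∑ j, wt (bpi lam) p bM (ins i true t) o * (est Yhat o (i, j) - bM (ins i true t i) (ins i true t j))^2
      + ∑ o, ∑ j, wt (bpi lam) p bM (ins i false t) o * (est Yhat o (i, j) - bM (ins i false t i) (ins i false t j))^2 := by
    intro t
    have hP : 0 ≤ ∏ j, bpi lam (t j) := Finset.prod_nonneg fun j _ => hb _
    rw [← Csum p i t, ← Finset.sum_add_distrib, Finset.sum_mul, Finset.mul_sum, Finset.mul_sum]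
    refine Finset.sum_le_sum fun o _ => ?_
    rw [← Finset.sum_add_distrib]
    obtain ⟨a1, a2, a3, a4⟩ := S_point hp.1.le hp.2 Finset.univ (m1 i t) (m0 i t)
      (fun e => bM_abs _ _) (m01 i t) o
    unfold wt
    rw [prior_ins, prior_ins]
    set P := ∏ j, bpi lam (t j)
    set C := ∏ e, qC p (m1 i t e) (m0 i t e) (o e)
    set N := ∏ e, qN p (m1 i t e) (m0 i t e) (o e)
    have heq : ∀ j, bpi lam true * P * (∏ e : Fin (m+1) × Fin (m+1), lik p (bM (ins i true t e.1) (ins i true t e.2)) (o e)) *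
        (est Yhat o (i, j) - bM (ins i true t i) (ins i true t j))^2 +
        bpi lam false * P * (∏ e : Fin (m+1) × Fin (m+1), lik p (bM (ins i false t e.1) (ins i false t e.2)) (o e)) *
        (est Yhat o (i, j) - bM (ins i false t i) (ins i false t j))^2 =
        lam * P * (∏ e, lik p (m1 i t e) (o e)) * (est Yhat o (i, j) - m1 i t (i, j))^2 +
        (1 - lam) * P * (∏ e, lik p (m0 i t e) (o e)) * (est Yhat o (i, j) - m0 i t (i, j))^2 := by
      intro j; simp only [bpi, if_true, Bool.false_eq_true, if_false, m1, m0]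
    simp only [heq]
    set L1 := ∏ e, lik p (m1 i t e) (o e)
    set L0 := ∏ e, lik p (m0 i t e) (o e)
    have hC : 0 ≤ C := by linarith
    have hL1 : C ≤ L1 := by linarith
    have hL0 : C ≤ L0 := by linarith
    have hl1 : 0 ≤ 1 - lam := by linarith
    have two : ∀ x : ℝ, lam * (1-lam) * (P * C) ≤ lam * P * L1 * (x - 1)^2 + (1 - lam) * P * L0 * (x - 0)^2 := by
      intro x
      have q1 : lam * P * C * (x-1)^2 ≤ lam * P * L1 * (x-1)^2 := by gcongr
      have q2 : (1-lam) * P * C * (x-0)^2 ≤ (1-lam) * P * L0 * (x-0)^2 := by gcongr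
      have q3 : 0 ≤ P * C * (x - lam)^2 := by positivity
      nlinarith
    have zero : ∀ x y z : ℝ, 0 ≤ lam * P * L1 * (x - y)^2 + (1 - lam) * P * L0 * (x - z)^2 := by
      intro x y z
      have : 0 ≤ L1 := hC.trans hL1
      have : 0 ≤ L0 := hC.trans hL0
      positivity
    rw [Fin.sum_univ_succAbove _ i]
    have f1 : m1 i t (i, i) = 1 := by simp [m1, ins, bM]
    have f0 : m0 i t (i, i) = 0 := by simp [m0, ins, bM]
    rw [f1, f0]
    have g : ∑ j, lam * (1-lam) * (P * C) * (if t j then (1:ℝ) else 0) ≤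
        ∑ j, (lam * P * L1 * (est Yhat o (i, i.succAbove j) - m1 i t (i, i.succAbove j))^2 +
        (1 - lam) * P * L0 * (est Yhat o (i, i.succAbove j) - m0 i t (i, i.succAbove j))^2) := by
      refine Finset.sum_le_sum fun j _ => ?_
      cases ht : t j
      · simp only [Bool.false_eq_true, if_false, mul_zero]; exact zero _ _ _
      · have f1 : m1 i t (i, i.succAbove j) = 1 := by simp [m1, ins, bM, ht]
        have f0 : m0 i t (i, i.succAbove j) = 0 := by simp [m0, ins, bM]
        rw [f1, f0]; simp only [if_true, mul_one]; exact two _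
    rw [← Finset.mul_sum] at g
    have := two (est Yhat o (i, i))
    linarith
  refine le_trans (le_of_eq ?_) (Finset.sum_le_sum fun t _ => key t)
  rw [← Finset.mul_sum]
  have e2 : ∀ j0 : Fin m, ∑ t : Fin m → Bool, (∏ j, bpi lam (t j)) *
      ((∏ j, (if t j then (1-p/2)^2 else 1)) * (if t j0 then (1:ℝ) else 0)) =
      lam * (1-p/2)^2 * (1 - lam + lam * (1-p/2)^2)^(m-1) := by
    intro j0
    have : ∀ t : Fin m → Bool, (∏ j, bpi lam (t j)) *
      ((∏ j, (if t j then (1-p/2)^2 else 1)) * (if t j0 then (1:ℝ) else 0)) =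
      ∏ j, (bpi lam (t j) * ((if t j then (1-p/2)^2 else 1) * (if j = j0 then (if t j then 1 else 0) else 1))) := by
      intro t
      rw [Finset.prod_mul_distrib, Finset.prod_mul_distrib,
        Finset.prod_ite_eq' Finset.univ j0 (fun j => if t j then (1:ℝ) else 0)]
      simp
    simp only [this]
    rw [sum_prod_pi (fun (j : Fin m) b => bpi lam b * ((if b then (1-p/2)^2 else 1) *
      (if j = j0 then (if b then 1 else 0) else 1))), ← Finset.mul_prod_erase _ _ (Finset.mem_univ j0)]
    rw [Finset.prod_congr rfl (g := fun _ => (1 - lam + lam * (1-p/2)^2))]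
    · rw [Finset.prod_const, Finset.card_erase_of_mem (Finset.mem_univ _)]
      simp [bpi]
    · intro j hj
      simp [bpi, (Finset.mem_erase.1 hj).1]; ring
  have e3 : ∑ t : Fin m → Bool, (∏ j, bpi lam (t j)) *
      (((1 - p/2) * ∏ j, (if t j then (1-p/2)^2 else 1)) * (1 + ∑ j, if t j then (1:ℝ) else 0)) =
      (1 - p/2) * (∑ t : Fin m → Bool, (∏ j, bpi lam (t j)) * (∏ j, (if t j then (1-p/2)^2 else 1)) +
       ∑ j0, ∑ t : Fin m → Bool, (∏ j, bpi lam (t j)) *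
      ((∏ j, (if t j then (1-p/2)^2 else 1)) * (if t j0 then (1:ℝ) else 0))) := by
    rw [Finset.sum_comm, ← Finset.sum_add_distrib, Finset.mul_sum]
    refine Finset.sum_congr rfl fun t _ => ?_
    rw [← Finset.mul_sum, ← Finset.mul_sum]; ring
  rw [e3, others]
  simp only [e2, Finset.sum_const, Finset.card_univ, Fintype.card_fin, nsmul_eq_mul]
  ring

end famS
end GLB

end

section
open MeasureTheory
namespace GLB

section expect
variable {L : Type} [Fintype L] [DecidableEq L] {n : ℕ}

noncomputable def Ex (μ : L → ℝ) (F : (Fin n → L) → ℝ) : ℝ := ∑ ℓ, (∏ i, μ (ℓ i)) * F ℓ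

lemma Ex_mono {μ : L → ℝ} (hμ : ∀ l, 0 ≤ μ l) {F G : (Fin n → L) → ℝ} (h : ∀ ℓ, F ℓ ≤ G ℓ) :
    Ex μ F ≤ Ex μ G :=
  Finset.sum_le_sum fun ℓ _ => mul_le_mul_of_nonneg_left (h ℓ) (Finset.prod_nonneg fun i _ => hμ _)

lemma Ex_add (μ : L → ℝ) (F G : (Fin n → L) → ℝ) :
    Ex μ (fun ℓ => F ℓ + G ℓ) = Ex μ F + Ex μ G := by
  simp only [Ex, mul_add, Finset.sum_add_distrib]
lemma Ex_sub (μ : L → ℝ) (F G : (Fin n → L) → ℝ) :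
    Ex μ (fun ℓ => F ℓ - G ℓ) = Ex μ F - Ex μ G := by
  simp only [Ex, mul_sub, Finset.sum_sub_distrib]
lemma Ex_smul (μ : L → ℝ) (c : ℝ) (F : (Fin n → L) → ℝ) :
    Ex μ (fun ℓ => c * F ℓ) = c * Ex μ F := by
  simp only [Ex, Finset.mul_sum]
  exact Finset.sum_congr rfl fun _ _ => by ring
lemma Ex_sum {ι : Type} (s : Finset ι) (μ : L → ℝ) (F : ι → (Fin n → L) → ℝ) :
    Ex μ (fun ℓ => ∑ i ∈ s, F i ℓ) = ∑ i ∈ s, Ex μ (F i) := by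
  simp only [Ex, Finset.mul_sum]; rw [Finset.sum_comm]

lemma Ex_one (μ P h : L → ℝ) (i : Fin n) :
    Ex μ (fun ℓ => P (ℓ i) * ∏ m ∈ Finset.univ.erase i, h (ℓ m)) =
      (∑ l, μ l * P l) * (∑ l, μ l * h l)^(n-1) := by
  have : ∀ ℓ : Fin n → L, (∏ i, μ (ℓ i)) * (P (ℓ i) * ∏ m ∈ Finset.univ.erase i, h (ℓ m)) =
      ∏ m, (μ (ℓ m) * if m = i then P (ℓ m) else h (ℓ m)) := by
    intro ℓ
    rw [Finset.prod_mul_distrib, ← Finset.mul_prod_erase _ _ (Finset.mem_univ i)]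
    congr 1
    rw [← Finset.mul_prod_erase _ (fun m => if m = i then P (ℓ m) else h (ℓ m)) (Finset.mem_univ i), if_pos rfl]
    congr 1
    exact Finset.prod_congr rfl fun m hm => by rw [if_neg (Finset.ne_of_mem_erase hm)]
  unfold Ex
  simp only [this]
  rw [sum_prod_pi (fun m l => μ l * if m = i then P l else h l),
    ← Finset.mul_prod_erase _ _ (Finset.mem_univ i)]
  simp only [if_true]
  congr 1
  rw [Finset.prod_congr rfl (g := fun _ => ∑ l, μ l * h l)]
  · rw [Finset.prod_const, Finset.card_erase_of_mem (Finset.mem_univ _)]; simp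
  · intro m hm; simp [Finset.ne_of_mem_erase hm]

lemma Ex_pair (μ P Q h : L → ℝ) {i j : Fin n} (hij : j ≠ i) :
    Ex μ (fun ℓ => P (ℓ i) * (Q (ℓ j) * ∏ m ∈ (Finset.univ.erase i).erase j, h (ℓ m))) =
      (∑ l, μ l * P l) * ((∑ l, μ l * Q l) * (∑ l, μ l * h l)^(n-2)) := by
  have hj : j ∈ (Finset.univ : Finset (Fin n)).erase i := Finset.mem_erase.2 ⟨hij, Finset.mem_univ _⟩
  have : ∀ ℓ : Fin n → L, (∏ i, μ (ℓ i)) * (P (ℓ i) * (Q (ℓ j) * ∏ m ∈ (Finset.univ.erase i).erase j, h (ℓ m))) =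
      ∏ m, (μ (ℓ m) * if m = i then P (ℓ m) else if m = j then Q (ℓ m) else h (ℓ m)) := by
    intro ℓ
    rw [Finset.prod_mul_distrib]
    congr 1
    rw [← Finset.mul_prod_erase _ (fun m => if m = i then P (ℓ m) else if m = j then Q (ℓ m) else h (ℓ m)) (Finset.mem_univ i), if_pos rfl,
      ← Finset.mul_prod_erase _ _ hj, if_neg hij, if_pos rfl]
    congr 2
    refine Finset.prod_congr rfl fun m hm => ?_
    rw [if_neg (Finset.ne_of_mem_erase (Finset.mem_of_mem_erase hm)), if_neg (Finset.ne_of_mem_erase hm)]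
  unfold Ex
  simp only [this]
  rw [sum_prod_pi (fun m l => μ l * if m = i then P l else if m = j then Q l else h l),
    ← Finset.mul_prod_erase _ _ (Finset.mem_univ i), ← Finset.mul_prod_erase _ _ hj]
  simp only [if_true, if_neg hij]
  congr 2
  rw [Finset.prod_congr rfl (g := fun _ => ∑ l, μ l * h l)]
  · rw [Finset.prod_const, Finset.card_erase_of_mem hj, Finset.card_erase_of_mem (Finset.mem_univ _)]
    simp [Nat.sub_sub]
  · intro m hm; simp [Finset.ne_of_mem_erase (Finset.mem_of_mem_erase hm), Finset.ne_of_mem_erase hm]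

lemma sum_pairs (c : ℝ) : (∑ i : Fin n, ∑ j ∈ Finset.univ.erase i, c) = n * (n - 1) * c := by
  rcases n with _ | n
  · simp
  · simp [Finset.card_erase_of_mem]; ring

/-- indicator that the label `l` occurs exactly once -/
noncomputable def one1 (ℓ : Fin n → L) (l : L) : ℝ := if kk ℓ l = 1 then 1 else 0

lemma kk_one_iff (ℓ : Fin n → L) (l : L) (i : Fin n) (hi : ℓ i = l) :
    kk ℓ l = 1 ↔ ∀ m ∈ Finset.univ.erase i, ℓ m ≠ l := by
  unfold kk
  constructor
  · intro h m hm hml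
    obtain ⟨a, ha⟩ := Finset.card_eq_one.1 h
    have h1 : i ∈ ({a} : Finset (Fin n)) := ha ▸ (by simp [hi])
    have h2 : m ∈ ({a} : Finset (Fin n)) := ha ▸ (by simp [hml])
    simp at h1 h2
    exact Finset.ne_of_mem_erase hm (h2.trans h1.symm)
  · intro h
    refine Finset.card_eq_one.2 ⟨i, ?_⟩
    ext m
    simp only [Finset.mem_filter, Finset.mem_univ, true_and, Finset.mem_singleton]
    constructor
    · intro hm; by_contra hne; exact h m (Finset.mem_erase.2 ⟨hne, Finset.mem_univ _⟩) hm
    · rintro rfl; exact hi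

lemma one1_mul (ℓ : Fin n → L) (l : L) (F : ℝ) :
    one1 ℓ l * F = ∑ i, (if ℓ i = l then 1 else 0) *
      ((∏ m ∈ Finset.univ.erase i, if ℓ m = l then 0 else 1) * F) := by
  have key : ∀ i, (if ℓ i = l then (1:ℝ) else 0) * ((∏ m ∈ Finset.univ.erase i, if ℓ m = l then 0 else 1) * F) =
      (if ℓ i = l then 1 else 0) * (one1 ℓ l * F) := by
    intro i
    split_ifs with h
    · congr 2
      unfold one1
      by_cases h1 : kk ℓ l = 1
      · rw [if_pos h1]
        exact Finset.prod_eq_one fun m hm => if_neg ((kk_one_iff ℓ l i h).1 h1 m hm)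
      · rw [if_neg h1]
        rw [kk_one_iff ℓ l i h] at h1
        push Not at h1
        obtain ⟨m, hm, h2⟩ := h1
        exact Finset.prod_eq_zero hm (if_pos h2)
    · simp
  simp only [key]
  rw [← Finset.sum_mul]
  have : (∑ i, if ℓ i = l then (1:ℝ) else 0) = kk ℓ l := by simp [kk]
  rw [this]
  unfold one1
  split_ifs with h <;> simp [h]

lemma Ex_one1 (μ : L → ℝ) (hs : ∑ l, μ l = 1) (l : L) :
    Ex μ (fun ℓ : Fin n → L => one1 ℓ l) = n * (μ l * (1 - μ l)^(n-1)) := by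
  have : ∀ ℓ : Fin n → L, one1 ℓ l = ∑ i, (fun x => if x = l then (1:ℝ) else 0) (ℓ i) *
      (∏ m ∈ Finset.univ.erase i, (fun x => if x = l then (0:ℝ) else 1) (ℓ m)) := by
    intro ℓ
    have := one1_mul ℓ l 1
    simpa using this
  simp only [this]
  rw [Ex_sum]
  refine (Finset.sum_congr rfl fun i _ => Ex_one μ (fun x => if x = l then (1:ℝ) else 0)
    (fun x => if x = l then (0:ℝ) else 1) i).trans ?_
  simp only [Finset.sum_const, Finset.card_univ, Fintype.card_fin, nsmul_eq_mul]
  have h1 : ∑ x, μ x * (if x = l then (1:ℝ) else 0) = μ l := by simp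
  have h2 : ∑ x, μ x * (if x = l then (0:ℝ) else 1) = 1 - μ l := by
    have : (1:ℝ) - μ l = ∑ x, μ x - (∑ x, μ x * (if x = l then (1:ℝ) else 0)) := by rw [h1, hs]
    rw [this, ← Finset.sum_sub_distrib]
    exact Finset.sum_congr rfl fun x _ => by split_ifs <;> ring
  rw [h1, h2]

lemma kk_pow (ℓ : Fin n → L) (l : L) (c : ℝ) : c^(kk ℓ l) = ∏ m, if ℓ m = l then c else 1 := by
  rw [Finset.prod_ite]; simp [kk]

/-- singleton with an extra weight `c^{k_a}` -/
lemma Ex_one1_pow (μ : L → ℝ) (hs : ∑ l, μ l = 1) {l a : L} (hla : a ≠ l) (c : ℝ) :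
    Ex μ (fun ℓ : Fin n → L => one1 ℓ l * c^(kk ℓ a)) =
      n * (μ l * (1 - μ l - (1 - c) * μ a)^(n-1)) := by
  have : ∀ ℓ : Fin n → L, one1 ℓ l * c^(kk ℓ a) = ∑ i, (fun x => if x = l then (1:ℝ) else 0) (ℓ i) *
      (∏ m ∈ Finset.univ.erase i, (fun x => if x = l then (0:ℝ) else if x = a then c else 1) (ℓ m)) := by
    intro ℓ
    rw [one1_mul]
    refine Finset.sum_congr rfl fun i _ => ?_
    by_cases h : ℓ i = l
    · simp only [h, if_true]
      rw [kk_pow, ← Finset.mul_prod_erase _ _ (Finset.mem_univ i), h, if_neg hla.symm, one_mul, one_mul,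
        one_mul, ← Finset.prod_mul_distrib]
      refine Finset.prod_congr rfl fun m _ => ?_
      split_ifs <;> simp
    · simp [h]
  simp only [this]
  rw [Ex_sum]
  refine (Finset.sum_congr rfl fun i _ => Ex_one μ (fun x => if x = l then (1:ℝ) else 0)
    (fun x => if x = l then (0:ℝ) else if x = a then c else 1) i).trans ?_
  simp only [Finset.sum_const, Finset.card_univ, Fintype.card_fin, nsmul_eq_mul]
  have h1 : ∑ x, μ x * (if x = l then (1:ℝ) else 0) = μ l := by simp
  have h1' : ∑ x, μ x * (if x = a then (1:ℝ) else 0) = μ a := by simp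
  have h2 : ∑ x, μ x * (if x = l then (0:ℝ) else if x = a then c else 1) = 1 - μ l - (1 - c) * μ a := by
    have : (1:ℝ) - μ l - (1 - c) * μ a = ∑ x, μ x - (∑ x, μ x * (if x = l then (1:ℝ) else 0)) -
      (1 - c) * ∑ x, μ x * (if x = a then (1:ℝ) else 0) := by rw [h1, h1', hs]
    rw [this, Finset.mul_sum, ← Finset.sum_sub_distrib, ← Finset.sum_sub_distrib]
    refine Finset.sum_congr rfl fun x _ => ?_
    by_cases h : x = l
    · subst h; simp [hla.symm]
    · simp only [h, if_false]; split_ifs <;> ring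
  rw [h1, h2]

lemma Ex_one1_one1 (μ : L → ℝ) (hs : ∑ l, μ l = 1) {l a : L} (hla : a ≠ l) :
    Ex μ (fun ℓ : Fin n → L => one1 ℓ l * one1 ℓ a) =
      n * (n - 1) * (μ l * (μ a * (1 - μ l - μ a)^(n-2))) := by
  have : ∀ ℓ : Fin n → L, one1 ℓ l * one1 ℓ a = ∑ i, ∑ j ∈ Finset.univ.erase i,
      (fun x => if x = l then (1:ℝ) else 0) (ℓ i) * ((fun x => if x = a then (1:ℝ) else 0) (ℓ j) *
      (∏ m ∈ (Finset.univ.erase i).erase j, (fun x => if x = l then (0:ℝ) else if x = a then 0 else 1) (ℓ m))) := by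
    intro ℓ
    rw [one1_mul]
    refine Finset.sum_congr rfl fun i _ => ?_
    by_cases h : ℓ i = l
    · have e := one1_mul ℓ a 1
      rw [mul_one] at e
      rw [e, Finset.mul_sum, Finset.mul_sum, ← Finset.add_sum_erase _ _ (Finset.mem_univ i)]
      simp only [h, if_neg hla.symm, zero_mul, mul_zero, zero_add, if_true, one_mul, mul_one]
      refine Finset.sum_congr rfl fun j hj => ?_
      by_cases h' : ℓ j = a
      · simp only [h', if_true, one_mul]
        rw [← Finset.mul_prod_erase _ _ hj, h', if_neg hla, one_mul]
        have hi : i ∈ Finset.univ.erase j := Finset.mem_erase.2 ⟨(Finset.ne_of_mem_erase hj).symm, Finset.mem_univ _⟩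
        rw [← Finset.mul_prod_erase _ (fun m => if ℓ m = a then (0:ℝ) else 1) hi, h, if_neg hla.symm, one_mul,
          Finset.erase_right_comm, ← Finset.prod_mul_distrib]
        refine Finset.prod_congr rfl fun m _ => ?_
        split_ifs <;> simp
      · simp [h']
    · simp [h]
  simp only [this]
  rw [Ex_sum]
  simp only [Ex_sum]
  have h1 : ∀ l, ∑ x, μ x * (if x = l then (1:ℝ) else 0) = μ l := by simp
  have h2 : ∑ x, μ x * (if x = l then (0:ℝ) else if x = a then 0 else 1) = 1 - μ l - μ a := by
    have : (1:ℝ) - μ l - μ a = ∑ x, μ x - (∑ x, μ x * (if x = l then (1:ℝ) else 0)) -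
      ∑ x, μ x * (if x = a then (1:ℝ) else 0) := by rw [h1, h1, hs]
    rw [this, ← Finset.sum_sub_distrib, ← Finset.sum_sub_distrib]
    refine Finset.sum_congr rfl fun x _ => ?_
    by_cases h : x = l
    · subst h; simp [hla.symm]
    · simp only [h, if_false]; split_ifs <;> ring
  rw [← sum_pairs]
  refine Finset.sum_congr rfl fun i _ => Finset.sum_congr rfl fun j hj => ?_
  refine (Ex_pair μ (fun x => if x = l then (1:ℝ) else 0) (fun x => if x = a then (1:ℝ) else 0)
    (fun x => if x = l then (0:ℝ) else if x = a then 0 else 1) (Finset.ne_of_mem_erase hj)).trans ?_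
  rw [h1, h1, h2]

/-- the column terms of the second moment bound -/
lemma Ex_col (μ : L → ℝ) (hs : ∑ l, μ l = 1) (Al : L → Bool) (b : L) (hb : Al b = false) (c : ℝ) :
    Ex μ (fun ℓ : Fin n → L => ((Finset.univ.filter fun i => Al (ℓ i) = true).card : ℝ) *
      ((kk ℓ b : ℝ) * c^(kk ℓ b))) =
      n * (n - 1) * ((∑ l, if Al l then μ l else 0) * (μ b * c * (1 - μ b + μ b * c)^(n-2))) := by
  have : ∀ ℓ : Fin n → L, ((Finset.univ.filter fun i => Al (ℓ i) = true).card : ℝ) *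
      ((kk ℓ b : ℝ) * c^(kk ℓ b)) = ∑ i, ∑ j ∈ Finset.univ.erase i,
      (fun x => if Al x = true then (1:ℝ) else 0) (ℓ i) * ((fun x => if x = b then c else 0) (ℓ j) *
      (∏ m ∈ (Finset.univ.erase i).erase j, (fun x => if x = b then c else 1) (ℓ m))) := by
    intro ℓ
    have e1 : ((Finset.univ.filter fun i => Al (ℓ i) = true).card : ℝ) = ∑ i, if Al (ℓ i) = true then (1:ℝ) else 0 := by simp
    have e2 : (kk ℓ b : ℝ) = ∑ j, if ℓ j = b then (1:ℝ) else 0 := by simp [kk]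
    rw [e1, Finset.sum_mul]
    refine Finset.sum_congr rfl fun i _ => ?_
    by_cases h : Al (ℓ i) = true
    · have hib : ℓ i ≠ b := by rintro h'; rw [h', hb] at h; cases h
      simp only [h, if_true, one_mul]
      rw [e2, Finset.sum_mul, ← Finset.add_sum_erase _ _ (Finset.mem_univ i), if_neg hib, zero_mul, zero_add]
      refine Finset.sum_congr rfl fun j hj => ?_
      by_cases h' : ℓ j = b
      · simp only [h', if_true, one_mul]
        rw [kk_pow, ← Finset.mul_prod_erase _ _ (Finset.mem_univ i), if_neg hib, one_mul,
          ← Finset.mul_prod_erase _ _ hj, if_pos h']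
      · simp [h']
    · simp [h]
  simp only [this]
  rw [Ex_sum]
  simp only [Ex_sum]
  have h1 : ∑ x, μ x * (if Al x = true then (1:ℝ) else 0) = ∑ l, if Al l then μ l else 0 := by simp
  have h2 : ∑ x, μ x * (if x = b then c else 0) = μ b * c := by simp
  have h0 : ∑ x, μ x * (if x = b then (1:ℝ) else 0) = μ b := by simp
  have h3 : ∑ x, μ x * (if x = b then c else 1) = 1 - μ b + μ b * c := by
    have : 1 - μ b + μ b * c = ∑ x, μ x - (∑ x, μ x * (if x = b then (1:ℝ) else 0)) +
      (∑ x, μ x * (if x = b then (1:ℝ) else 0)) * c := by rw [h0, hs]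
    rw [this, Finset.sum_mul, ← Finset.sum_sub_distrib, ← Finset.sum_add_distrib]
    refine Finset.sum_congr rfl fun x _ => ?_
    split_ifs <;> ring
  rw [← sum_pairs]
  refine Finset.sum_congr rfl fun i _ => Finset.sum_congr rfl fun j hj => ?_
  refine (Ex_pair μ (fun x => if Al x = true then (1:ℝ) else 0) (fun x => if x = b then c else 0)
    (fun x => if x = b then c else 1) (Finset.ne_of_mem_erase hj)).trans ?_
  rw [h1, h2, h3]

lemma kk_two (ℓ : Fin n → Fin 2) : kk ℓ 0 + kk ℓ 1 = n := by
  unfold kk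
  have := Finset.card_filter_add_card_filter_not (s := (Finset.univ : Finset (Fin n))) (fun i => ℓ i = 0)
  rw [Finset.card_univ, Fintype.card_fin] at this
  have e : (Finset.univ.filter fun i => ℓ i = 1) = Finset.univ.filter fun i => ¬ ℓ i = 0 := by
    ext i; simp only [Finset.mem_filter, Finset.mem_univ, true_and]; omega
  rw [e]; exact this

lemma Ex_two (μ : Fin 2 → ℝ) (F : ℕ → ℝ) :
    Ex μ (fun ℓ : Fin n → Fin 2 => F (kk ℓ 1)) =
      ∑ k ∈ Finset.range (n+1), (n.choose k : ℝ) * (μ 1)^k * (μ 0)^(n-k) * F k := by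
  have hc := Finset.sum_powerset_apply_card (fun k => (μ 1)^k * (μ 0)^(n-k) * F k) (x := (Finset.univ : Finset (Fin n)))
  rw [Finset.card_univ, Fintype.card_fin] at hc
  have hr : ∑ k ∈ Finset.range (n+1), (n.choose k : ℝ) * (μ 1)^k * (μ 0)^(n-k) * F k =
      ∑ m ∈ Finset.range (n + 1), n.choose m • ((μ 1)^m * (μ 0)^(n-m) * F m) :=
    Finset.sum_congr rfl fun k _ => by rw [nsmul_eq_mul]; ring
  rw [hr, ← hc]
  unfold Ex
  refine Finset.sum_bij' (fun ℓ _ => Finset.univ.filter fun i => ℓ i = 1)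
    (fun S _ => fun i => if i ∈ S then 1 else 0) ?_ ?_ ?_ ?_ ?_
  · intro ℓ _; simp
  · intro S _; simp
  · intro ℓ _; funext i; simp; split_ifs with h
    · exact h.symm
    · omega
  · intro S _; ext i; simp
  · intro ℓ _
    have h0 : ∏ i, μ (ℓ i) = (μ 1)^(kk ℓ 1) * (μ 0)^(kk ℓ 0) := by
      rw [kk_pow, kk_pow, ← Finset.prod_mul_distrib]
      refine Finset.prod_congr rfl fun i _ => ?_
      rcases Fin.exists_fin_two.1 ⟨ℓ i, rfl⟩ with h | h <;> simp [h]
    have h1 : n - kk ℓ 1 = kk ℓ 0 := by have := kk_two ℓ; omega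
    rw [h0]
    change _ = (μ 1)^(kk ℓ 1) * (μ 0)^(n - kk ℓ 1) * F (kk ℓ 1)
    rw [h1]

end expect

lemma eta_le {w : ℝ} (h0 : 1/2 ≤ w) (h1 : w ≤ 1) : eta w ≤ 1 - w ∧ eta w ≤ 1 - 3/2*w + max 0 (1 - 3/2*w) := by
  unfold eta
  constructor
  · rcases max_cases (w/2) (1-w) with ⟨h, _⟩ | ⟨h, _⟩ <;> rw [h] <;> linarith
  · rcases max_cases (w/2) (1-w) with ⟨h, _⟩ | ⟨h, _⟩ <;>
      rcases max_cases 0 (1-3/2*w) with ⟨h', _⟩ | ⟨h', _⟩ <;> rw [h, h'] <;> linarith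

lemma Sfac_mem {w p : ℝ} (h0 : 1/2 ≤ w) (h1 : w ≤ 1) (hp0 : 0 ≤ p) (hp1 : p ≤ 1) (m : ℕ) :
    0 ≤ Sfac w p m ∧ Sfac w p m ≤ 1 := by
  unfold Sfac
  split_ifs with h
  · norm_num
  have x0 : 0 ≤ (1-p)^m := pow_nonneg (by linarith) m
  have x1 : (1-p)^m ≤ (1-p/2)^m := pow_le_pow_left₀ (by linarith) (by linarith) m
  have x2 : (1-p/2)^m ≤ 1 := pow_le_one₀ (by linarith) (by linarith)
  have e := (eta_le h0 h1).1
  have e2 : 1 - 2*(1-w) + eta w ≥ 0 := by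
    unfold eta; have := le_max_left (w/2) (1-w); linarith
  constructor
  · rcases le_total 0 (eta w) with h | h
    · have := mul_nonneg h x0; nlinarith
    · nlinarith
  · have : eta w * (1-p)^m ≤ (1-w) * (1-p)^m := mul_le_mul_of_nonneg_right e x0
    nlinarith

end GLB

end

section
open MeasureTheory
namespace GLB

/-! ### Concrete designs -/

/-- label `0` has mass `1 - m b`, the columns `1..m` have mass `b`; column `j` covers `i < j`. -/
noncomputable def tour (m : ℕ) (b w : ℝ) (D : Bool) : Design (Fin (m+1)) where
  μ := fun l => if l = 0 then 1 - m * b else b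
  D := fun l => D && decide (l ≠ 0)
  A := fun j i => decide (i < j)
  w := w
  l0 := 0
  l1 := 0

lemma tour_sum (m : ℕ) (b w : ℝ) (D : Bool) : ∑ l, (tour m b w D).μ l = 1 := by
  rw [Fin.sum_univ_succ]; simp [tour]

lemma tour_muA (m : ℕ) (b w : ℝ) (D : Bool) (j : Fin m) :
    (tour m b w D).μA j.succ = 1 - m * b + j * b := by
  unfold Design.μA
  rw [Fin.sum_univ_succ]
  simp [tour, Fin.succ_lt_succ_iff]
  rw [Finset.sum_ite]
  have : (Finset.univ.filter fun x => x < j) = Finset.Iio j := by ext x; simp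
  rw [this]; simp [Fin.card_Iio]

lemma tour_ok {m : ℕ} {b w lam : ℝ} {D : Bool} (hb : 0 < b) (ha : 0 < 1 - m * b) (h0 : 1/2 ≤ w)
    (h1 : w ≤ 1) (hl : lam^2 ≤ w * (1 - m * b) * b) (hl0 : 0 ≤ lam) (hla : lam ≤ 1 - m * b)
    (hD : D = true → lam ≤ b) : (tour m b w D).Ok lam where
  pos := by intro l; simp only [tour]; split_ifs <;> assumption
  sum := tour_sum _ _ _ _
  hD := by
    intro l h
    simp only [tour, Bool.and_eq_true, decide_eq_true_eq] at h ⊢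
    rw [if_neg h.2]; exact hD h.1
  hA := by
    intro j i h
    have hj : j ≠ 0 := by
      rintro rfl; simp [tour] at h
    obtain ⟨j, rfl⟩ := Fin.exists_succ_eq.2 hj
    rw [tour_muA]
    have e : (tour m b w D).μ j.succ = b := by simp [tour]
    rw [e]
    change lam^2 ≤ w * (1 - m*b + j*b) * b
    have : 0 ≤ w * ((j:ℝ) * b) * b := by positivity
    nlinarith
  irr := by intro b; simp [tour]
  asym := by intro b l h; simp only [tour, decide_eq_true_eq, decide_eq_false_iff_not] at h ⊢; exact not_lt.2 h.le
  h0 := by simp [tour]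
  h1 := by simp [tour]
  hd := by intro _; simp [tour]
  hlam := by simp only [tour, if_true]; nlinarith
  w0 := h0
  w1 := h1

/-- `K` labels of mass `1/K`, all diagonal blocks -/
noncomputable def rs (K : ℕ) : Design (Fin (K+2)) where
  μ := fun _ => 1/((K:ℝ)+2)
  D := fun _ => true
  A := fun _ _ => false
  w := 1/2
  l0 := 0
  l1 := 1

lemma rs_ok {K : ℕ} {lam : ℝ} (hl : 0 ≤ lam) (h : lam ≤ 1/((K:ℝ)+2)) : (rs K).Ok lam where
  pos := by intro l; simp only [rs]; positivity
  sum := by simp only [rs, Finset.sum_const, Finset.card_univ, Fintype.card_fin, nsmul_eq_mul]; push_cast; field_simp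
  hD := by intro l _; exact h
  hA := by intro b l h; cases h
  irr := by intro b; rfl
  asym := by intro b l h; cases h
  h0 := rfl
  h1 := rfl
  hd := by intro h; exact absurd h (by simp [rs])
  hlam := by simp only [rs]; nlinarith
  w0 := le_refl _
  w1 := by simp only [rs]; norm_num

variable {n : ℕ} {p lam : ℝ}

lemma rs_val (K : ℕ) (p : ℝ) (ℓ : Fin n → Fin (K+2)) :
  (1 - (∏ l, if (rs K).D l = true then Sfac (1/2) p (kk ℓ l ^ 2) else 1) *
        ∏ b, Sfac (rs K).w p (2 * kk ℓ b) ^ ((rs K).kA ℓ b)) =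
   1 - ∏ l, Sfac (1/2) p (kk ℓ l ^ 2) := by
  have : ∀ b, (rs K).kA ℓ b = 0 := by intro b; simp [Design.kA, rs]
  simp [this]; simp [rs]

theorem RS2 (hp : p ∈ Set.Ioc (0:ℝ) 1) (hl : 0 < lam) (hl2 : lam ≤ 1/2)
    (Yhat : (Fin n → Fin n → Bool × ℝ) → Fin n → Fin n → ℝ) (r : ℝ)
    (hr : r ≤ ∑ k ∈ Finset.range (n+1), (n.choose k : ℝ) * (1/2)^n *
      (1 - Sfac (1/2) p ((n-k)^2) * Sfac (1/2) p (k^2))) : Goal01 n p lam Yhat r := by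
  refine G01 hp hl (rs_ok (K := 0) hl.le (by norm_num; linarith)) Yhat r (hr.trans (le_of_eq ?_))
  have e : ∀ ℓ : Fin n → Fin 2, (1 - ∏ l, Sfac (1/2) p (kk ℓ l ^ 2)) =
      (fun k => 1 - Sfac (1/2) p ((n-k)^2) * Sfac (1/2) p (k^2)) (kk ℓ 1) := by
    intro ℓ
    have : n - kk ℓ 1 = kk ℓ 0 := by have := kk_two ℓ; omega
    simp [Fin.prod_univ_two, this]
  simp only [rs_val]
  change _ = Ex (rs 0).μ (fun ℓ : Fin n → Fin 2 => (1 - ∏ l, Sfac (1/2) p (kk ℓ l ^ 2)))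
  rw [funext e]
  refine Eq.trans ?_ (Ex_two (rs 0).μ (fun k => 1 - Sfac (1/2) p ((n-k)^2) * Sfac (1/2) p (k^2))).symm
  refine Finset.sum_congr rfl fun k hk => ?_
  congr 1
  have : k + (n - k) = n := by have := Finset.mem_range.1 hk; omega
  simp only [rs]
  rw [mul_assoc, ← pow_add, this]; norm_num

theorem AB01 (hp : p ∈ Set.Ioc (0:ℝ) 1) (hl : 0 < lam) {b w : ℝ} (hb : 0 < b) (hb2 : b ≤ 1/2)
    (h0 : 1/2 ≤ w) (h1 : w ≤ 1) (hl2 : lam^2 ≤ w * (1-b) * b) (hl3 : lam ≤ 1/2)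
    (Yhat : (Fin n → Fin n → Bool × ℝ) → Fin n → Fin n → ℝ) (r : ℝ)
    (hr : r ≤ ∑ k ∈ Finset.range (n+1), (n.choose k : ℝ) * b^k * (1-b)^(n-k) *
      (1 - Sfac w p (2*k)^(n-k))) : Goal01 n p lam Yhat r := by
  refine G01 hp hl (tour_ok (m := 1) (b := b) (w := w) (lam := lam) (D := false) hb (by norm_num; linarith) h0 h1
    (by norm_num; linarith) hl.le (by norm_num; linarith) (by simp)) Yhat r (hr.trans (le_of_eq ?_))
  have e : ∀ ℓ : Fin n → Fin 2, (1 - (∏ l, if (tour 1 b w false).D l = true then Sfac (1/2) p (kk ℓ l ^ 2) else 1) *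
        ∏ j, Sfac (tour 1 b w false).w p (2 * kk ℓ j) ^ ((tour 1 b w false).kA ℓ j)) =
      (fun k => 1 - Sfac w p (2*k)^(n-k)) (kk ℓ 1) := by
    intro ℓ
    have h : n - kk ℓ 1 = kk ℓ 0 := by have := kk_two ℓ; omega
    have a0 : (tour 1 b w false).kA ℓ 0 = 0 := by simp [Design.kA, tour]
    have a1 : (tour 1 b w false).kA ℓ 1 = kk ℓ 0 := by
      simp only [Design.kA, tour, kk]; congr 1; ext i
      simp only [Finset.mem_filter, Finset.mem_univ, true_and, decide_eq_true_eq]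
      change (ℓ i < (1 : Fin 2)) ↔ (ℓ i = (0 : Fin 2))
      omega
    simp only [Fin.prod_univ_two, h, a0, a1]
    simp [tour]
  change _ = Ex (tour 1 b w false).μ (fun ℓ : Fin n → Fin 2 => _)
  rw [funext e]
  refine Eq.trans ?_ (Ex_two (tour 1 b w false).μ (fun k => 1 - Sfac w p (2*k)^(n-k))).symm
  refine Finset.sum_congr rfl fun k hk => ?_
  simp [tour]

lemma Sfac_one (p : ℝ) : Sfac (1/2) p 1 = 1/2 := by
  unfold Sfac eta; norm_num; ring
lemma Sfac_two (p : ℝ) : Sfac (1/2) p 2 = 1/2 + p^2/4 := by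
  unfold Sfac eta; norm_num; ring

lemma u_bound (U : ℕ) : (11/24:ℝ) * U - (1/12) * (U * (U - 1)) ≤ 1 - (1/2)^U := by
  rcases Nat.lt_or_ge U 7 with h | h
  · interval_cases U <;> norm_num
  · have h7 : (7:ℝ) ≤ U := by exact_mod_cast h
    have : ((1:ℝ)/2)^U ≤ 1 := pow_le_one₀ (by norm_num) (by norm_num)
    nlinarith

lemma sum_one1 {L : Type} [Fintype L] [DecidableEq L] (s : Finset L) (ℓ : Fin n → L) :
    ∑ l ∈ s, one1 ℓ l = ((s.filter fun l => kk ℓ l = 1).card : ℝ) := by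
  simp [one1]

lemma sum_sq {L : Type} [Fintype L] [DecidableEq L] (s : Finset L) (ℓ : Fin n → L) :
    (∑ l ∈ s, one1 ℓ l) * ((∑ l ∈ s, one1 ℓ l) - 1) = ∑ l ∈ s, ∑ a ∈ s.erase l, one1 ℓ l * one1 ℓ a := by
  have : ∀ l ∈ s, ∑ a ∈ s.erase l, one1 ℓ l * one1 ℓ a = one1 ℓ l * ((∑ a ∈ s, one1 ℓ a) - 1) := by
    intro l hl
    rw [← Finset.mul_sum, ← Finset.add_sum_erase _ _ hl]
    unfold one1
    split_ifs <;> ring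
  rw [Finset.sum_congr rfl this, Finset.sum_mul]

theorem RSK (hp : p ∈ Set.Ioc (0:ℝ) 1) (hl : 0 < lam) (K : ℕ) (hl2 : lam ≤ 1/((K:ℝ)+2))
    (Yhat : (Fin n → Fin n → Bool × ℝ) → Fin n → Fin n → ℝ) (r : ℝ)
    (hr : r ≤ (11/24:ℝ) * (n * (1 - 1/((K:ℝ)+2))^(n-1)) -
      (1/12) * (n * (n-1) * ((1 - 1/((K:ℝ)+2)) * (1 - 2/((K:ℝ)+2))^(n-2)))) : Goal01 n p lam Yhat r := by
  have hok := rs_ok (K := K) hl.le hl2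
  refine G01 hp hl hok Yhat r (hr.trans ?_)
  simp only [rs_val]
  have hK : ((K:ℝ)+2) ≠ 0 := by positivity
  have key : Ex (rs K).μ (fun ℓ : Fin n → Fin (K+2) => (11/24:ℝ) * (∑ l, one1 ℓ l) -
      (1/12) * ∑ l, ∑ a ∈ Finset.univ.erase l, one1 ℓ l * one1 ℓ a) ≤
      Ex (rs K).μ (fun ℓ : Fin n → Fin (K+2) => 1 - ∏ l, Sfac (1/2) p (kk ℓ l ^ 2)) := by
    refine Ex_mono (fun l => (hok.pos l).le) fun ℓ => ?_
    rw [← sum_sq, sum_one1]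
    refine (u_bound _).trans ?_
    have : ∏ l, Sfac (1/2) p (kk ℓ l ^ 2) ≤ ∏ l, (if kk ℓ l = 1 then (1/2:ℝ) else 1) := by
      refine Finset.prod_le_prod (fun l _ => (Sfac_mem (le_refl _) (by norm_num) hp.1.le hp.2 _).1) fun l _ => ?_
      split_ifs with h
      · rw [h, one_pow, Sfac_one]
      · exact (Sfac_mem (le_refl _) (by norm_num) hp.1.le hp.2 _).2
    rw [Finset.prod_ite] at this
    simp at this
    simp; linarith
  refine le_trans (le_of_eq ?_) key
  rw [Ex_sub, Ex_smul, Ex_smul, Ex_sum, Ex_sum]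
  simp only [Ex_sum, Ex_one1 _ hok.sum]
  have e2 : ∀ l : Fin (K+2), ∑ a ∈ Finset.univ.erase l, Ex (rs K).μ (fun ℓ : Fin n → Fin (K+2) => one1 ℓ l * one1 ℓ a) =
      (K+1) * (n * (n-1) * (1/((K:ℝ)+2) * (1/((K:ℝ)+2) * (1 - 2/((K:ℝ)+2))^(n-2)))) := by
    intro l
    rw [Finset.sum_congr rfl fun a ha => Ex_one1_one1 _ hok.sum (Finset.ne_of_mem_erase ha)]
    have : (1 - 1/((K:ℝ)+2) - 1/((K:ℝ)+2)) = 1 - 2/((K:ℝ)+2) := by ring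
    simp only [rs, Finset.sum_const, Finset.card_erase_of_mem (Finset.mem_univ _), Finset.card_univ,
      Fintype.card_fin, nsmul_eq_mul, this]
    push_cast
    norm_num
  simp only [e2]
  simp only [rs, Finset.sum_const, Finset.card_univ, Fintype.card_fin, nsmul_eq_mul]
  push_cast
  have h1 : (1:ℝ) - 1/((K:ℝ)+2) = (K+1)/(K+2) := by field_simp; ring
  rw [h1]
  field_simp

/-- three columns, singletons only -/
theorem P01 (hp : p ∈ Set.Ioc (0:ℝ) 1) (hl : 0 < lam) {b : ℝ} (hb : 0 < b) (ha : 0 < 1 - 3*b)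
    (hl2 : lam^2 ≤ 1/2 * (1-3*b) * b) (hl3 : lam ≤ 1-3*b)
    (Yhat : (Fin n → Fin n → Bool × ℝ) → Fin n → Fin n → ℝ) (r : ℝ)
    (hr : r ≤ 3 * (n * (b * (1-b)^(n-1))) - 3 * (n * (n-1) * (b * (b * (1 - 2*b)^(n-2)))) -
      3 * (n * (b * (1 - b - (1-3*b)/4)^(n-1)))) : Goal01 n p lam Yhat r := by
  have hok := tour_ok (m := 3) (b := b) (w := 1/2) (lam := lam) (D := false) hb (by norm_num; linarith) (le_refl _)
    (by norm_num) (by norm_num; linarith) hl.le (by norm_num; linarith) (by simp)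
  refine G01 hp hl hok Yhat r (hr.trans ?_)
  set s : Finset (Fin 4) := Finset.univ.erase 0 with hs
  have key : Ex (tour 3 b (1/2) false).μ (fun ℓ : Fin n → Fin 4 => (∑ l ∈ s, one1 ℓ l) -
      (1/2) * (∑ l ∈ s, ∑ a ∈ s.erase l, one1 ℓ l * one1 ℓ a) - ∑ l ∈ s, one1 ℓ l * (3/4)^(kk ℓ 0)) ≤
      Ex (tour 3 b (1/2) false).μ (fun ℓ : Fin n → Fin 4 => (1 - (∏ l, if (tour 3 b (1/2) false).D l = true then Sfac (1/2) p (kk ℓ l ^ 2) else 1) *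
        ∏ j, Sfac (tour 3 b (1/2) false).w p (2 * kk ℓ j) ^ ((tour 3 b (1/2) false).kA ℓ j))) := by
    refine Ex_mono (fun l => (hok.pos l).le) fun ℓ => ?_
    rw [← sum_sq, ← Finset.sum_mul, sum_one1]
    have hD : ∀ l, (tour 3 b (1/2) false).D l = false := by intro l; simp [tour]
    simp only [hD, Bool.false_eq_true, if_false, Finset.prod_const_one, one_mul]
    have hw : (tour 3 b (1/2) false).w = 1/2 := rfl
    rw [hw]
    have hS := fun m => Sfac_mem (w := 1/2) (p := p) (le_refl _) (by norm_num) hp.1.le hp.2 m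
    have hq0 : (0:ℝ) ≤ (3/4)^(kk ℓ 0) := by positivity
    have hq1 : ((3:ℝ)/4)^(kk ℓ 0) ≤ 1 := pow_le_one₀ (by norm_num) (by norm_num)
    have hprod1 : ∏ j, Sfac (1/2) p (2 * kk ℓ j) ^ ((tour 3 b (1/2) false).kA ℓ j) ≤ 1 :=
      Finset.prod_le_one (fun j _ => pow_nonneg (hS _).1 _) fun j _ => pow_le_one₀ (hS _).1 (hS _).2
    rcases Nat.eq_zero_or_pos (s.filter fun l => kk ℓ l = 1).card with h | h
    · rw [h]; norm_num; linarith
    · obtain ⟨j, hj⟩ := Finset.card_pos.1 h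
      obtain ⟨hj1, hj2⟩ := Finset.mem_filter.1 hj
      have hj0 : j ≠ 0 := Finset.ne_of_mem_erase hj1
      have hp' : ∏ j, Sfac (1/2) p (2 * kk ℓ j) ^ ((tour 3 b (1/2) false).kA ℓ j) ≤ (3/4)^(kk ℓ 0) := by
        rw [← Finset.mul_prod_erase _ _ (Finset.mem_univ j)]
        have r1 : ∏ j ∈ Finset.univ.erase j, Sfac (1/2) p (2 * kk ℓ j) ^ ((tour 3 b (1/2) false).kA ℓ j) ≤ 1 :=
          Finset.prod_le_one (fun j _ => pow_nonneg (hS _).1 _) fun j _ => pow_le_one₀ (hS _).1 (hS _).2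
        have r0 := pow_nonneg (hS (2 * kk ℓ j)).1 ((tour 3 b (1/2) false).kA ℓ j)
        refine (mul_le_of_le_one_right r0 r1).trans ?_
        have hle : kk ℓ 0 ≤ (tour 3 b (1/2) false).kA ℓ j := by
          refine Finset.card_le_card fun i hi => ?_
          simp only [Finset.mem_filter, Finset.mem_univ, true_and] at hi ⊢
          simp [tour, hi, Fin.pos_iff_ne_zero, hj0]
        refine (pow_le_pow_of_le_one (hS _).1 (hS _).2 hle).trans (pow_le_pow_left₀ (hS _).1 ?_ _)
        rw [hj2, mul_one, Sfac_two]
        nlinarith [hp.1, hp.2]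
      have hle3 : (s.filter fun l => kk ℓ l = 1).card ≤ 3 := (Finset.card_filter_le _ _).trans (by simp [hs])
      set N := (s.filter fun l => kk ℓ l = 1).card
      have : ((N:ℝ) - (1/2) * (N * (N - 1)) - N * (3/4)^(kk ℓ 0)) ≤ 1 - (3/4)^(kk ℓ 0) := by
        have h1 : 1 ≤ N := h
        clear_value N
        interval_cases N <;> norm_num <;> linarith
      linarith
  refine le_trans (le_of_eq ?_) key
  rw [Ex_sub, Ex_sub, Ex_smul, Ex_sum, Ex_sum, Ex_sum]
  simp only [Ex_sum, Ex_one1 _ hok.sum]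
  have hμ : ∀ l ∈ s, (tour 3 b (1/2) false).μ l = b := by
    intro l hl; simp [tour, Finset.ne_of_mem_erase hl]
  have h0 : (tour 3 b (1/2) false).μ 0 = 1 - 3*b := by simp [tour]
  have hc : s.card = 3 := by simp [hs]
  rw [Finset.sum_congr rfl (fun l hl => by rw [hμ l hl] : ∀ l ∈ s, _ = n * (b * (1-b)^(n-1)))]
  have q2 : ∀ l ∈ s, ∑ a ∈ s.erase l, Ex (tour 3 b (1/2) false).μ (fun ℓ : Fin n → Fin 4 => one1 ℓ l * one1 ℓ a) =
      2 * (n * (n-1) * (b * (b * (1 - 2*b)^(n-2)))) := by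
    intro l hl
    rw [Finset.sum_congr rfl (g := fun _ => n * (n-1) * (b * (b * (1 - 2*b)^(n-2))))]
    · rw [Finset.sum_const, Finset.card_erase_of_mem hl, hc]; simp
    · intro a ha
      rw [Ex_one1_one1 _ hok.sum (Finset.ne_of_mem_erase ha), hμ l hl, hμ a (Finset.mem_of_mem_erase ha)]
      ring
  have q3 : ∀ l ∈ s, Ex (tour 3 b (1/2) false).μ (fun ℓ : Fin n → Fin 4 => one1 ℓ l * (3/4)^(kk ℓ 0)) =
      (n * (b * (1 - b - (1-3*b)/4)^(n-1))) := by
    intro l hl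
    rw [Ex_one1_pow _ hok.sum (Finset.ne_of_mem_erase hl).symm, hμ l hl, h0]
    ring
  rw [Finset.sum_congr rfl q2, Finset.sum_congr rfl q3]
  simp only [Finset.sum_const, hc, nsmul_eq_mul]
  push_cast; ring

theorem T2 (hp : p ∈ Set.Ioc (0:ℝ) 1) (hl : 0 < lam) (hn : 1 ≤ n) (m : ℕ) {b w : ℝ} (D : Bool)
    (hb : 0 < b) (ha : 0 < 1 - m * b) (h0 : 1/2 ≤ w)
    (h1 : w ≤ 1) (hl2 : lam^2 ≤ w * (1 - m * b) * b) (hla : lam ≤ 1 - m * b)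
    (hD : D = true → lam ≤ b)
    (Yhat : (Fin n → Fin n → Bool × ℝ) → Fin n → Fin n → ℝ) (r : ℝ)
    (hr : (n:ℝ) * r ≤ (if D then m * (b * (1-b)^(n-1)) * (1/2 * (1-p/2)) else 0) +
      4 * w * (1-w) * (n-1) * (m * (1 - m*b) + m * (m-1) / 2 * b) * (b * (1-p/2)^2 * (1 - b + b * (1-p/2)^2)^(n-2))) :
    Goal2 n p lam Yhat r := by
  have hok := tour_ok (m := m) (b := b) (w := w) (lam := lam) (D := D) hb ha h0 h1 hl2 hl.le hla hD
  refine G2 hp hl hok hn Yhat r ?_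
  have hr' := mul_le_mul_of_nonneg_left hr (Nat.cast_nonneg (α := ℝ) n)
  refine (le_of_eq (by ring)).trans (hr'.trans ?_)
  have hx : 0 ≤ 1 - p/2 := by linarith [hp.2]
  change _ ≤ Ex (tour m b w D).μ (fun ℓ : Fin n → Fin (m+1) => _)
  rw [Ex_add, mul_add]
  refine add_le_add ?_ (le_of_eq ?_)
  · rw [Ex_sum, Fin.sum_univ_succ]
    have hD0 : (tour m b w D).D 0 = false := by simp [tour]
    have hDs : ∀ j : Fin m, (tour m b w D).D j.succ = D := by intro j; simp [tour]
    have hm : ∀ j : Fin m, (tour m b w D).μ j.succ = b := by intro j; simp [tour]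
    simp only [hD0, hDs, Bool.false_eq_true, if_false]
    have z : Ex (tour m b w D).μ (fun ℓ : Fin n → Fin (m+1) => (0:ℝ)) = 0 := by simp [Ex]
    rw [z, zero_add]
    cases D
    · simp [z]
    · simp only [if_true]
      have : ∀ j : Fin m, n * (b * (1-b)^(n-1)) * (1/2 * (1-p/2)) ≤
          Ex (tour m b w true).μ (fun ℓ : Fin n → Fin (m+1) => (kk ℓ j.succ : ℝ)^2 * (1/2 * (1 - p/2)^(kk ℓ j.succ ^ 2))) := by
        intro j
        have e := Ex_one1 (n := n) _ hok.sum j.succ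
        rw [hm] at e
        rw [← e, mul_comm, ← Ex_smul]
        refine Ex_mono (fun l => (hok.pos l).le) fun ℓ => ?_
        unfold one1
        split_ifs with h
        · rw [h]; norm_num
        · rw [mul_zero]; positivity
      refine le_trans (le_of_eq ?_) (Finset.sum_le_sum fun j _ => this j)
      simp; ring
  · rw [Ex_sum, Fin.sum_univ_succ]
    have k0 : ∀ ℓ : Fin n → Fin (m+1), (tour m b w D).kA ℓ 0 = 0 := by intro ℓ; simp [Design.kA, tour]
    have hw : (tour m b w D).w = w := rfl
    have hm : ∀ j : Fin m, (tour m b w D).μ j.succ = b := by intro j; simp [tour]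
    simp only [k0, hw]
    have z : Ex (tour m b w D).μ (fun ℓ : Fin n → Fin (m+1) => (((0:ℕ):ℝ) * (2 * kk ℓ 0) * (2 * w * (1 - w) * (1 - p/2)^(2 * kk ℓ 0)))) = 0 := by
      simp [Ex]
    rw [z, zero_add]
    have c : ∀ j : Fin m, Ex (tour m b w D).μ (fun ℓ : Fin n → Fin (m+1) => ((tour m b w D).kA ℓ j.succ : ℝ) * (2 * kk ℓ j.succ) * (2 * w * (1 - w) * (1 - p/2)^(2 * kk ℓ j.succ))) =
        4 * w * (1 - w) * (n * (n-1) * ((1 - m * b + j * b) * (b * (1-p/2)^2 * (1 - b + b * (1-p/2)^2)^(n-2)))) := by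
      intro j
      have e := Ex_col (n := n) _ hok.sum ((tour m b w D).A j.succ) j.succ (hok.irr _) ((1-p/2)^2)
      have e' : (∑ l, if (tour m b w D).A j.succ l = true then (tour m b w D).μ l else 0) = 1 - m * b + j * b := tour_muA _ _ _ _ _
      rw [hm, e'] at e
      rw [← e, ← Ex_smul]
      congr 1; funext ℓ
      unfold Design.kA
      rw [← pow_mul]; ring
    simp only [c]
    rw [← Finset.mul_sum, ← Finset.mul_sum, ← Finset.sum_mul, Finset.sum_add_distrib, ← Finset.sum_mul]
    have g : (∑ j : Fin m, ((j:ℕ):ℝ)) = m * (m-1) / 2 := by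
      rw [Fin.sum_univ_eq_sum_range (fun j => (j:ℝ)), ← Nat.cast_sum, Finset.sum_range_id]
      rcases m with _ | m
      · simp
      · rw [Nat.cast_div]
        · push_cast; simp
        · exact (Nat.even_mul_pred_self (m+1)).two_dvd
        · norm_num
    rw [g]
    simp only [Finset.sum_const, Finset.card_univ, Fintype.card_fin, nsmul_eq_mul]
    ring

end GLB

end

section
open MeasureTheory
namespace GLB

/-! ### Monotonicity in `p` and closed forms for the two-label design -/

lemma pow_diff {a b c d : ℝ} (hb : 0 ≤ b) (hab : b ≤ a) (hac : a ≤ c) (hbd : b ≤ d) (hd : d ≤ c)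
    (h : a - b ≤ 2 * (c - d)) (m : ℕ) : a^m - b^m ≤ 2 * (c^m - d^m) ∧ 0 ≤ a^m - b^m := by
  induction m with
  | zero => simp
  | succ m ih =>
    obtain ⟨i1, i2⟩ := ih
    have h1 : b^m ≤ d^m := pow_le_pow_left₀ hb hbd m
    have h2 : 0 ≤ b^m := pow_nonneg hb m
    have e1 : a^(m+1) - b^(m+1) = a * (a^m - b^m) + (a - b) * b^m := by ring
    have e2 : c^(m+1) - d^(m+1) = c * (c^m - d^m) + (c - d) * d^m := by ring
    rw [e1, e2]
    have a0 : 0 ≤ a := hb.trans hab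
    have p1 : a * (a^m - b^m) ≤ c * (2 * (c^m - d^m)) :=
      mul_le_mul hac i1 i2 (a0.trans hac)
    have p2 : (a - b) * b^m ≤ (2 * (c - d)) * d^m :=
      mul_le_mul h h1 h2 (by linarith)
    have p3 : 0 ≤ a * (a^m - b^m) := mul_nonneg a0 i2
    have p4 : 0 ≤ (a-b) * b^m := mul_nonneg (by linarith) h2
    constructor <;> nlinarith

lemma Sfac_mono {w p q : ℝ} (h0 : 1/2 ≤ w) (h1 : w ≤ 1) (hp : 0 ≤ p) (hpq : p ≤ q) (hq : q ≤ 1)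
    (m : ℕ) : Sfac w p m ≤ Sfac w q m := by
  unfold Sfac
  split_ifs with hm
  · exact le_refl _
  · have h := pow_diff (a := 1-p) (b := 1-q) (c := 1-p/2) (d := 1-q/2) (by linarith) (by linarith)
      (by linarith) (by linarith) (by linarith) (by linarith) m
    have he := (eta_le h0 h1).1
    have : eta w * ((1-p)^m - (1-q)^m) ≤ (1-w) * ((1-p)^m - (1-q)^m) :=
      mul_le_mul_of_nonneg_right he h.2
    have : (1-w) * ((1-p)^m - (1-q)^m) ≤ (1-w) * (2 * ((1-p/2)^m - (1-q/2)^m)) :=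
      mul_le_mul_of_nonneg_left h.1 (by linarith)
    linarith

noncomputable def ABr (n : ℕ) (b w p : ℝ) : ℝ :=
  ∑ k ∈ Finset.range (n+1), (n.choose k : ℝ) * b^k * (1-b)^(n-k) * (1 - Sfac w p (2*k)^(n-k))

lemma ABr_anti {n : ℕ} {b w p q : ℝ} (hb : 0 < b) (hb2 : b ≤ 1/2) (h0 : 1/2 ≤ w) (h1 : w ≤ 1)
    (hp : 0 ≤ p) (hpq : p ≤ q) (hq : q ≤ 1) : ABr n b w q ≤ ABr n b w p := by
  unfold ABr
  refine Finset.sum_le_sum fun k _ => mul_le_mul_of_nonneg_left ?_ ?_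
  · have := pow_le_pow_left₀ (Sfac_mem h0 h1 hp (hpq.trans hq) (2*k)).1
      (Sfac_mono h0 h1 hp hpq hq (2*k)) (n-k)
    linarith
  · have : 0 ≤ 1 - b := by linarith
    positivity

lemma chord {v x : ℝ} (hv : 0 ≤ v) (hv1 : v ≤ 1) (hx : 0 ≤ x) (hx1 : x ≤ 1) {S : ℝ} (hS : 0 ≤ S)
    (h : S ≤ 1 - (1-v) * x) (m : ℕ) : (1 - v^m) * x ≤ 1 - S^m := by
  have h1 : S^m ≤ (1 - (1-v)*x)^m := pow_le_pow_left₀ hS h m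
  have h2 : (1 - (1-v)*x)^m ≤ 1 - (1 - v^m) * x := by
    clear h1 h
    induction m with
    | zero => simp
    | succ m ih =>
      have a : 0 ≤ 1 - (1-v)*x := by nlinarith [mul_nonneg hv hx, mul_le_mul hx1 hv1 hv zero_le_one]
      have b0 : 0 ≤ v^m := pow_nonneg hv m
      have b1 : v^m ≤ 1 := pow_le_one₀ hv hv1
      rw [pow_succ]
      refine (mul_le_mul_of_nonneg_right ih a).trans ?_
      have : 0 ≤ (1-v) * (1 - v^m) * (x * (1-x)) := by
        apply mul_nonneg (mul_nonneg _ _) (mul_nonneg hx _) <;> linarith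
      rw [pow_succ]; nlinarith
  linarith

lemma ABr_closed {n : ℕ} {b w p v σ : ℝ} (hb : 0 < b) (hb2 : b ≤ 1/2) (h0 : 1/2 ≤ w) (h1 : w ≤ 1)
    (hp : 0 ≤ p) (hp1 : p ≤ 1) (hv : 0 ≤ v) (hv1 : v ≤ 1) (hσ : 0 ≤ σ) (hσ1 : σ ≤ 1)
    (h : ∀ k, 1 ≤ k → Sfac w p (2*k) ≤ 1 - (1-v) * σ^k) :
    (1 - b + b*σ)^n - (1-b)^n - (b*σ + (1-b)*v)^n + ((1-b)*v)^n ≤ ABr n b w p := by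
  have hb1 : 0 ≤ 1 - b := by linarith
  have e : (1 - b + b*σ)^n - (b*σ + (1-b)*v)^n =
      ∑ k ∈ Finset.range (n+1), (n.choose k : ℝ) * b^k * (1-b)^(n-k) * ((1 - v^(n-k)) * σ^k) := by
    rw [show (1 - b + b*σ) = b*σ + (1-b) by ring, add_pow, add_pow, ← Finset.sum_sub_distrib]
    refine Finset.sum_congr rfl fun k _ => ?_
    rw [mul_pow, mul_pow]; ring
  have e0 : (1-b)^n - ((1-b)*v)^n = (n.choose 0 : ℝ) * b^0 * (1-b)^(n-0) * ((1 - v^(n-0)) * σ^0) := by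
    rw [mul_pow]; simp; ring
  unfold ABr
  rw [Finset.sum_range_succ'] at e ⊢
  have z : (n.choose 0 : ℝ) * b^0 * (1-b)^(n-0) * (1 - Sfac w p (2*0)^(n-0)) = 0 := by
    simp [Sfac]
  rw [z, add_zero]
  have : (1 - b + b*σ)^n - (1-b)^n - (b*σ + (1-b)*v)^n + ((1-b)*v)^n =
      ((1 - b + b*σ)^n - (b*σ + (1-b)*v)^n) - ((1-b)^n - ((1-b)*v)^n) := by ring
  rw [this, e, e0, add_sub_cancel_right]
  refine Finset.sum_le_sum fun k _ => mul_le_mul_of_nonneg_left ?_ (by positivity)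
  exact chord hv hv1 (pow_nonneg hσ _) (pow_le_one₀ hσ hσ1) (Sfac_mem h0 h1 hp hp1 _).1
    (h (k+1) (by omega)) _

lemma Sfac_closed {w p : ℝ} (h0 : 1/2 ≤ w) (h1 : w ≤ 1) (hp : 0 ≤ p) (hp1 : p ≤ 1) (k : ℕ)
    (hk : 1 ≤ k) : Sfac w p (2*k) ≤ 1 - (1 - max (2*w-1) (1-w)) * ((1-p/2)^2)^k := by
  unfold Sfac
  rw [if_neg (by omega), ← pow_mul]
  have hx : (1-p)^(2*k) ≤ (1-p/2)^(2*k) := pow_le_pow_left₀ (by linarith) (by linarith) _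
  have hy : 0 ≤ (1-p)^(2*k) := pow_nonneg (by linarith) _
  unfold eta
  rcases le_total (2/3) w with h | h
  · rw [max_eq_left (by linarith : 1-w ≤ w/2), max_eq_left (by linarith : 1-w ≤ 2*w-1)]
    nlinarith
  · rw [max_eq_right (by linarith : w/2 ≤ 1-w), max_eq_right (by linarith : 2*w-1 ≤ 1-w)]
    nlinarith [mul_le_mul_of_nonneg_left hx (by linarith : 0 ≤ 2 - 3*w)]

lemma Sfac_w1 {p : ℝ} (k : ℕ) (hk : 1 ≤ k) :
    Sfac 1 p (2*k) ≤ 1 - (1 - 1/2) * ((1-p)^2)^k := by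
  unfold Sfac eta
  rw [if_neg (by omega), ← pow_mul, max_eq_left (by norm_num)]
  apply le_of_eq; ring

end GLB

end

section
open MeasureTheory
namespace GLB

/-! ### Rational cell checker -/

def qpow (x : ℚ) (n : ℕ) : ℚ := x ^ n

def T16 (x : ℚ) : ℚ := (1 + x/16 + (x/16)*(x/16)/2 + (x/16)*(x/16)*(x/16)/6 + (x/16)*(x/16)*(x/16)*(x/16)/24)^16

lemma T16_le {x : ℚ} (hx : 0 ≤ x) : (T16 x : ℝ) ≤ Real.exp x := by
  have hx' : (0:ℝ) ≤ (x:ℝ)/16 := by positivity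
  have h := Real.sum_le_exp_of_nonneg hx' 5
  simp only [Finset.sum_range_succ, Finset.sum_range_zero, Nat.factorial] at h
  have e : Real.exp x = Real.exp ((x:ℝ)/16)^16 := by
    rw [← Real.exp_nat_mul]; congr 1; push_cast; ring
  rw [e]; unfold T16; push_cast
  refine pow_le_pow_left₀ (by positivity) (le_trans (le_of_eq ?_) h) 16
  push_cast; ring

def cq (l : ℚ) : ℚ := 2*(l*l)*(1+4*(l*l))

def chainOk (R : ℚ → ℚ) (a : ℚ) : ℕ → List ℕ → Bool
  | lo, [] => decide (40 ≤ lo)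
  | lo, hi :: t => decide (hi ≤ 40) && (decide (1 ≤ R ((hi:ℚ)/40) * T16 (a * lo)) && chainOk R a hi t)

lemma chain_sound (R : ℚ → ℚ) (R' : ℝ → ℝ)
    (hR : ∀ (q : ℚ) (p : ℝ), 0 < p → p ≤ q → (q:ℝ) ≤ 1 → (R q : ℝ) ≤ R' p) (a : ℚ) (ha : 0 ≤ a)
    (C : ℝ) (hC : (a:ℝ) * 40 ≤ C) (l : List ℕ) : ∀ lo : ℕ, chainOk R a lo l = true →
    ∀ p : ℝ, 0 < p → p ≤ 1 → (lo:ℝ)/40 ≤ p → Real.exp (-(C * p)) ≤ R' p ∨ p = 1 ∧ 40 ≤ lo := by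
  induction l with
  | nil =>
    intro lo h p hp hp1 hlo
    simp only [chainOk, decide_eq_true_eq] at h
    have : (40:ℝ) ≤ lo := by exact_mod_cast h
    right; exact ⟨by linarith, h⟩
  | cons hi t ih =>
    intro lo h p hp hp1 hlo
    simp only [chainOk, Bool.and_eq_true, decide_eq_true_eq] at h
    obtain ⟨h1, h2, h3⟩ := h
    have main : p ≤ (hi:ℝ)/40 → Real.exp (-(C*p)) ≤ R' p := by
      intro hle
      have hr := hR ((hi:ℚ)/40) p hp (by push_cast; exact hle)
        (by push_cast; rw [div_le_one (by norm_num)]; exact_mod_cast h1)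
      have hx : 0 ≤ a * lo := by positivity
      have hT := T16_le hx
      have h2' : (1:ℝ) ≤ (R ((hi:ℚ)/40) : ℝ) * (T16 (a*lo) : ℝ) := by exact_mod_cast h2
      have hTpos : 0 < (T16 (a*lo) : ℝ) := by
        have : (0:ℚ) < T16 (a*lo) := by unfold T16; positivity
        exact_mod_cast this
      have hexp : Real.exp (((a*lo : ℚ)):ℝ) ≤ Real.exp (C*p) := by
        apply Real.exp_le_exp.2
        push_cast
        have a0 : (0:ℝ) ≤ a := by exact_mod_cast ha
        have : (a:ℝ) * lo = (a*40) * (lo/40) := by ring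
        rw [this]
        exact mul_le_mul hC hlo (by positivity) (le_trans (by positivity) hC)
      rw [Real.exp_neg]
      refine le_trans ?_ hr
      have : (Real.exp (C*p))⁻¹ ≤ (T16 (a*lo) : ℝ)⁻¹ := inv_anti₀ hTpos (hT.trans hexp)
      refine this.trans ?_
      rw [inv_le_iff_one_le_mul₀ hTpos]; exact h2'
    rcases le_total p ((hi:ℝ)/40) with hle | hge
    · exact Or.inl (main hle)
    · rcases ih hi h3 p hp hp1 hge with h | ⟨h, h'⟩
      · exact Or.inl h
      · left; apply main; rw [h, le_div_iff₀ (by norm_num)]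
        have : (40:ℝ) ≤ hi := by exact_mod_cast h'
        linarith

lemma chain_sound0 (R : ℚ → ℚ) (R' : ℝ → ℝ)
    (hR : ∀ (q : ℚ) (p : ℝ), 0 < p → p ≤ q → (q:ℝ) ≤ 1 → (R q : ℝ) ≤ R' p) (a : ℚ) (ha : 0 ≤ a)
    (C : ℝ) (hC : (a:ℝ) * 40 ≤ C) (l : List ℕ) (h : chainOk R a 0 l = true)
    (p : ℝ) (hp : 0 < p) (hp1 : p ≤ 1) : Real.exp (-(C * p)) ≤ R' p := by
  rcases chain_sound R R' hR a ha C hC l 0 h p hp hp1 (by simpa using hp.le) with h | ⟨_, h⟩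
  · exact h
  · omega

lemma cq_le {l : ℚ} {lam : ℝ} (hl : 0 ≤ l) (h : (l:ℝ) ≤ lam) : (cq l : ℝ) ≤ 2*lam^2*(1+4*lam^2) := by
  unfold cq; push_cast
  have : (0:ℝ) ≤ l := by exact_mod_cast hl
  have : (l:ℝ)*l ≤ lam^2 := by nlinarith
  nlinarith [mul_nonneg (by assumption : (0:ℝ) ≤ l) (by assumption : (0:ℝ) ≤ l)]

/-! AB part -/

def sfq (w p : ℚ) (m : ℕ) : ℚ :=
  if m = 0 then 1 else 1 - 2 * (1 - w) * (1 - p/2)^m + ((if w/2 ≤ 1 - w then 1 - w else w/2) - 2*w + 1) * (1-p)^m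

lemma sfq_cast (w p : ℚ) (m : ℕ) : (sfq w p m : ℝ) = Sfac w p m := by
  unfold sfq Sfac eta
  split_ifs with h h'
  · simp
  · rw [max_eq_right (by exact_mod_cast h')]; push_cast; ring
  · rw [max_eq_left (by have := (not_le.1 h').le; exact_mod_cast this)]; push_cast; ring

def qsum (f : ℕ → ℚ) : ℕ → ℚ
  | 0 => 0
  | n+1 => qsum f n + f n

lemma qsum_cast (f : ℕ → ℚ) (n : ℕ) : (qsum f n : ℝ) = ∑ k ∈ Finset.range n, (f k : ℝ) := by
  induction n with
  | zero => simp [qsum]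
  | succ n ih => rw [Finset.sum_range_succ, ← ih]; simp [qsum]

def abq (n : ℕ) (b w p : ℚ) : ℚ :=
  qsum (fun k => (n.choose k : ℚ) * b^k * (1-b)^(n-k) * (1 - sfq w p (2*k)^(n-k))) (n+1)

lemma abq_cast (n : ℕ) (b w p : ℚ) : (abq n b w p : ℝ) = ABr n b w p := by
  unfold abq ABr
  rw [qsum_cast]
  refine Finset.sum_congr rfl fun k _ => ?_
  push_cast; rw [sfq_cast]

def abc (n : ℕ) (b w p : ℚ) : ℚ :=
  (1 - b + b*((1-p/2)*(1-p/2)))^n - (1-b)^n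
   - (b*((1-p/2)*(1-p/2)) + (1-b)*(if 2*w-1 ≤ 1-w then 1-w else 2*w-1))^n

lemma abc_cast {n : ℕ} {b w p : ℚ} (hb : 0 < b) (hb2 : b ≤ 1/2) (h0 : 1/2 ≤ w) (h1 : w ≤ 1)
    (hp : (0:ℝ) ≤ p) (hp1 : (p:ℝ) ≤ 1) : (abc n b w p : ℝ) ≤ ABr n b w p := by
  have hb' : (0:ℝ) < b := by exact_mod_cast hb
  have hb2' : (b:ℝ) ≤ 1/2 := by have : ((b:ℚ):ℝ) ≤ ((1/2:ℚ):ℝ) := by exact_mod_cast hb2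
                                simpa using this
  have h0' : (1:ℝ)/2 ≤ w := by have : (((1/2:ℚ)):ℝ) ≤ (w:ℝ) := by exact_mod_cast h0
                               simpa using this
  have h1' : (w:ℝ) ≤ 1 := by exact_mod_cast h1
  have hv : (0:ℝ) ≤ max (2*(w:ℝ)-1) (1-w) := le_max_of_le_right (by linarith)
  have := ABr_closed (n := n) hb' hb2' h0' h1' hp hp1
    hv (max_le (by linarith) (by linarith)) (sq_nonneg (1-(p:ℝ)/2)) (by nlinarith)
    (Sfac_closed h0' h1' hp hp1)
  refine le_trans ?_ this
  have hnn : (0:ℝ) ≤ ((1-(b:ℝ)) * max (2*(w:ℝ)-1) (1-w))^n :=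
    pow_nonneg (mul_nonneg (by linarith) hv) n
  have e : (((if 2*w-1 ≤ 1-w then 1-w else 2*w-1 : ℚ)):ℝ) = max (2*(w:ℝ)-1) (1-w) := by
    split_ifs with h
    · rw [max_eq_right (by exact_mod_cast h)]; push_cast; ring
    · rw [max_eq_left (by have := (not_le.1 h).le; exact_mod_cast this)]; push_cast; ring
  unfold abc; push_cast [e]
  rw [← pow_two]; linarith

/-- cell `(l, b, w, ps)` : lower end `l/1000`, `b/200`, `w/20`. -/
def abCell (n : ℕ) (lhi : ℚ) (llo b w : ℚ) (ps : List ℕ) : Bool :=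
  decide (0 ≤ llo) && (decide (0 < b) && (decide (b ≤ 1/2) && (decide (1/2 ≤ w) && (decide (w ≤ 1) &&
  (decide (lhi*lhi ≤ w*(1-b)*b) && (decide (lhi ≤ 1/2) && 
  chainOk (fun p => 2 * (if n ≤ 16 then abq n b w p else abc n b w p)) (cq llo * n / 40) 0 ps))))))

variable {n : ℕ} {p lam : ℝ}

theorem abCell_sound {lhi llo b w : ℚ} {ps : List ℕ} (h : abCell n lhi llo b w ps = true)
    (hp : p ∈ Set.Ioc (0:ℝ) 1) (hl : 0 < lam) (h1 : (llo:ℝ) ≤ lam) (h2 : lam ≤ lhi)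
    (Yhat : (Fin n → Fin n → Bool × ℝ) → Fin n → Fin n → ℝ) :
    Goal01 n p lam Yhat ((1/2) * Real.exp (-2*lam^2*(4*lam^2 + 1)*p*(n:ℝ))) := by
  simp only [abCell, Bool.and_eq_true, decide_eq_true_eq] at h
  obtain ⟨a1, a2, a3, a4, a5, a6, a7, a8⟩ := h
  have c2 : (0:ℝ) < b := by exact_mod_cast a2
  have c3 : (b:ℝ) ≤ 1/2 := by
    have : ((b:ℚ):ℝ) ≤ ((1/2:ℚ):ℝ) := by exact_mod_cast a3
    simpa using this
  have c4 : (1:ℝ)/2 ≤ w := by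
    have : (((1/2:ℚ)):ℝ) ≤ (w:ℝ) := by exact_mod_cast a4
    simpa using this
  have c5 : (w:ℝ) ≤ 1 := by exact_mod_cast a5
  have c6 : (lhi:ℝ)*lhi ≤ w*(1-b)*b := by exact_mod_cast a6
  have c7 : (lhi:ℝ) ≤ 1/2 := by
    have : ((lhi:ℚ):ℝ) ≤ ((1/2:ℚ):ℝ) := by exact_mod_cast a7
    simpa using this
  refine AB01 hp hl c2 c3 c4 c5 (le_trans (by nlinarith) c6) (h2.trans c7) Yhat _ ?_
  change _ ≤ ABr n b w p
  have := chain_sound0 _ (fun p => 2 * ABr n b w p) ?_ (cq llo * n / 40) ?_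
    (2*lam^2*(1+4*lam^2)*n) ?_ ps a8 p hp.1 hp.2
  · have e : -2*lam^2*(4*lam^2 + 1)*p*(n:ℝ) = -(2*lam^2*(1+4*lam^2)*n*p) := by ring
    rw [e]; linarith
  · intro q p' hp' hpq hq
    have an := ABr_anti (n := n) c2 c3 c4 c5 hp'.le hpq hq
    have : ((if n ≤ 16 then abq n b w q else abc n b w q : ℚ) : ℝ) ≤ ABr n b w q := by
      split_ifs
      · rw [abq_cast]
      · exact abc_cast a2 a3 a4 a5 (hp'.le.trans hpq) hq
    push_cast at this ⊢
    linarith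
  · have : 0 ≤ cq llo := by unfold cq; positivity
    positivity
  · have := cq_le a1 h1
    push_cast
    have hn : (0:ℝ) ≤ n := Nat.cast_nonneg n
    nlinarith

def floorOk (n par : ℕ) (lo : ℚ) : Bool :=
  if n ≤ 13 then
    decide (2 ≤ par) && (decide (lo * par ≤ 1) &&
    decide ((1:ℚ)/2 ≤ (11/24) * (n * (1 - 1/(par:ℚ))^(n-1)) -
      (1/12) * (n * (n-1) * ((1 - 1/(par:ℚ)) * (1 - 2/(par:ℚ))^(n-2)))))
  else
    decide (0 < (par:ℚ)/(20*n)) && (decide (0 < 1 - 3*((par:ℚ)/(20*n))) &&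
    (decide (lo*lo ≤ 1/2*(1-3*((par:ℚ)/(20*n)))*((par:ℚ)/(20*n))) && (decide (lo ≤ 1-3*((par:ℚ)/(20*n))) &&
    decide ((1:ℚ)/2 ≤ 3*(n*((par:ℚ)/(20*n)*(1-(par:ℚ)/(20*n))^(n-1)))
      - 3*(n*(n-1)*((par:ℚ)/(20*n)*((par:ℚ)/(20*n)*(1-2*((par:ℚ)/(20*n)))^(n-2))))
      - 3*(n*((par:ℚ)/(20*n)*(1-(par:ℚ)/(20*n)-(1-3*((par:ℚ)/(20*n)))/4)^(n-1)))))))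

lemma half_exp_le {x : ℝ} (h : x ≤ 0) : (1/2) * Real.exp x ≤ 1/2 := by
  have := Real.exp_le_one_iff.2 h; linarith

lemma arg_nonpos (hp : p ∈ Set.Ioc (0:ℝ) 1) : -2*lam^2*(4*lam^2 + 1)*p*(n:ℝ) ≤ 0 := by
  have : 0 ≤ 2*lam^2*(4*lam^2 + 1)*p*(n:ℝ) := by have := hp.1; positivity
  linarith

theorem floor_sound {par : ℕ} {lo : ℚ} (h : floorOk n par lo = true)
    (hp : p ∈ Set.Ioc (0:ℝ) 1) (hl : 0 < lam) (h2 : lam ≤ lo)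
    (Yhat : (Fin n → Fin n → Bool × ℝ) → Fin n → Fin n → ℝ) :
    Goal01 n p lam Yhat ((1/2) * Real.exp (-2*lam^2*(4*lam^2 + 1)*p*(n:ℝ))) := by
  have hh := half_exp_le (arg_nonpos (n := n) (lam := lam) hp)
  unfold floorOk at h
  split_ifs at h
  · simp only [Bool.and_eq_true, decide_eq_true_eq] at h
    obtain ⟨a1, a2, a3⟩ := h
    obtain ⟨K, rfl⟩ := Nat.exists_eq_add_of_le' a1
    have e : (((K+2:ℕ)):ℝ) = (K:ℝ)+2 := by push_cast; ring
    have a2' : (lo:ℝ) * ((K:ℝ)+2) ≤ 1 := by rw [← e]; exact_mod_cast a2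
    refine RSK hp hl K (h2.trans ?_) Yhat _ (hh.trans ?_)
    · rw [le_div_iff₀ (by positivity)]; exact a2'
    · have : (((1:ℚ)/2 : ℚ) : ℝ) ≤ _ := Rat.cast_le.2 a3
      push_cast at this
      exact this
  · simp only [Bool.and_eq_true, decide_eq_true_eq] at h
    generalize hb : (par:ℚ)/(20*n) = b at h
    obtain ⟨a1, a2, a3, a4, a5⟩ := h
    have c3 : (((lo*lo : ℚ)):ℝ) ≤ _ := Rat.cast_le.2 a3
    have c4 : ((lo : ℚ):ℝ) ≤ _ := Rat.cast_le.2 a4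
    have c2 : (((0 : ℚ)):ℝ) < _ := Rat.cast_lt.2 a2
    have c5 : (((1:ℚ)/2 : ℚ) : ℝ) ≤ _ := Rat.cast_le.2 a5
    push_cast at c2 c3 c4 c5
    exact P01 hp hl (b := b) (by exact_mod_cast a1) c2 (by nlinarith) (h2.trans c4) Yhat _ (hh.trans c5)

def abRow (n par : ℕ) : ℚ → List (ℕ × ℕ × ℕ × List ℕ) → Bool
  | lhi, [] => floorOk n par lhi
  | lhi, (l, b, w, ps) :: t =>
    abCell n lhi ((l:ℚ)/1000) ((b:ℚ)/200) ((w:ℚ)/20) ps && abRow n par ((l:ℚ)/1000) t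

theorem abRow_sound {par : ℕ} (t : List (ℕ × ℕ × ℕ × List ℕ)) : ∀ {lhi : ℚ}, abRow n par lhi t = true →
    p ∈ Set.Ioc (0:ℝ) 1 → 0 < lam → lam ≤ lhi →
    ∀ (Yhat : (Fin n → Fin n → Bool × ℝ) → Fin n → Fin n → ℝ),
    Goal01 n p lam Yhat ((1/2) * Real.exp (-2*lam^2*(4*lam^2 + 1)*p*(n:ℝ))) := by
  induction t with
  | nil => intro lhi h hp hl h2 Yhat; exact floor_sound h hp hl h2 Yhat
  | cons a t ih =>
    obtain ⟨l, b, w, ps⟩ := a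
    intro lhi h hp hl h2 Yhat
    simp only [abRow, Bool.and_eq_true] at h
    rcases le_total lam (((l:ℚ)/1000 : ℚ) : ℝ) with h' | h'
    · exact ih h.2 hp hl h' Yhat
    · exact abCell_sound h.1 hp hl h' h2 Yhat

def abAll (lhi : ℚ) : ℕ → List (ℕ × List (ℕ × ℕ × ℕ × List ℕ)) → Bool
  | _, [] => true
  | n, (par, t) :: rest => abRow n par lhi t && abAll lhi (n+1) rest

theorem abAll_sound {lhi : ℚ} (t : List (ℕ × List (ℕ × ℕ × ℕ × List ℕ))) : ∀ n0 : ℕ,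
    abAll lhi n0 t = true → n0 ≤ n → n < n0 + t.length →
    p ∈ Set.Ioc (0:ℝ) 1 → 0 < lam → lam ≤ lhi →
    ∀ (Yhat : (Fin n → Fin n → Bool × ℝ) → Fin n → Fin n → ℝ),
    Goal01 n p lam Yhat ((1/2) * Real.exp (-2*lam^2*(4*lam^2 + 1)*p*(n:ℝ))) := by
  induction t with
  | nil => intro n0 _ h1 h2; simp at h2; omega
  | cons a t ih =>
    obtain ⟨par, t'⟩ := a
    intro n0 h h1 h2 hp hl hl2 Yhat
    simp only [abAll, Bool.and_eq_true] at h
    rcases Nat.eq_or_lt_of_le h1 with rfl | h1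
    · exact abRow_sound _ h.1 hp hl hl2 Yhat
    · exact ih (n0+1) h.2 h1 (by simp only [List.length_cons] at h2; omega) hp hl hl2 Yhat

end GLB

end

section
open MeasureTheory
namespace GLB

def tab1 : List (ℕ × List (ℕ × ℕ × ℕ × List ℕ)) := [
  (4, [(388, 100, 15, [8, 17, 26, 34, 40]), (316, 73, 13, [14, 26, 35, 40]), (250, 56, 10, [16, 29, 35, 38, 39, 40])]),
  (5, [(386, 75, 16, [12, 27, 40]), (296, 72, 13, [19, 33, 40]), (200, 46, 10, [24, 35, 39, 40])]),
  (6, [(370, 75, 16, [14, 31, 40]), (292, 61, 13, [22, 40]), (166, 44, 10, [28, 37, 40])]),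
  (7, [(292, 75, 16, [14, 25, 32, 36, 39, 40]), (142, 44, 10, [31, 38, 40])]),
  (9, [(375, 75, 16, [14, 34, 40]), (267, 56, 14, [23, 40]), (111, 35, 10, [33, 39, 40])]),
  (10, [(376, 75, 16, [14, 35, 40]), (262, 51, 15, [22, 40]), (100, 33, 10, [35, 40])]),
  (10, [(382, 75, 16, [14, 36, 40]), (268, 53, 15, [21, 40]), (100, 35, 10, [35, 40])]),
  (10, [(274, 66, 17, [14, 24, 31, 36, 40]), (100, 33, 11, [34, 40])]),
  (10, [(280, 66, 17, [13, 23, 31, 37, 40]), (100, 31, 12, [34, 40])]),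
  (10, [(286, 66, 17, [13, 24, 33, 40]), (100, 30, 13, [33, 39, 40])]),
  (43, [(347, 75, 16, [12, 27, 40]), (203, 37, 16, [24, 40])]),
  (44, [(346, 75, 16, [12, 26, 40]), (202, 40, 15, [24, 40])]),
  (45, [(339, 66, 17, [12, 27, 40]), (201, 42, 14, [24, 40])]),
  (46, [(332, 60, 18, [4, 9, 15, 22, 31, 40]), (230, 29, 18, [8, 15, 21, 27, 32, 36, 39, 40]), (200, 15, 16, [8, 15, 21, 26, 30, 33, 35, 37, 38, 39, 40])]),
  (47, [(349, 60, 18, [4, 9, 16, 26, 40]), (253, 33, 18, [8, 16, 24, 32, 40]), (199, 17, 17, [9, 17, 23, 28, 32, 35, 37, 39, 40])]),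
  (47, [(359, 60, 18, [4, 9, 17, 29, 40]), (263, 35, 18, [7, 15, 23, 32, 40]), (197, 18, 17, [9, 17, 23, 28, 32, 35, 37, 39, 40])]),
  (48, [(357, 60, 18, [4, 9, 16, 27, 40]), (261, 35, 18, [7, 14, 22, 31, 40]), (195, 18, 17, [10, 18, 24, 29, 33, 36, 38, 40])]),
  (48, [(355, 60, 18, [4, 9, 16, 26, 40]), (259, 34, 18, [7, 14, 22, 31, 40]), (193, 18, 17, [10, 18, 24, 29, 33, 36, 38, 40])]),
  (48, [(359, 60, 18, [4, 9, 16, 27, 40]), (263, 35, 18, [6, 13, 21, 30, 40]), (191, 18, 17, [9, 17, 24, 29, 33, 36, 38, 40])]),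
  (48, [(339, 55, 19, [3, 7, 12, 19, 29, 40]), (249, 31, 18, [7, 14, 22, 31, 40]), (189, 15, 18, [9, 17, 25, 31, 36, 40])]),
  (48, [(355, 55, 19, [3, 7, 13, 23, 40]), (259, 34, 18, [6, 13, 20, 29, 40]), (187, 17, 18, [9, 17, 24, 30, 34, 37, 40])]),
  (49, [(353, 60, 18, [3, 7, 12, 19, 30, 40]), (263, 34, 18, [6, 13, 21, 31, 40]), (185, 17, 18, [9, 17, 24, 29, 33, 37, 40])]),
  (49, [(351, 60, 18, [3, 7, 12, 19, 29, 40]), (249, 33, 18, [6, 12, 18, 25, 33, 40]), (183, 15, 18, [9, 17, 25, 32, 37, 40])]),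
  (49, [(349, 60, 18, [3, 7, 12, 18, 27, 40]), (247, 31, 19, [5, 10, 16, 23, 31, 40]), (181, 15, 18, [9, 17, 24, 31, 36, 40])]),
  (49, [(347, 55, 19, [2, 5, 9, 15, 24, 40]), (257, 32, 18, [6, 12, 20, 30, 40]), (179, 16, 18, [9, 17, 24, 30, 35, 38, 40])]),
  (49, [(333, 55, 19, [2, 5, 9, 14, 20, 29, 40]), (255, 27, 19, [6, 14, 25, 40]), (177, 16, 18, [9, 17, 23, 29, 33, 37, 40])]),
  (49, [(343, 60, 18, [3, 6, 10, 15, 21, 30, 40]), (241, 29, 19, [5, 11, 17, 24, 33, 40]), (175, 14, 18, [9, 17, 25, 32, 38, 40])]),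
  (49, [(347, 55, 19, [2, 5, 9, 15, 24, 40]), (245, 30, 19, [5, 10, 16, 23, 32, 40]), (173, 15, 18, [9, 17, 24, 30, 35, 39, 40])]),
  (49, [(351, 55, 19, [2, 5, 9, 15, 25, 40]), (249, 31, 19, [5, 10, 16, 23, 32, 40]), (171, 15, 18, [9, 17, 23, 28, 33, 37, 40])]),
  (49, [(349, 55, 19, [2, 5, 9, 15, 24, 40]), (241, 31, 19, [5, 9, 14, 19, 25, 32, 40]), (169, 14, 18, [9, 17, 24, 30, 35, 39, 40])]),
  (49, [(348, 55, 19, [2, 5, 9, 15, 24, 40]), (246, 30, 19, [5, 10, 16, 23, 32, 40]), (168, 15, 18, [9, 16, 22, 27, 31, 35, 38, 40])]),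
  (49, [(352, 55, 19, [2, 5, 9, 15, 25, 40]), (244, 31, 19, [4, 8, 13, 18, 24, 31, 40]), (166, 14, 19, [8, 15, 21, 26, 31, 35, 38, 40])]),
  (49, [(338, 55, 19, [2, 5, 8, 12, 18, 27, 40]), (230, 28, 19, [5, 10, 15, 20, 26, 33, 40]), (164, 12, 19, [9, 17, 24, 31, 37, 40])]),
  (49, [(348, 55, 19, [2, 5, 9, 15, 24, 40]), (240, 30, 19, [4, 8, 13, 18, 24, 31, 40]), (162, 13, 19, [8, 15, 21, 27, 32, 36, 39, 40])]),
  (49, [(365, 60, 18, [2, 5, 9, 15, 24, 40]), (281, 34, 19, [4, 9, 16, 26, 40]), (215, 19, 19, [7, 15, 26, 40]), (161, 11, 18, [9, 18, 26, 34, 40])]),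
  (49, [(351, 55, 19, [2, 5, 9, 15, 24, 40]), (291, 31, 19, [4, 10, 20, 40]), (225, 20, 19, [6, 14, 25, 40]), (159, 12, 18, [9, 17, 24, 30, 36, 40])]),
  (49, [(356, 55, 19, [2, 5, 9, 15, 25, 40]), (278, 32, 19, [4, 9, 16, 27, 40]), (212, 18, 19, [7, 16, 28, 40]), (158, 10, 19, [9, 18, 27, 35, 40])]),
  (49, [(354, 55, 19, [2, 5, 9, 15, 25, 40]), (276, 32, 19, [4, 9, 16, 27, 40]), (210, 18, 19, [7, 15, 26, 40]), (156, 10, 19, [9, 18, 26, 34, 40])]),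
  (49, [(353, 55, 19, [2, 5, 9, 15, 24, 40]), (275, 32, 19, [4, 9, 16, 26, 40]), (209, 18, 19, [7, 15, 26, 40]), (155, 10, 19, [9, 18, 26, 34, 40])]),
  (49, [(357, 55, 19, [2, 5, 9, 15, 25, 40]), (285, 32, 19, [3, 8, 15, 27, 40]), (219, 19, 19, [6, 14, 25, 40]), (153, 11, 19, [9, 17, 24, 30, 36, 40])]),
  (49, [(356, 55, 19, [2, 5, 9, 15, 25, 40]), (284, 32, 19, [3, 8, 15, 27, 40]), (218, 19, 19, [6, 14, 25, 40]), (152, 11, 19, [9, 17, 24, 30, 35, 40])]),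
  (49, [(366, 55, 19, [2, 5, 9, 16, 29, 40]), (276, 34, 19, [3, 7, 12, 19, 29, 40]), (198, 18, 19, [6, 13, 21, 31, 40]), (150, 9, 19, [9, 18, 27, 35, 40])]),
  (49, [(365, 55, 19, [2, 5, 9, 16, 28, 40]), (275, 34, 19, [3, 7, 12, 18, 27, 40]), (197, 18, 19, [6, 13, 21, 30, 40]), (149, 9, 19, [9, 18, 27, 35, 40])]),
  (49, [(382, 55, 19, [2, 5, 10, 20, 40]), (292, 38, 19, [3, 6, 10, 16, 25, 40]), (202, 20, 19, [5, 10, 16, 23, 31, 40]), (148, 9, 19, [9, 18, 27, 35, 40])]),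
  (49, [(363, 55, 19, [2, 5, 9, 16, 28, 40]), (291, 34, 19, [3, 7, 13, 23, 40]), (201, 20, 19, [5, 10, 16, 22, 30, 40]), (147, 9, 19, [9, 18, 26, 34, 40])]),
  (49, [(361, 55, 19, [1, 3, 6, 11, 19, 33, 40]), (289, 33, 19, [3, 7, 13, 23, 40]), (211, 20, 19, [5, 11, 18, 27, 40]), (145, 10, 19, [9, 17, 24, 30, 35, 40])]),
  (49, [(354, 55, 19, [1, 3, 6, 10, 16, 26, 40]), (270, 32, 19, [3, 7, 12, 19, 30, 40]), (210, 17, 19, [6, 14, 25, 40]), (144, 10, 19, [9, 17, 24, 30, 35, 40])]),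
  (49, [(359, 55, 19, [1, 3, 6, 10, 17, 29, 40]), (275, 33, 19, [3, 7, 12, 19, 30, 40]), (191, 18, 19, [6, 12, 18, 25, 33, 40]), (143, 9, 17, [9, 18, 26, 33, 40])]),
  (49, [(358, 55, 19, [1, 3, 6, 10, 16, 27, 40]), (274, 33, 19, [3, 6, 10, 16, 25, 40]), (202, 18, 19, [5, 11, 18, 28, 40]), (142, 9, 19, [9, 17, 25, 32, 38, 40])]),
  (49, [(357, 55, 19, [1, 3, 6, 10, 16, 26, 40]), (285, 32, 19, [3, 7, 13, 23, 40]), (207, 19, 19, [5, 11, 18, 27, 40]), (141, 10, 19, [8, 15, 21, 27, 32, 36, 40])]),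
  (49, [(355, 55, 19, [1, 3, 6, 10, 16, 26, 40]), (271, 32, 19, [3, 6, 10, 16, 25, 40]), (199, 17, 19, [6, 13, 21, 32, 40]), (139, 9, 19, [9, 17, 24, 31, 37, 40])]),
  (49, [(360, 55, 19, [1, 3, 6, 10, 17, 29, 40]), (288, 33, 19, [3, 7, 13, 22, 40]), (198, 20, 19, [5, 9, 14, 19, 25, 32, 40]), (138, 9, 19, [9, 17, 24, 30, 36, 40])]),
  (49, [(359, 55, 19, [1, 3, 6, 10, 16, 27, 40]), (269, 33, 19, [3, 6, 10, 15, 22, 33, 40]), (197, 17, 19, [5, 11, 18, 28, 40]), (137, 9, 19, [9, 17, 24, 30, 35, 40])]),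
  (49, [(358, 55, 19, [1, 3, 6, 10, 16, 26, 40]), (262, 33, 19, [2, 5, 8, 12, 16, 22, 30, 40]), (190, 16, 19, [6, 12, 20, 30, 40]), (136, 8, 19, [9, 18, 26, 33, 40])]),
  (49, [(357, 55, 19, [1, 3, 6, 10, 16, 26, 40]), (285, 32, 19, [3, 7, 13, 22, 40]), (201, 19, 19, [5, 10, 16, 23, 32, 40]), (135, 9, 19, [9, 16, 23, 29, 34, 38, 40])]),
  (49, [(362, 55, 19, [1, 3, 6, 10, 17, 29, 40]), (284, 34, 19, [2, 5, 9, 15, 24, 40]), (200, 19, 19, [5, 10, 15, 21, 29, 40]), (134, 9, 19, [8, 15, 21, 27, 32, 36, 40])])]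

set_option maxRecDepth 100000 in
theorem tab1_ok : abAll (433/1000) 4 tab1 = true := by decide +kernel

end GLB

end

section
open MeasureTheory
namespace GLB
variable {n : ℕ} {p lam : ℝ}

/-! ### The table for part (ii) -/

noncomputable def t2r (n m : ℕ) (b w : ℝ) (D : Bool) (p : ℝ) : ℝ :=
  (if D then m * (b * (1-b)^(n-1)) * (1/2 * (1-p/2)) else 0) +
      4 * w * (1-w) * (n-1) * (m * (1 - m*b) + m * (m-1) / 2 * b) * (b * (1-p/2)^2 * (1 - b + b * (1-p/2)^2)^(n-2))

def t2q (n m : ℕ) (b w : ℚ) (D : Bool) (p : ℚ) : ℚ :=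
  (if D then m * (b * (1-b)^(n-1)) * (1/2 * (1-p/2)) else 0) +
      4 * w * (1-w) * (n-1) * (m * (1 - m*b) + m * (m-1) / 2 * b) * (b * (1-p/2)^2 * (1 - b + b * (1-p/2)^2)^(n-2))

lemma t2q_cast (n m : ℕ) (b w : ℚ) (D : Bool) (p : ℚ) : (t2q n m b w D p : ℝ) = t2r n m b w D p := by
  unfold t2q t2r; cases D <;> push_cast <;> simp

lemma t2r_anti {m : ℕ} {b w : ℝ} {D : Bool} {p q : ℝ} (hn : 1 ≤ n) (hm : 1 ≤ m) (hb : 0 < b)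
    (ha : 0 < 1 - m * b) (h0 : 1/2 ≤ w) (h1 : w ≤ 1) (hp : 0 ≤ p) (hpq : p ≤ q) (hq : q ≤ 1) :
    t2r n m b w D q ≤ t2r n m b w D p := by
  have hm' : (1:ℝ) ≤ m := by exact_mod_cast hm
  have hn' : (1:ℝ) ≤ n := by exact_mod_cast hn
  have hb1 : 0 ≤ 1 - b := by nlinarith
  have hx : (1-q/2)^2 ≤ (1-p/2)^2 := by nlinarith
  unfold t2r
  apply add_le_add
  · cases D
    · simp
    · simp only [if_true]
      refine mul_le_mul_of_nonneg_left (by linarith) (by positivity)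
  · refine mul_le_mul_of_nonneg_left ?_ ?_
    · refine mul_le_mul (mul_le_mul_of_nonneg_left hx hb.le) (pow_le_pow_left₀ (by positivity) ?_ _)
        (by positivity) (by positivity)
      have := mul_le_mul_of_nonneg_left hx hb.le
      linarith
    · have a1 : 0 ≤ 1 - w := by linarith
      have a2 : (0:ℝ) ≤ n - 1 := by linarith
      have a3 : (0:ℝ) ≤ m - 1 := by linarith
      have a4 : 0 ≤ w := by linarith
      have a5 : 0 ≤ 1 - m*b := ha.le
      positivity

def t2Cell (n : ℕ) (lhi llo : ℚ) (m : ℕ) (b w : ℚ) (D : Bool) (ps : List ℕ) : Bool :=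
  decide (0 ≤ llo) && (decide (1 ≤ m) && (decide (0 < b) && (decide (0 < 1 - m*b) && (decide (1/2 ≤ w) &&
  (decide (w ≤ 1) && (decide (0 ≤ lhi) && (decide (lhi*lhi ≤ w*(1-m*b)*b) && (decide (lhi ≤ 1 - m*b) &&
  ((!D || decide (lhi ≤ b)) &&
  chainOk (fun p => 4 * t2q n m b w D p) (cq llo * n / 40) 0 ps)))))))))

theorem t2Cell_sound {lhi llo b w : ℚ} {m : ℕ} {D : Bool} {ps : List ℕ} (hn : 1 ≤ n)
    (h : t2Cell n lhi llo m b w D ps = true)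
    (hp : p ∈ Set.Ioc (0:ℝ) 1) (hl : 0 < lam) (h1 : (llo:ℝ) ≤ lam) (h2 : lam ≤ lhi)
    (Yhat : (Fin n → Fin n → Bool × ℝ) → Fin n → Fin n → ℝ) :
    Goal2 n p lam Yhat ((1/(4*(n:ℝ))) * Real.exp (-2*lam^2*(4*lam^2 + 1)*p*(n:ℝ))) := by
  simp only [t2Cell, Bool.and_eq_true, decide_eq_true_eq, Bool.or_eq_true, Bool.not_eq_true'] at h
  obtain ⟨a1, am, a2, a3, a4, a5, ah, a6, a7, aD, a8⟩ := h
  have c2 : (0:ℝ) < b := by exact_mod_cast a2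
  have c3 : (0:ℝ) < 1 - m*b := by exact_mod_cast a3
  have c4 : (1:ℝ)/2 ≤ w := by
    have : (((1/2:ℚ)):ℝ) ≤ (w:ℝ) := by exact_mod_cast a4
    simpa using this
  have c5 : (w:ℝ) ≤ 1 := by exact_mod_cast a5
  have c6 : (lhi:ℝ)*lhi ≤ w*(1-m*b)*b := by exact_mod_cast a6
  have c7 : (lhi:ℝ) ≤ 1 - m*b := by exact_mod_cast a7
  refine T2 hp hl hn m D c2 c3 c4 c5 (le_trans (by nlinarith) c6) (h2.trans c7) ?_ Yhat _ ?_
  · intro hD; subst hD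
    rcases aD with h | h
    · cases h
    · exact h2.trans (by exact_mod_cast h)
  change _ ≤ t2r n m b w D p
  have := chain_sound0 _ (fun p => 4 * t2r n m b w D p) ?_ (cq llo * n / 40) ?_
    (2*lam^2*(1+4*lam^2)*n) ?_ ps a8 p hp.1 hp.2
  · have e : -2*lam^2*(4*lam^2 + 1)*p*(n:ℝ) = -(2*lam^2*(1+4*lam^2)*n*p) := by ring
    have hn0 : (n:ℝ) ≠ 0 := by positivity
    rw [e, show (n:ℝ) * (1/(4*(n:ℝ)) * Real.exp (-(2*lam^2*(1+4*lam^2)*n*p))) =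
      1/4 * Real.exp (-(2*lam^2*(1+4*lam^2)*n*p)) by field_simp]
    linarith
  · intro q p' hp' hpq hq
    have an := t2r_anti (n := n) (D := D) hn am c2 c3 c4 c5 hp'.le hpq hq
    push_cast
    rw [t2q_cast]
    linarith
  · have : 0 ≤ cq llo := by unfold cq; positivity
    positivity
  · have := cq_le a1 h1
    push_cast
    have hn : (0:ℝ) ≤ n := Nat.cast_nonneg n
    nlinarith

def t2Row (n : ℕ) : ℚ → List (ℕ × ℕ × ℕ × ℕ × Bool × List ℕ) → Bool
  | lhi, [] => decide (lhi ≤ 0)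
  | lhi, (l, m, b, w, D, ps) :: t =>
    t2Cell n lhi ((l:ℚ)/1000) m ((b:ℚ)/240) ((w:ℚ)/20) D ps && t2Row n ((l:ℚ)/1000) t

theorem t2Row_sound (hn : 1 ≤ n) (t : List (ℕ × ℕ × ℕ × ℕ × Bool × List ℕ)) : ∀ {lhi : ℚ}, t2Row n lhi t = true →
    p ∈ Set.Ioc (0:ℝ) 1 → 0 < lam → lam ≤ lhi →
    ∀ (Yhat : (Fin n → Fin n → Bool × ℝ) → Fin n → Fin n → ℝ),
    Goal2 n p lam Yhat ((1/(4*(n:ℝ))) * Real.exp (-2*lam^2*(4*lam^2 + 1)*p*(n:ℝ))) := by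
  induction t with
  | nil =>
    intro lhi h hp hl h2 Yhat
    simp only [t2Row, decide_eq_true_eq] at h
    have : (lhi:ℝ) ≤ 0 := by exact_mod_cast h
    linarith
  | cons a t ih =>
    obtain ⟨l, m, b, w, D, ps⟩ := a
    intro lhi h hp hl h2 Yhat
    simp only [t2Row, Bool.and_eq_true] at h
    rcases le_total lam (((l:ℚ)/1000 : ℚ) : ℝ) with h' | h'
    · exact ih h.2 hp hl h' Yhat
    · exact t2Cell_sound hn h.1 hp hl h' h2 Yhat

def t2All (lhi : ℚ) : ℕ → List (List (ℕ × ℕ × ℕ × ℕ × Bool × List ℕ)) → Bool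
  | _, [] => true
  | n, t :: rest => t2Row n lhi t && t2All lhi (n+1) rest

theorem t2All_sound (hn : 1 ≤ n) {lhi : ℚ} (t : List (List (ℕ × ℕ × ℕ × ℕ × Bool × List ℕ))) : ∀ n0 : ℕ,
    t2All lhi n0 t = true → n0 ≤ n → n < n0 + t.length →
    p ∈ Set.Ioc (0:ℝ) 1 → 0 < lam → lam ≤ lhi →
    ∀ (Yhat : (Fin n → Fin n → Bool × ℝ) → Fin n → Fin n → ℝ),
    Goal2 n p lam Yhat ((1/(4*(n:ℝ))) * Real.exp (-2*lam^2*(4*lam^2 + 1)*p*(n:ℝ))) := by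
  induction t with
  | nil => intro n0 _ h1 h2; simp at h2; omega
  | cons a t ih =>
    intro n0 h h1 h2 hp hl hl2 Yhat
    simp only [t2All, Bool.and_eq_true] at h
    rcases Nat.eq_or_lt_of_le h1 with rfl | h1
    · exact t2Row_sound hn _ h.1 hp hl hl2 Yhat
    · exact ih (n0+1) h.2 h1 (by simp only [List.length_cons] at h2; omega) hp hl hl2 Yhat

def tab2 : List (List (ℕ × ℕ × ℕ × ℕ × Bool × List ℕ)) := [
  [(366, 1, 101, 15, true, [16, 29, 39, 40]), (306, 1, 101, 11, true, [22, 32, 37, 39, 40]), (270, 2, 74, 16, true, [27, 37, 40]), (204, 2, 66, 12, true, [34, 40]), (0, 3, 50, 11, true, [40])],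
  [(354, 1, 101, 15, true, [18, 32, 40]), (288, 1, 85, 11, true, [24, 35, 40]), (216, 2, 70, 14, true, [32, 40]), (0, 3, 52, 13, true, [40])],
  [(372, 1, 79, 16, false, [15, 30, 40]), (288, 1, 90, 12, true, [24, 35, 40]), (216, 2, 70, 14, true, [32, 40]), (0, 3, 52, 13, true, [40])],
  [(384, 1, 71, 17, false, [13, 28, 40]), (294, 1, 73, 14, false, [22, 34, 40]), (216, 2, 54, 14, false, [31, 40]), (0, 3, 52, 13, true, [40])],
  [(306, 1, 79, 16, false, [18, 29, 36, 40]), (216, 2, 58, 15, false, [29, 38, 40]), (0, 3, 34, 12, false, [40])],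
  [(300, 1, 79, 16, false, [18, 29, 36, 40]), (222, 2, 49, 15, false, [30, 40]), (0, 3, 36, 12, false, [40])],
  [(306, 1, 71, 17, false, [15, 26, 34, 40]), (228, 2, 45, 16, false, [28, 40]), (0, 3, 32, 13, false, [40])],
  [(330, 1, 71, 17, false, [15, 29, 40]), (228, 1, 47, 14, false, [24, 35, 40]), (0, 3, 32, 13, false, [40])],
  [(336, 1, 71, 17, false, [15, 30, 40]), (228, 1, 54, 13, false, [24, 35, 40]), (0, 3, 32, 13, false, [40])],
  [(336, 1, 71, 17, false, [15, 30, 40]), (228, 1, 49, 14, false, [23, 35, 40]), (0, 3, 27, 14, false, [40])],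
  [(342, 1, 65, 18, false, [12, 26, 40]), (228, 1, 51, 14, false, [23, 34, 40]), (0, 3, 32, 13, false, [40])],
  [(330, 1, 71, 17, false, [15, 30, 40]), (222, 1, 43, 15, false, [22, 34, 40]), (0, 3, 25, 14, false, [40])],
  [(306, 1, 65, 18, false, [12, 23, 33, 40]), (222, 2, 45, 16, false, [26, 40]), (0, 3, 25, 14, false, [40])],
  [(330, 1, 65, 18, false, [12, 25, 40]), (222, 1, 43, 15, false, [22, 34, 40]), (0, 3, 28, 13, false, [40])],
  [(324, 1, 71, 17, false, [14, 28, 40]), (216, 1, 41, 15, false, [22, 34, 40]), (0, 3, 23, 14, false, [40])],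
  [(324, 1, 71, 17, false, [14, 27, 40]), (216, 1, 41, 15, false, [21, 33, 40]), (0, 3, 23, 14, false, [40])],
  [(318, 1, 65, 18, false, [11, 23, 35, 40]), (210, 1, 39, 15, false, [21, 33, 40]), (0, 3, 21, 14, false, [40])],
  [(318, 1, 65, 18, false, [11, 22, 34, 40]), (210, 1, 39, 15, false, [21, 33, 40]), (0, 3, 21, 14, false, [40])],
  [(318, 1, 65, 18, false, [11, 22, 34, 40]), (210, 1, 39, 15, false, [21, 33, 40]), (0, 3, 21, 14, false, [40])],
  [(312, 1, 65, 18, false, [11, 22, 33, 40]), (210, 1, 35, 16, false, [20, 32, 40]), (0, 4, 23, 15, false, [40])],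
  [(312, 1, 65, 18, false, [11, 22, 33, 40]), (210, 1, 35, 16, false, [19, 32, 40]), (0, 4, 23, 15, false, [40])],
  [(306, 1, 65, 18, false, [11, 21, 31, 40]), (204, 1, 33, 16, false, [20, 32, 40]), (0, 3, 19, 14, false, [40])],
  [(306, 1, 65, 18, false, [10, 20, 30, 40]), (204, 1, 36, 15, false, [20, 32, 40]), (0, 4, 20, 15, false, [40])],
  [(306, 1, 65, 18, false, [10, 20, 30, 40]), (204, 1, 36, 15, false, [20, 32, 40]), (0, 4, 20, 15, false, [40])],
  [(306, 1, 65, 18, false, [10, 20, 30, 40]), (204, 1, 36, 15, false, [20, 32, 40]), (0, 4, 20, 15, false, [40])],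
  [(312, 1, 65, 18, false, [10, 20, 31, 40]), (198, 1, 35, 16, false, [18, 29, 36, 40]), (0, 3, 19, 13, false, [40])],
  [(312, 1, 65, 18, false, [10, 20, 31, 40]), (198, 1, 35, 16, false, [18, 29, 36, 40]), (0, 4, 18, 15, false, [40])],
  [(312, 1, 65, 18, false, [10, 20, 30, 40]), (198, 1, 37, 15, false, [19, 30, 36, 40]), (0, 4, 18, 15, false, [40])],
  [(312, 1, 65, 18, false, [9, 18, 28, 40]), (198, 1, 37, 15, false, [18, 29, 36, 40]), (0, 4, 18, 15, false, [40])],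
  [(300, 1, 65, 18, false, [9, 17, 25, 33, 40]), (192, 1, 29, 17, false, [17, 28, 35, 40]), (0, 4, 17, 15, false, [40])],
  [(300, 1, 65, 18, false, [9, 17, 25, 33, 40]), (192, 1, 29, 17, false, [17, 28, 35, 40]), (0, 4, 17, 15, false, [40])],
  [(300, 1, 65, 18, false, [9, 17, 25, 33, 40]), (192, 1, 32, 16, false, [18, 29, 36, 40]), (0, 4, 17, 15, false, [40])],
  [(354, 1, 65, 18, false, [9, 22, 40]), (264, 1, 44, 17, false, [13, 26, 40]), (186, 2, 25, 17, false, [23, 40]), (0, 4, 15, 15, false, [40])],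
  [(354, 1, 65, 18, false, [9, 22, 40]), (264, 1, 44, 17, false, [13, 26, 40]), (186, 2, 25, 17, false, [23, 40]), (0, 4, 15, 15, false, [40])],
  [(354, 1, 65, 18, false, [9, 22, 40]), (264, 1, 44, 17, false, [13, 26, 40]), (186, 2, 25, 17, false, [23, 40]), (0, 4, 15, 15, false, [40])],
  [(300, 1, 65, 18, false, [8, 16, 24, 32, 40]), (186, 1, 29, 17, false, [16, 26, 32, 37, 40]), (0, 4, 15, 15, false, [40])],
  [(294, 1, 65, 18, false, [8, 15, 22, 28, 35, 40]), (186, 1, 30, 16, false, [17, 28, 35, 40]), (0, 4, 15, 15, false, [40])],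
  [(348, 1, 60, 19, false, [6, 15, 29, 40]), (258, 1, 42, 17, false, [13, 26, 40]), (180, 2, 26, 16, false, [24, 40]), (0, 4, 14, 15, false, [40])],
  [(342, 1, 60, 19, false, [6, 14, 26, 40]), (252, 1, 40, 17, false, [13, 26, 40]), (180, 2, 22, 17, false, [23, 40]), (0, 4, 14, 15, false, [40])],
  [(342, 1, 60, 19, false, [6, 14, 26, 40]), (252, 1, 40, 17, false, [13, 26, 40]), (180, 2, 22, 17, false, [23, 40]), (0, 4, 14, 15, false, [40])],
  [(342, 1, 60, 19, false, [6, 14, 26, 40]), (252, 1, 40, 17, false, [13, 26, 40]), (180, 2, 22, 17, false, [23, 40]), (0, 4, 14, 15, false, [40])],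
  [(336, 1, 60, 19, false, [6, 14, 25, 40]), (252, 1, 38, 17, false, [13, 27, 40]), (180, 2, 22, 17, false, [23, 40]), (0, 4, 15, 14, false, [40])],
  [(336, 1, 60, 19, false, [6, 14, 25, 40]), (246, 1, 38, 17, false, [13, 26, 40]), (174, 2, 21, 17, false, [23, 40]), (0, 4, 13, 15, false, [40])],
  [(330, 1, 65, 18, false, [8, 17, 29, 40]), (246, 1, 37, 17, false, [13, 26, 40]), (174, 2, 21, 17, false, [23, 40]), (0, 4, 13, 15, false, [40])],
  [(330, 1, 65, 18, false, [7, 16, 27, 40]), (246, 1, 37, 17, false, [13, 26, 40]), (174, 2, 23, 16, false, [23, 40]), (0, 4, 14, 14, false, [40])],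
  [(330, 1, 65, 18, false, [7, 16, 27, 40]), (246, 1, 37, 17, false, [13, 26, 40]), (174, 2, 23, 16, false, [23, 40]), (0, 4, 14, 14, false, [40])],
  [(342, 1, 60, 19, false, [6, 14, 26, 40]), (264, 1, 37, 18, false, [11, 24, 40]), (168, 2, 25, 17, false, [20, 33, 40]), (0, 4, 12, 15, false, [40])],
  [(342, 1, 60, 19, false, [6, 14, 26, 40]), (240, 1, 37, 18, false, [10, 20, 30, 40]), (168, 2, 21, 16, false, [24, 40]), (0, 4, 12, 15, false, [40])],
  [(342, 1, 60, 19, false, [6, 14, 26, 40]), (240, 1, 37, 18, false, [10, 20, 30, 40]), (168, 2, 21, 16, false, [24, 40]), (0, 4, 12, 15, false, [40])],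
  [(342, 1, 60, 19, false, [5, 12, 23, 40]), (240, 1, 37, 18, false, [10, 20, 30, 40]), (168, 2, 21, 16, false, [23, 40]), (0, 4, 13, 14, false, [40])],
  [(336, 1, 65, 18, false, [7, 16, 28, 40]), (234, 1, 38, 17, false, [12, 22, 32, 40]), (162, 2, 20, 16, false, [24, 40]), (0, 4, 11, 15, false, [40])],
  [(336, 1, 65, 18, false, [7, 16, 28, 40]), (234, 1, 38, 17, false, [12, 22, 32, 40]), (162, 2, 20, 16, false, [24, 40]), (0, 4, 11, 15, false, [40])],
  [(336, 1, 65, 18, false, [7, 16, 28, 40]), (234, 1, 38, 17, false, [11, 21, 31, 40]), (162, 2, 20, 16, false, [23, 40]), (0, 4, 11, 15, false, [40])],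
  [(336, 1, 65, 18, false, [7, 15, 26, 40]), (234, 1, 38, 17, false, [11, 21, 31, 40]), (162, 2, 20, 16, false, [23, 40]), (0, 4, 11, 15, false, [40])],
  [(336, 1, 65, 18, false, [7, 15, 26, 40]), (234, 1, 38, 17, false, [11, 21, 31, 40]), (162, 2, 20, 16, false, [23, 40]), (0, 4, 12, 14, false, [40])],
  [(348, 1, 60, 19, false, [5, 13, 25, 40]), (252, 1, 39, 18, false, [9, 19, 30, 40]), (156, 2, 22, 17, false, [20, 32, 40]), (0, 4, 9, 16, false, [40])],
  [(348, 1, 60, 19, false, [5, 12, 23, 40]), (252, 1, 39, 18, false, [9, 18, 28, 40]), (156, 2, 22, 17, false, [20, 32, 40]), (0, 4, 10, 15, false, [40])]]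

set_option maxRecDepth 100000 in
theorem tab2_ok : t2All (420/1000) 3 tab2 = true := by decide +kernel

end GLB

end

section
open MeasureTheory
namespace GLB

/-! ### Part (i): small `n` and large `lam` -/

def rsq (n : ℕ) (p : ℚ) : ℚ :=
  qsum (fun k => (n.choose k : ℚ) * (1/2)^n * (1 - sfq (1/2) p ((n-k)^2) * sfq (1/2) p (k^2))) (n+1)

noncomputable def RSr (n : ℕ) (p : ℝ) : ℝ := ∑ k ∈ Finset.range (n+1), (n.choose k : ℝ) * (1/2)^n *
      (1 - Sfac (1/2) p ((n-k)^2) * Sfac (1/2) p (k^2))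

lemma rsq_cast (n : ℕ) (p : ℚ) : (rsq n p : ℝ) = RSr n p := by
  unfold rsq RSr
  rw [qsum_cast]
  refine Finset.sum_congr rfl fun k _ => ?_
  push_cast; rw [sfq_cast, sfq_cast]; push_cast; rfl

lemma RSr_anti {n : ℕ} {p q : ℝ} (hp : 0 ≤ p) (hpq : p ≤ q) (hq : q ≤ 1) : RSr n q ≤ RSr n p := by
  unfold RSr
  refine Finset.sum_le_sum fun k _ => mul_le_mul_of_nonneg_left ?_ (by positivity)
  have h : ∀ m, Sfac (1/2) p m ≤ Sfac (1/2) q m := fun m =>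
    Sfac_mono le_rfl (by norm_num) hp hpq hq m
  have h0 : ∀ m, 0 ≤ Sfac (1/2) p m := fun m =>
    (Sfac_mem le_rfl (by norm_num) hp (hpq.trans hq) m).1
  have := mul_le_mul (h ((n-k)^2)) (h (k^2)) (h0 _) ((h0 _).trans (h _))
  linarith

variable {n : ℕ} {p lam : ℝ}

theorem RS_chain {llo : ℚ} {ps : List ℕ} (hq0 : 0 ≤ llo)
    (h : chainOk (fun p => 2 * rsq n p) (cq llo * n / 40) 0 ps = true)
    (hp : p ∈ Set.Ioc (0:ℝ) 1) (hl : 0 < lam) (h1 : (llo:ℝ) ≤ lam) (h2 : lam ≤ 1/2)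
    (Yhat : (Fin n → Fin n → Bool × ℝ) → Fin n → Fin n → ℝ) :
    Goal01 n p lam Yhat ((1/2) * Real.exp (-2*lam^2*(4*lam^2 + 1)*p*(n:ℝ))) := by
  refine RS2 hp hl h2 Yhat _ ?_
  change _ ≤ RSr n p
  have := chain_sound0 _ (fun p => 2 * RSr n p) ?_ (cq llo * n / 40) ?_
    (2*lam^2*(1+4*lam^2)*n) ?_ ps h p hp.1 hp.2
  · have e : -2*lam^2*(4*lam^2 + 1)*p*(n:ℝ) = -(2*lam^2*(1+4*lam^2)*n*p) := by ring
    rw [e]; linarith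
  · intro q p' hp' hpq hq
    have an := RSr_anti (n := n) hp'.le hpq hq
    push_cast [rsq_cast]
    linarith
  · have : 0 ≤ cq llo := by unfold cq; positivity
    positivity
  · have := cq_le hq0 h1
    push_cast
    have hn : (0:ℝ) ≤ n := Nat.cast_nonneg n
    nlinarith

theorem i_small (h1 : 1 ≤ n) (h3 : n ≤ 3)
    (hp : p ∈ Set.Ioc (0:ℝ) 1) (hl : 0 < lam) (h2 : lam ≤ 1/2)
    (Yhat : (Fin n → Fin n → Bool × ℝ) → Fin n → Fin n → ℝ) :
    Goal01 n p lam Yhat ((1/2) * Real.exp (-2*lam^2*(4*lam^2 + 1)*p*(n:ℝ))) := by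
  have hh := half_exp_le (arg_nonpos (n := n) (lam := lam) hp)
  by_cases hc : n = 1
  · subst hc
    refine RS2 hp hl h2 Yhat _ (hh.trans ?_)
    simp [Finset.sum_range_succ, Sfac_one, Sfac]
    norm_num
    have : eta (1/2) = 1/2 := by unfold eta; norm_num
    norm_num [this]
    linarith
  rcases le_or_gt lam (1/3) with h | h
  · refine RSK hp hl 1 (by norm_num; linarith) Yhat _ (hh.trans ?_)
    interval_cases n
    · omega
    · norm_num
    · norm_num
  · have h' : ((333/1000:ℚ):ℝ) ≤ lam := by push_cast; linarith
    interval_cases n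
    · omega
    · exact RS_chain (ps := [4,8,12,16,20,24,28,32,36,40]) (by norm_num) (by decide +kernel) hp hl h' h2 Yhat
    · exact RS_chain (ps := [4,8,12,16,20,24,28,32,36,40]) (by norm_num) (by decide +kernel) hp hl h' h2 Yhat

lemma exp_neg_le {y : ℝ} (hy : 0 ≤ y) : Real.exp (-y) ≤ 1 - y + y^2/2 := by
  rw [Real.exp_neg, inv_le_comm₀ (Real.exp_pos y) (by nlinarith [sq_nonneg (y-1)])]
  refine le_trans ?_ (Real.quadratic_le_exp_of_nonneg hy)
  rw [inv_le_iff_one_le_mul₀ (by nlinarith [sq_nonneg (y-1)])]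
  nlinarith [sq_nonneg (y^2)]

lemma exp_cubic {y : ℝ} (hy : 0 ≤ y) : 1 + y + y^2/2 + y^3/6 ≤ Real.exp y := by
  have h := Real.sum_le_exp_of_nonneg hy 4
  simp only [Finset.sum_range_succ, Finset.sum_range_zero, Nat.factorial] at h
  norm_num at h; linarith

theorem i_S (hn : 4 ≤ n) (hp : p ∈ Set.Ioc (0:ℝ) 1) (hl : 433/1000 ≤ lam) (h2 : lam ≤ 1/2)
    (hz : 1 ≤ p * n)
    (Yhat : (Fin n → Fin n → Bool × ℝ) → Fin n → Fin n → ℝ) :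
    Goal01 n p lam Yhat ((1/2) * Real.exp (-2*lam^2*(4*lam^2 + 1)*p*(n:ℝ))) := by
  obtain ⟨m, rfl⟩ : ∃ m, n = m + 1 := ⟨n-1, by omega⟩
  refine S01 hp (by linarith) h2 Yhat _ ?_
  obtain ⟨hp0, hp1⟩ := hp
  have hx : Real.exp (-(71/100*p)) ≤ 1 - p/2 := by
    rw [Real.exp_neg]
    have h := exp_cubic (y := 71/100*p) (by positivity)
    have hx0 : 0 < 1 - p/2 := by linarith
    rw [inv_le_iff_one_le_mul₀ (Real.exp_pos _)]
    refine le_trans ?_ (mul_le_mul_of_nonneg_left h hx0.le)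
    nlinarith [pow_pos hp0 2, pow_pos hp0 3, mul_nonneg (pow_pos hp0 1).le (sub_nonneg.2 hp1), mul_nonneg (pow_pos hp0 2).le (sub_nonneg.2 hp1), mul_nonneg (pow_pos hp0 3).le (sub_nonneg.2 hp1)]
  have hB : Real.exp (-(lam*p)) ≤ 1 - lam + lam*(1-p/2)^2 := by
    refine (exp_neg_le (by positivity)).trans ?_
    nlinarith [mul_nonneg (mul_nonneg (by linarith : 0 ≤ lam) (by linarith : 0 ≤ 1/2 - lam)) (sq_nonneg p)]
  have hBm := pow_le_pow_left₀ (Real.exp_pos _).le hB m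
  have hY : (1 - lam + lam * (1-p)^2)^m ≤ (1 - lam + lam * (1-p/2)^2)^m := by
    refine pow_le_pow_left₀ ?_ ?_ m
    · nlinarith [mul_nonneg (by linarith : 0 ≤ lam) (sq_nonneg (1-p))]
    · nlinarith [mul_nonneg (by linarith : 0 ≤ lam) (by nlinarith : 0 ≤ (1-p/2)^2-(1-p)^2)]
  have hY0 : 0 ≤ (1 - lam + lam * (1-p)^2)^m := pow_nonneg (by nlinarith [mul_nonneg (by linarith : 0 ≤ lam) (sq_nonneg (1-p))]) _
  have h3 : (1 - 2*lam) * (1 - p) * (1 - lam + lam * (1-p)^2)^m ≤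
      (1 - 2*lam) * (1 - p/2) * (1 - lam + lam * (1-p/2)^2)^m := by
    refine mul_le_mul ?_ hY hY0 (mul_nonneg (by linarith) (by linarith))
    exact mul_le_mul_of_nonneg_left (by linarith) (by linarith)
  have h4 : lam * (Real.exp (-(71/100*p)) * Real.exp (-(lam*p))^m) ≤
      lam * ((1 - p/2) * (1 - lam + lam * (1-p/2)^2)^m) :=
    mul_le_mul_of_nonneg_left (mul_le_mul hx hBm (by positivity) (by linarith)) (by linarith)
  refine le_trans ?_ (by linarith : lam * (Real.exp (-(71/100*p)) * Real.exp (-(lam*p))^m) ≤ _)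
  rw [← Real.exp_nat_mul, ← Real.exp_add]
  have hm : (3:ℝ) ≤ m := by exact_mod_cast (by omega : 3 ≤ m)
  push_cast at hz ⊢
  have hc : 223/1000 ≤ 2*lam^2*(4*lam^2+1) - lam := by nlinarith [mul_nonneg (by linarith : 0 ≤ lam - 433/1000) (by linarith : 0 ≤ lam - 433/1000), pow_le_pow_left₀ (by norm_num) hl 4, pow_le_pow_left₀ (by norm_num) hl 2]
  have hE : -2*lam^2*(4*lam^2 + 1)*p*((m:ℝ)+1) + 15375/100000 ≤ -(71/100*p) + m * -(lam*p) := by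
    have a1 := mul_le_mul_of_nonneg_right hc (by linarith : 0 ≤ p*((m:ℝ)+1))
    have a2 : p * 4 ≤ p*((m:ℝ)+1) := mul_le_mul_of_nonneg_left (by linarith) hp0.le
    have a3 := mul_le_mul_of_nonneg_right hl hp0.le
    nlinarith
  have h5 := Real.exp_le_exp.2 hE
  rw [Real.exp_add] at h5
  have h6 : (116/100:ℝ) ≤ Real.exp (15375/100000) :=
    le_trans (by norm_num) (Real.quadratic_le_exp_of_nonneg (by norm_num))
  have h7 := Real.exp_pos (-2*lam^2*(4*lam^2 + 1)*p*((m:ℝ)+1))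
  have h8 := mul_le_mul_of_nonneg_left h6 h7.le
  have h9 : lam * (Real.exp (-2*lam^2*(4*lam^2 + 1)*p*((m:ℝ)+1)) * (116/100)) ≤ lam * _ :=
    mul_le_mul_of_nonneg_left (h8.trans h5) (by linarith)
  nlinarith

lemma c_lb (hl : 433/1000 ≤ lam) : 656/1000 ≤ 2*lam^2*(4*lam^2+1) := by
  nlinarith [pow_le_pow_left₀ (by norm_num) hl 4, pow_le_pow_left₀ (by norm_num) hl 2]

theorem i_AB6 (hn : 6 ≤ n) (hp : p ∈ Set.Ioc (0:ℝ) 1) (hl : 433/1000 ≤ lam) (h2 : lam ≤ 1/2)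
    (hz : p * n ≤ 1)
    (Yhat : (Fin n → Fin n → Bool × ℝ) → Fin n → Fin n → ℝ) :
    Goal01 n p lam Yhat ((1/2) * Real.exp (-2*lam^2*(4*lam^2 + 1)*p*(n:ℝ))) := by
  have hl0 : 0 < lam := by linarith
  refine AB01 hp hl0 (b := 1/2) (w := 1) (by norm_num) le_rfl (by norm_num) le_rfl (by nlinarith) h2 Yhat _ ?_
  change _ ≤ ABr n (1/2) 1 p
  obtain ⟨hp0, hp1⟩ := hp
  have hσ1 : (1-p)^2 ≤ 1 := pow_le_one₀ (by linarith) (by linarith)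
  refine le_trans ?_ (ABr_closed (v := 1/2) (σ := (1-p)^2) (by norm_num) le_rfl (by norm_num) le_rfl hp0.le hp1
    (by norm_num) (by norm_num) (sq_nonneg _) hσ1
    (fun k hk => Sfac_w1 k hk))
  have hV : ((1/2)*(1-p)^2 + (1-1/2)*(1/2) : ℝ)^n ≤ (3/4)^n * (1 - 1/2 + 1/2*(1-p)^2)^n := by
    rw [← mul_pow]
    exact pow_le_pow_left₀ (by positivity) (by linarith) n
  have hZ : Real.exp (-(p*n)) ≤ (1 - 1/2 + 1/2*(1-p)^2)^n := by
    have := pow_le_pow_left₀ (Real.exp_pos _).le (exp_neg_le hp0.le) n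
    rw [← Real.exp_nat_mul] at this
    refine le_trans (le_of_eq ?_) (this.trans (le_of_eq ?_))
    · congr 1; ring
    · congr 1; ring
  have h34 : (3/4:ℝ)^n ≤ 178/1000 :=
    (pow_le_pow_of_le_one (by norm_num) (by norm_num) hn).trans (by norm_num)
  have h12 : (1-1/2:ℝ)^n ≤ 1/64 :=
    (pow_le_pow_of_le_one (by norm_num) (by norm_num) hn).trans (by norm_num)
  have hW : (0:ℝ) ≤ ((1-1/2)*(1/2))^n := by positivity
  set z := p * n with hzd
  have hz0 : 0 ≤ z := by positivity
  have e1 : Real.exp z ≤ 272/100 := (Real.exp_le_exp.2 hz).trans (by have := Real.exp_one_lt_d9; linarith)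
  have e2 : Real.exp (344/1000*z) ≤ 153/100 := by
    refine (Real.exp_le_exp.2 (by linarith : 344/1000*z ≤ 344/1000)).trans ?_
    have h := Real.add_one_le_exp (-(344/1000:ℝ))
    rw [Real.exp_neg, le_inv_comm₀ (by norm_num) (Real.exp_pos _)] at h
    exact h.trans (by norm_num)
  have e3 : Real.exp (-2*lam^2*(4*lam^2 + 1)*p*(n:ℝ)) ≤ Real.exp (-z) * Real.exp (344/1000*z) := by
    rw [← Real.exp_add]
    apply Real.exp_le_exp.2
    have := mul_le_mul_of_nonneg_right (c_lb hl) hz0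
    rw [hzd] at *
    nlinarith
  have e4 : Real.exp (-z) * Real.exp z = 1 := by rw [← Real.exp_add]; simp
  have hE := Real.exp_pos (-z)
  set Z := (1 - 1/2 + 1/2*(1-p)^2)^n
  have b1 : (3/4)^n * Z ≤ 178/1000 * Z := mul_le_mul_of_nonneg_right h34 (hE.le.trans hZ)
  nlinarith

theorem AB_chain45 {ps : List ℕ} (hn : 1 ≤ n)
    (h : chainOk (fun p => 2 * abq n (1/2) 1 (p/n)) (cq (433/1000) / 40) 0 ps = true)
    (hp : p ∈ Set.Ioc (0:ℝ) 1) (hl : 433/1000 ≤ lam) (h2 : lam ≤ 1/2) (hz : p * n ≤ 1)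
    (Yhat : (Fin n → Fin n → Bool × ℝ) → Fin n → Fin n → ℝ) :
    Goal01 n p lam Yhat ((1/2) * Real.exp (-2*lam^2*(4*lam^2 + 1)*p*(n:ℝ))) := by
  have hl0 : 0 < lam := by linarith
  refine AB01 hp hl0 (b := 1/2) (w := 1) (by norm_num) le_rfl (by norm_num) le_rfl (by nlinarith) h2 Yhat _ ?_
  change _ ≤ ABr n (1/2) 1 p
  have hn0 : (0:ℝ) < n := by exact_mod_cast hn
  have hn1 : (1:ℝ) ≤ n := by exact_mod_cast hn
  have := chain_sound0 _ (fun p => 2 * ABr n (1/2) 1 (p/n)) ?_ (cq (433/1000) / 40) ?_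
    (2*lam^2*(1+4*lam^2)) ?_ ps h (p*n) (mul_pos hp.1 hn0) hz
  · have e : -2*lam^2*(4*lam^2 + 1)*p*(n:ℝ) = -(2*lam^2*(1+4*lam^2)*(p*n)) := by ring
    rw [e]
    simp only [mul_div_cancel_right₀ p hn0.ne'] at this
    linarith
  · intro q p' hp' hpq hq
    have an := ABr_anti (n := n) (b := 1/2) (w := 1) (p := p'/n) (q := (q:ℝ)/n) (by norm_num) le_rfl (by norm_num) le_rfl
      (by positivity) (by gcongr) (by rw [div_le_one hn0]; linarith)
    have := abq_cast n (1/2) 1 (q/n)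
    push_cast at this ⊢
    linarith
  · unfold cq; norm_num
  · have := cq_le (l := 433/1000) (lam := lam) (by norm_num) (by push_cast; linarith)
    push_cast at this ⊢
    linarith

theorem i_big (hn : 4 ≤ n) (hp : p ∈ Set.Ioc (0:ℝ) 1) (hl : 433/1000 ≤ lam) (h2 : lam ≤ 1/2)
    (Yhat : (Fin n → Fin n → Bool × ℝ) → Fin n → Fin n → ℝ) :
    Goal01 n p lam Yhat ((1/2) * Real.exp (-2*lam^2*(4*lam^2 + 1)*p*(n:ℝ))) := by
  rcases le_total 1 (p*n) with hz | hz
  · exact i_S hn hp hl h2 hz Yhat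
  by_cases h6 : 6 ≤ n
  · exact i_AB6 h6 hp hl h2 hz Yhat
  have : n ≤ 5 := by omega
  interval_cases n
  · exact AB_chain45 (ps := [4,8,12,16,20,24,28,30,32,34,36,38,40]) (by norm_num) (by decide +kernel) hp hl h2 hz Yhat
  · exact AB_chain45 (ps := [4,8,12,16,20,24,28,30,32,34,36,38,40]) (by norm_num) (by decide +kernel) hp hl h2 hz Yhat

end GLB

end

section
open MeasureTheory
namespace GLB

/-! ### Large `n` -/

variable {n : ℕ} {p lam : ℝ}

lemma one_sub_pow_ge {a N : ℝ} {k : ℕ} (ha : 0 ≤ a) (hN : a < N) (hk : (k:ℝ) ≤ N - a) :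
    Real.exp (-a) ≤ (1 - a/N)^k := by
  have hN0 : 0 < N := by linarith
  have h1 : Real.exp (-(a/(N-a))) ≤ 1 - a/N := by
    rw [Real.exp_neg]
    have h := Real.add_one_le_exp (a/(N-a))
    have h2 : 0 < N - a := by linarith
    have e : a/(N-a) + 1 = N/(N-a) := by field_simp; ring
    rw [e] at h
    refine (inv_anti₀ (by positivity) h).trans (le_of_eq ?_)
    rw [inv_div]; field_simp
  refine le_trans ?_ (pow_le_pow_left₀ (Real.exp_pos _).le h1 k)
  rw [← Real.exp_nat_mul]
  apply Real.exp_le_exp.2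
  have h2 : 0 < N - a := by linarith
  have : (k:ℝ) * (a/(N-a)) ≤ a := by
    rw [mul_div_assoc', div_le_iff₀ h2]; nlinarith
  linarith

lemma exp_neg_two : (1353/10000:ℝ) ≤ Real.exp (-2) := by
  rw [Real.exp_neg, show (2:ℝ) = ((2:ℕ):ℝ) * 1 by norm_num, Real.exp_nat_mul]
  have h := Real.exp_one_lt_d9
  have h0 := Real.exp_pos 1
  rw [le_inv_comm₀ (by norm_num) (by positivity)]
  nlinarith

lemma exp_neg_four : Real.exp (-4 + 8/60) ≤ 212/10000 := by
  have h1 : Real.exp (8/60) ≤ 60/52 := by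
    have h := Real.add_one_le_exp (-(8/60:ℝ))
    rw [Real.exp_neg, le_inv_comm₀ (by norm_num) (Real.exp_pos _)] at h
    exact h.trans (by norm_num)
  have h2 : Real.exp (-4) ≤ 1/54 := by
    rw [Real.exp_neg, show (4:ℝ) = ((4:ℕ):ℝ) * 1 by norm_num, Real.exp_nat_mul]
    have h := Real.exp_one_gt_d9
    rw [inv_le_comm₀ (by positivity) (by norm_num)]
    have := pow_le_pow_left₀ (by norm_num) h.le 4
    refine le_trans ?_ this
    norm_num
  have h54 : Real.exp (-4) ≤ 1/(5459/100) := by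
    rw [Real.exp_neg, show (4:ℝ) = ((4:ℕ):ℝ) * 1 by norm_num, Real.exp_nat_mul]
    have h := Real.exp_one_gt_d9
    rw [inv_le_comm₀ (by positivity) (by norm_num)]
    have := pow_le_pow_left₀ (by norm_num) h.le 4
    refine le_trans ?_ this
    norm_num
  rw [Real.exp_add]
  refine (mul_le_mul h54 h1 (Real.exp_pos _).le (by norm_num)).trans (by norm_num)

theorem i_large_a (hn : 60 ≤ n) (hp : p ∈ Set.Ioc (0:ℝ) 1) (hl : 0 < lam) (h2 : lam ≤ 1/2)
    (hs : lam^2 * n ≤ 9/10)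
    (Yhat : (Fin n → Fin n → Bool × ℝ) → Fin n → Fin n → ℝ) :
    Goal01 n p lam Yhat ((1/2) * Real.exp (-2*lam^2*(4*lam^2 + 1)*p*(n:ℝ))) := by
  have hh := half_exp_le (arg_nonpos (n := n) (lam := lam) hp)
  have hN : (60:ℝ) ≤ n := by exact_mod_cast hn
  have hN0 : (0:ℝ) < n := by linarith
  obtain ⟨u, hu⟩ : ∃ u : ℝ, u = 1/(n:ℝ) := ⟨_, rfl⟩
  have hun : u * n = 1 := by rw [hu]; field_simp
  have hu0 : 0 < u := by rw [hu]; positivity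
  have hu1 : u ≤ 1/60 := by rw [hu]; exact one_div_le_one_div_of_le (by norm_num) hN
  refine P01 hp hl (b := 2*u) (by linarith) (by linarith) ?_ (by linarith) Yhat _ (hh.trans ?_)
  · have : lam^2 = (lam^2*n)*u := by rw [mul_assoc, mul_comm (n:ℝ) u, hun, mul_one]
    rw [this]; nlinarith
  · have e1 : (n:ℝ) * (2*u) = 2 := by linarith
    have a1 : Real.exp (-2) ≤ (1 - 2/(n:ℝ))^(n-2) := by
      refine one_sub_pow_ge (by norm_num) (by linarith) ?_
      rw [Nat.cast_sub (by omega)]; norm_num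
    have e2 : 1 - 2/(n:ℝ) = 1 - 2*u := by rw [hu]; ring
    rw [e2] at a1
    have t1 : 3 * (n * (2*u * (1-2*u)^(n-1))) = 6 * ((1-2*u)*(1-2*u)^(n-2)) := by
      rw [← pow_succ', show n - 2 + 1 = n - 1 by omega]
      linear_combination 3 * (1-2*u)^(n-1) * e1
    have t2 : 3 * (n * (n-1) * (2*u * (2*u * (1 - 2*(2*u))^(n-2)))) ≤ 12 * (1-4*u)^(n-2) := by
      have hq : 0 ≤ (1-4*u)^(n-2) := pow_nonneg (by linarith) _
      have : 3 * (n * (n-1) * (2*u * (2*u * (1 - 2*(2*u))^(n-2)))) = 3 * ((n*(2*u)) * (n*(2*u) - 2*u)) * (1-4*u)^(n-2) := by ring_nf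
      rw [this, e1]
      nlinarith
    have t3 : 3 * (n * (2*u * (1 - 2*u - (1-3*(2*u))/4)^(n-1))) ≤ 6/10000 := by
      have h3 : (1 - 2*u - (1-3*(2*u))/4)^(n-1) ≤ 1/10000 := by
        refine (pow_le_pow_left₀ (by linarith) (by linarith : _ ≤ (3/4:ℝ)) _).trans ?_
        exact (pow_le_pow_of_le_one (by norm_num) (by norm_num) (by omega : 59 ≤ n-1)).trans (by norm_num)
      have : 3 * (n * (2*u * (1 - 2*u - (1-3*(2*u))/4)^(n-1))) = 3 * (n*(2*u)) * (1 - 2*u - (1-3*(2*u))/4)^(n-1) := by ring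
      rw [this, e1]; linarith
    have t4 : (1-4*u)^(n-2) ≤ 212/10000 := by
      refine le_trans ?_ exp_neg_four
      have h := pow_le_pow_left₀ (by linarith) (by have := Real.add_one_le_exp (-(4*u)); linarith : 1 - 4*u ≤ Real.exp (-(4*u))) (n-2)
      refine h.trans ?_
      rw [← Real.exp_nat_mul]
      apply Real.exp_le_exp.2
      rw [Nat.cast_sub (by omega)]; push_cast
      nlinarith
    rw [t1]
    have := exp_neg_two.trans a1
    nlinarith

/-! the second regime -/

lemma b_exists (hl : 0 < lam) (h2 : lam ≤ 433/1000) :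
    ∃ b : ℝ, 0 < b ∧ b ≤ 1/2 ∧ b*(1-b) = 4/3*lam^2 := by
  have hl2 : lam^2 ≤ (433/1000)^2 := pow_le_pow_left₀ hl.le h2 2
  have h0 : 0 ≤ 1 - 16/3*lam^2 := by nlinarith
  have hs := Real.sq_sqrt h0
  have hs0 := Real.sqrt_nonneg (1 - 16/3*lam^2)
  refine ⟨(1 - Real.sqrt (1 - 16/3*lam^2))/2, ?_, by linarith, by nlinarith⟩
  have : Real.sqrt (1 - 16/3*lam^2) < 1 := by
    rw [Real.sqrt_lt' one_pos]; nlinarith [pow_pos hl 2]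
  linarith

lemma c_eq {b : ℝ} (h : b*(1-b) = 4/3*lam^2) (n : ℕ) (p : ℝ) :
    -2*lam^2*(4*lam^2 + 1)*p*(n:ℝ) = n * -(3/2*(b*(1-b))*(1+3*(b*(1-b)))*p) := by
  rw [h]; ring

/-- lower bound for `Z`, small `b` -/
lemma Z_small {b : ℝ} (hb : 0 < b) (hb2 : b ≤ 1/4) (hp0 : 0 < p) (hp1 : p ≤ 1) :
    Real.exp (-(3/2*(b*(1-b))*(1+3*(b*(1-b)))*p) + b*(p/2+p^2/4)) ≤ 1 - b + b*(1-p/2)^2 := by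
  obtain ⟨y, hy⟩ : ∃ y : ℝ, y = b*(p-p^2/4) := ⟨_, rfl⟩
  have hg : 0 ≤ p - p^2/4 := by nlinarith
  have hg1 : p - p^2/4 ≤ 1 := by nlinarith
  have y0 : 0 ≤ y := by rw [hy]; positivity
  have y1 : y ≤ 1/4 := by rw [hy]; nlinarith
  have e : 1 - b + b*(1-p/2)^2 = 1 - y := by rw [hy]; ring
  rw [e]
  have hexp : Real.exp (-(y+y^2)) ≤ 1 - y := by
    rw [Real.exp_neg, inv_le_iff_one_le_mul₀ (Real.exp_pos _)]
    have h := Real.add_one_le_exp (y+y^2)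
    have h' := Real.quadratic_le_exp_of_nonneg (by positivity : 0 ≤ y+y^2)
    refine le_trans ?_ (mul_le_mul_of_nonneg_left h' (by linarith))
    nlinarith [pow_nonneg y0 3, pow_nonneg y0 2, mul_nonneg (pow_nonneg y0 2) (by linarith : 0 ≤ 1/4 - y), mul_nonneg (pow_nonneg y0 3) (by linarith : 0 ≤ 1/4 - y), mul_nonneg (pow_nonneg y0 4) (by linarith : 0 ≤ 1/4 - y)]
  refine le_trans (Real.exp_le_exp.2 ?_) hexp
  have k1 : y^2 ≤ 3/4*b^2*p := by
    have : (p-p^2/4)^2 ≤ 3/4*p := by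
      have : (p-p^2/4)^2 = p * (p*(1-p/4)^2) := by ring
      rw [this]
      have : p*(1-p/4)^2 ≤ 3/4 := by nlinarith [mul_nonneg hp0.le (sub_nonneg.2 hp1), mul_nonneg (pow_pos hp0 2).le (sub_nonneg.2 hp1)]
      nlinarith
    rw [hy, mul_pow]; nlinarith [mul_le_mul_of_nonneg_left this (sq_nonneg b)]
  have k2 : 3/2*b + 3/4*b^2 ≤ 3/2*(b*(1-b))*(1+3*(b*(1-b))) := by
    have : 9/16 ≤ (1-b)^2 := by nlinarith
    nlinarith [mul_le_mul_of_nonneg_left this (sq_nonneg b), sq_nonneg b]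
  have k3 := mul_le_mul_of_nonneg_right k2 hp0.le
  rw [hy] at k1 ⊢
  nlinarith

lemma Z_big {b : ℝ} (hb : 1/4 ≤ b) (hb2 : b ≤ 1/2) (hp0 : 0 < p) (hp1 : p ≤ 1) :
    Real.exp (-(3/2*(b*(1-b))*(1+3*(b*(1-b)))*p)) ≤ 1 - b + b*(1-p/2)^2 := by
  have h := exp_neg_le (y := b*p) (by positivity)
  have k : b ≤ 3/2*(b*(1-b))*(1+3*(b*(1-b))) := by
    have h1 : 3/16 ≤ b*(1-b) := by nlinarith
    have h2 : b/2 ≤ b*(1-b) := by nlinarith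
    nlinarith
  refine le_trans (Real.exp_le_exp.2 ?_) (h.trans ?_)
  · have := mul_le_mul_of_nonneg_right k hp0.le; linarith
  · nlinarith [mul_nonneg (mul_nonneg (by linarith : 0 ≤ b) (by linarith : 0 ≤ 1/2 - b)) (sq_nonneg p)]

lemma bern {p : ℝ} (h0 : 0 ≤ p) (h1 : p ≤ 1) (i j : ℕ) : 0 ≤ p^i*(1-p)^j :=
  mul_nonneg (pow_nonneg h0 i) (pow_nonneg (by linarith) j)

lemma poly1 (hp0 : 0 ≤ p) (hp1 : p ≤ 1) :
    1/2*(1+6/5*(1-p/2)^2) ≤ (1 + 6/5*(p/2+p^2/4) + (6/5*(p/2+p^2/4))^2/2) *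
      (6/5*(1-p/2)^2 - 1/1000*(1+6/5*(1-p/2)^2)) := by
  nlinarith [bern hp0 hp1 0 6, bern hp0 hp1 1 5, bern hp0 hp1 2 4, bern hp0 hp1 3 3, bern hp0 hp1 4 2,
    bern hp0 hp1 5 1, bern hp0 hp1 6 0]

lemma poly2 (hp0 : 0 ≤ p) (hp1 : p ≤ 1) :
    1/4 ≤ 53/80 * ((1 + 6/5*(p/2+p^2/4) + (6/5*(p/2+p^2/4))^2/2) * (1-p/2)^2) := by
  nlinarith [bern hp0 hp1 0 6, bern hp0 hp1 1 5, bern hp0 hp1 2 4, bern hp0 hp1 3 3, bern hp0 hp1 4 2,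
    bern hp0 hp1 5 1, bern hp0 hp1 6 0]

lemma one_sub_exp {y : ℝ} (hy : 0 ≤ y) : Real.exp (-y) ≤ 1/(1+y) := by
  rw [Real.exp_neg, one_div]
  exact inv_anti₀ (by linarith) (by have := Real.add_one_le_exp y; linarith)

lemma beta_lb {b : ℝ} (hb : 0 < b) (h : b*(1-b) = 4/3*lam^2) (hs : 9/10 ≤ lam^2*n) : 6/5 ≤ b * n := by
  have : b*(1-b) ≤ b := by nlinarith
  have hn : (0:ℝ) ≤ n := Nat.cast_nonneg n
  nlinarith

set_option maxHeartbeats 1000000 in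
theorem i_large_b (hn : 60 ≤ n) (hp : p ∈ Set.Ioc (0:ℝ) 1) (hl : 0 < lam) (h2 : lam ≤ 433/1000)
    (hs : 9/10 ≤ lam^2 * n)
    (Yhat : (Fin n → Fin n → Bool × ℝ) → Fin n → Fin n → ℝ) :
    Goal01 n p lam Yhat ((1/2) * Real.exp (-2*lam^2*(4*lam^2 + 1)*p*(n:ℝ))) := by
  obtain ⟨b, hb, hb2, hq⟩ := b_exists hl h2
  refine AB01 hp hl (b := b) (w := 3/4) hb hb2 (by norm_num) (by norm_num) (by nlinarith) (by linarith) Yhat _ ?_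
  change _ ≤ ABr n b (3/4) p
  obtain ⟨hp0, hp1⟩ := hp
  have hσ0 : 0 ≤ (1-p/2)^2 := sq_nonneg _
  have hσ1 : (1-p/2)^2 ≤ 1 := pow_le_one₀ (by linarith) (by linarith)
  refine le_trans ?_ (ABr_closed (v := 1/2) (σ := (1-p/2)^2) hb hb2 (by norm_num) (by norm_num) hp0.le hp1
    (by norm_num) (by norm_num) hσ0 hσ1
    (fun k hk => by
      have := Sfac_closed (w := 3/4) (by norm_num) (by norm_num) hp0.le hp1 k hk
      rw [show max (2*(3/4)-1) (1-3/4:ℝ) = 1/2 by norm_num] at this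
      exact this))
  have hβ := beta_lb hb hq hs
  have hN : (60:ℝ) ≤ n := by exact_mod_cast hn
  obtain ⟨s, hsd⟩ : ∃ s : ℝ, s = (1-p/2)^2 := ⟨_, rfl⟩
  obtain ⟨Z, hZ⟩ : ∃ Z : ℝ, Z = 1 - b + b*(1-p/2)^2 := ⟨_, rfl⟩
  have hbs : 0 ≤ b*(1-p/2)^2 := by positivity
  have hZ0 : 0 < Z := by rw [hZ]; linarith
  have hZ1 : Z ≤ 1 := by rw [hZ]; nlinarith
  have hZn : 0 < Z^n := pow_pos hZ0 n
  have hV : (b*(1-p/2)^2 + (1-b)*(1/2))^n ≤ 1/1000 * Z^n := by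
    have h1 : (b*(1-p/2)^2 + (1-b)*(1/2))^n ≤ (3/4*Z)^n := by
      refine pow_le_pow_left₀ (by nlinarith) ?_ n
      rw [hZ]; nlinarith
    rw [mul_pow] at h1
    have : (3/4:ℝ)^n ≤ 1/1000 := (pow_le_pow_of_le_one (by norm_num) (by norm_num) hn).trans (by norm_num)
    nlinarith
  have hB : (1-b)^n ≤ Real.exp (-(b*n*(1-p/2)^2)) * Z^n := by
    have h1 : 1 - b ≤ Real.exp (-(b*(1-p/2)^2)) * Z := by
      have := Real.add_one_le_exp (-(b*(1-p/2)^2))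
      nlinarith
    have := pow_le_pow_left₀ (by linarith) h1 n
    rw [mul_pow, ← Real.exp_nat_mul] at this
    refine this.trans (le_of_eq ?_)
    congr 2; ring
  have hW : 0 ≤ ((1-b)*(1/2))^n := pow_nonneg (by linarith) n
  rw [← hZ, c_eq hq n p]
  have key : Z^n * (1 - Real.exp (-(b*n*(1-p/2)^2)) - 1/1000) ≤
      Z^n - (1-b)^n - (b*(1-p/2)^2 + (1-b)*(1/2))^n + ((1-b)*(1/2))^n := by nlinarith
  refine le_trans ?_ key
  rw [← hsd]
  have s14 : 1/4 ≤ s := by rw [hsd]; nlinarith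
  rcases le_total b (1/4) with hb4 | hb4
  · have h := pow_le_pow_left₀ (Real.exp_pos _).le (Z_small hb hb4 hp0 hp1) n
    rw [← hZ, ← Real.exp_nat_mul, mul_add, Real.exp_add] at h
    have g0 : 0 ≤ p/2+p^2/4 := by positivity
    have h1 : 1 + 6/5*(p/2+p^2/4) + (6/5*(p/2+p^2/4))^2/2 ≤ Real.exp (n*(b*(p/2+p^2/4))) := by
      refine (Real.quadratic_le_exp_of_nonneg (by positivity)).trans (Real.exp_le_exp.2 ?_)
      nlinarith
    have h2 : Real.exp (-(b*n*s)) ≤ 1/(1+6/5*s) := by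
      refine le_trans (Real.exp_le_exp.2 ?_) (one_sub_exp (by positivity))
      nlinarith
    have h3 : 1/2 ≤ (1 + 6/5*(p/2+p^2/4) + (6/5*(p/2+p^2/4))^2/2) * (1 - 1/(1+6/5*s) - 1/1000) := by
      have h := poly1 hp0.le hp1
      rw [← hsd] at h
      have hpos : 0 < 1+6/5*s := by positivity
      have e : 1 - 1/(1+6/5*s) - 1/1000 = (6/5*s - 1/1000*(1+6/5*s))/(1+6/5*s) := by field_simp; ring
      rw [e, mul_div_assoc', le_div_iff₀ hpos]; exact h
    have h4 : 0 ≤ 1 - Real.exp (-(b*n*s)) - 1/1000 := by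
      have : 1/(1+6/5*s) ≤ 10/13 := by
        rw [div_le_div_iff₀ (by positivity) (by norm_num)]; linarith
      linarith
    have hT0 : 0 ≤ 1 + 6/5*(p/2+p^2/4) + (6/5*(p/2+p^2/4))^2/2 := by positivity
    have hE := Real.exp_pos (n * -(3/2*(b*(1-b))*(1+3*(b*(1-b)))*p))
    have h5 : 1/2 ≤ Real.exp (n*(b*(p/2+p^2/4))) * (1 - Real.exp (-(b*n*s)) - 1/1000) :=
      h3.trans (mul_le_mul h1 (by linarith) (by
        have : 1/(1+6/5*s) ≤ 10/13 := by
          rw [div_le_div_iff₀ (by positivity) (by norm_num)]; linarith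
        linarith) (Real.exp_pos _).le)
    have h6 := mul_le_mul_of_nonneg_right h h4
    refine le_trans ?_ h6
    have h7 := mul_le_mul_of_nonneg_left h5 hE.le
    linarith
  · have h := pow_le_pow_left₀ (Real.exp_pos _).le (Z_big hb4 hb2 hp0 hp1) n
    rw [← hZ, ← Real.exp_nat_mul] at h
    have h2 : Real.exp (-(b*n*s)) ≤ 1/4 := by
      have : 3 ≤ b*n*s := by
        have : 15 ≤ b*n := by nlinarith
        nlinarith
      refine (Real.exp_le_exp.2 (neg_le_neg this)).trans ((one_sub_exp (by norm_num)).trans (by norm_num))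
    nlinarith

theorem i_large (hn : 60 ≤ n) (hp : p ∈ Set.Ioc (0:ℝ) 1) (hl : 0 < lam) (h2 : lam ≤ 433/1000)
    (Yhat : (Fin n → Fin n → Bool × ℝ) → Fin n → Fin n → ℝ) :
    Goal01 n p lam Yhat ((1/2) * Real.exp (-2*lam^2*(4*lam^2 + 1)*p*(n:ℝ))) := by
  rcases le_total (lam^2*n) (9/10) with h | h
  · exact i_large_a hn hp hl (by linarith) h Yhat
  · exact i_large_b hn hp hl h2 h Yhat

theorem part_i (hn : 1 ≤ n) (hp : p ∈ Set.Ioc (0:ℝ) 1) (hl : 0 < lam) (h2 : lam ≤ 1/2)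
    (Yhat : (Fin n → Fin n → Bool × ℝ) → Fin n → Fin n → ℝ) :
    Goal01 n p lam Yhat ((1/2) * Real.exp (-2*lam^2*(4*lam^2 + 1)*p*(n:ℝ))) := by
  by_cases h3 : n ≤ 3
  · exact i_small hn h3 hp hl h2 Yhat
  push Not at h3
  rcases le_total lam (433/1000) with h | h
  · by_cases h60 : 60 ≤ n
    · exact i_large h60 hp hl h Yhat
    · refine abAll_sound tab1 4 tab1_ok (by omega) ?_ hp hl (by push_cast; exact h) Yhat
      have : tab1.length = 56 := by decide +kernel
      omega
  · exact i_big (by omega) hp h h2 Yhat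

/-! part (ii), large `n` -/

lemma quarter_exp {r : ℝ} (hn : (0:ℝ) < n) : (n:ℝ) * ((1/(4*(n:ℝ))) * r) = 1/4 * r := by field_simp

theorem ii_large_a (hn : 60 ≤ n) (hp : p ∈ Set.Ioc (0:ℝ) 1) (hl : 0 < lam) (h2 : lam ≤ 1/2)
    (hs : lam^2 * n ≤ 9/10)
    (Yhat : (Fin n → Fin n → Bool × ℝ) → Fin n → Fin n → ℝ) :
    Goal2 n p lam Yhat ((1/(4*(n:ℝ))) * Real.exp (-2*lam^2*(4*lam^2 + 1)*p*(n:ℝ))) := by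
  have hh := Real.exp_le_one_iff.2 (arg_nonpos (n := n) (lam := lam) hp)
  have hN : (60:ℝ) ≤ n := by exact_mod_cast hn
  have hN0 : (0:ℝ) < n := by linarith
  obtain ⟨u, hu⟩ : ∃ u : ℝ, u = 1/(n:ℝ) := ⟨_, rfl⟩
  have hun : u * n = 1 := by rw [hu]; field_simp
  have hu0 : 0 < u := by rw [hu]; positivity
  have hu1 : u ≤ 1/60 := by rw [hu]; exact one_div_le_one_div_of_le (by norm_num) hN
  obtain ⟨hp0, hp1⟩ := id hp
  refine T2 hp hl (by omega) 3 (b := 2*u) (w := 1/2) false (by linarith) (by push_cast; linarith) le_rfl (by norm_num)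
    ?_ (by push_cast; linarith) (by simp) Yhat _ ?_
  · have : lam^2 = (lam^2*n)*u := by rw [mul_assoc, mul_comm (n:ℝ) u, hun, mul_one]
    rw [this]; push_cast; nlinarith
  · rw [quarter_exp hN0]
    have a1 : Real.exp (-(3/2)) ≤ (1 - (3/2)/(n:ℝ))^(n-2) := by
      refine one_sub_pow_ge (by norm_num) (by linarith) ?_
      rw [Nat.cast_sub (by omega)]; push_cast; linarith
    have e2 : 1 - (3/2)/(n:ℝ) = 1 - 3/2*u := by rw [hu]; ring
    rw [e2] at a1
    have a2 : (205/1000:ℝ) ≤ Real.exp (-(3/2)) := by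
      have h := pow_le_pow_left₀ (by norm_num) (by have := Real.add_one_le_exp (-(1/10:ℝ)); linarith : (9/10:ℝ) ≤ Real.exp (-(1/10))) 15
      rw [← Real.exp_nat_mul] at h
      norm_num at h ⊢
      linarith
    have hs14 : 1/4 ≤ (1-p/2)^2 := by nlinarith
    have a3 : (1 - 3/2*u)^(n-2) ≤ (1 - 2*u + 2*u*(1-p/2)^2)^(n-2) :=
      pow_le_pow_left₀ (by linarith) (by nlinarith) _
    have a4 : 205/1000 ≤ (1 - 2*u + 2*u*(1-p/2)^2)^(n-2) := by linarith
    have a5 : 1/4*(205/1000) ≤ (1-p/2)^2 * (1 - 2*u + 2*u*(1-p/2)^2)^(n-2) :=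
      mul_le_mul hs14 a4 (by norm_num) (by positivity)
    obtain ⟨W, hW⟩ : ∃ W : ℝ, W = (1-p/2)^2 * (1 - 2*u + 2*u*(1-p/2)^2)^(n-2) := ⟨_, rfl⟩
    rw [← hW] at a5
    have a7 : 2*((n:ℝ)*u - u)*(3-12*u)*W = 2*(1 - u)*(3-12*u)*W := by rw [mul_comm (n:ℝ) u, hun]
    have a8 : 11/2 ≤ 2*(1-u)*(3-12*u) := by nlinarith
    refine le_trans (by nlinarith : _ ≤ 2*(1 - u)*(3-12*u)*W) (le_of_eq ?_)
    rw [← a7, hW]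
    simp only [Bool.false_eq_true, if_false]
    push_cast
    ring

set_option maxHeartbeats 1000000 in
theorem ii_large_b (hn : 60 ≤ n) (hp : p ∈ Set.Ioc (0:ℝ) 1) (hl : 0 < lam) (h2 : lam ≤ 433/1000)
    (hs : 9/10 ≤ lam^2 * n)
    (Yhat : (Fin n → Fin n → Bool × ℝ) → Fin n → Fin n → ℝ) :
    Goal2 n p lam Yhat ((1/(4*(n:ℝ))) * Real.exp (-2*lam^2*(4*lam^2 + 1)*p*(n:ℝ))) := by
  obtain ⟨b, hb, hb2, hq⟩ := b_exists hl h2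
  have hN : (60:ℝ) ≤ n := by exact_mod_cast hn
  have hN0 : (0:ℝ) < n := by linarith
  refine T2 hp hl (by omega) 1 (b := b) (w := 3/4) false hb (by push_cast; linarith) (by norm_num) (by norm_num)
    (by push_cast; linarith) (by push_cast; linarith) (by simp) Yhat _ ?_
  rw [quarter_exp hN0]
  obtain ⟨hp0, hp1⟩ := hp
  have hβ := beta_lb hb hq hs
  have hσ0 : 0 ≤ (1-p/2)^2 := sq_nonneg _
  have hσ1 : (1-p/2)^2 ≤ 1 := pow_le_one₀ (by linarith) (by linarith)
  have hbs : 0 ≤ b*(1-p/2)^2 := by positivity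
  obtain ⟨s, hsd⟩ : ∃ s : ℝ, s = (1-p/2)^2 := ⟨_, rfl⟩
  obtain ⟨Z, hZ⟩ : ∃ Z : ℝ, Z = 1 - b + b*(1-p/2)^2 := ⟨_, rfl⟩
  have hZ0 : 0 < Z := by rw [hZ]; linarith
  have hZ1 : Z ≤ 1 := by rw [hZ]; nlinarith
  have hZn : Z^n ≤ Z^(n-2) := pow_le_pow_of_le_one hZ0.le hZ1 (by omega)
  have s14 : 1/4 ≤ s := by rw [hsd]; nlinarith
  have main : 1/4 * Real.exp (-2*lam^2*(4*lam^2 + 1)*p*(n:ℝ)) ≤ 3/4*((n-1)*b)*(1-b)*s*Z^n := by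
    rw [c_eq hq n p]
    have hE := Real.exp_pos (n * -(3/2*(b*(1-b))*(1+3*(b*(1-b)))*p))
    have n1 : 59/60*(b*n) ≤ (n-1)*b := by nlinarith
    rcases le_total b (1/4) with hb4 | hb4
    · have h := pow_le_pow_left₀ (Real.exp_pos _).le (Z_small hb hb4 hp0 hp1) n
      rw [← hZ, ← Real.exp_nat_mul, mul_add, Real.exp_add] at h
      have h1 : 1 + 6/5*(p/2+p^2/4) + (6/5*(p/2+p^2/4))^2/2 ≤ Real.exp (n*(b*(p/2+p^2/4))) := by
        refine (Real.quadratic_le_exp_of_nonneg (by positivity)).trans (Real.exp_le_exp.2 ?_)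
        have : 0 ≤ p/2+p^2/4 := by positivity
        nlinarith
      have h3 := poly2 hp0.le hp1
      rw [← hsd] at h3
      have s0 : 0 ≤ s := by linarith
      have k1 : 53/80 ≤ 3/4*((n-1)*b)*(1-b) := by
        have : 59/60*(6/5) ≤ (n-1)*b := by linarith
        nlinarith
      have k2 : 1/4 ≤ 3/4*((n-1)*b)*(1-b) * (Real.exp (n*(b*(p/2+p^2/4))) * s) :=
        h3.trans (mul_le_mul k1 (mul_le_mul_of_nonneg_right h1 s0) (by positivity) (by linarith))
      calc 1/4 * Real.exp (n * -(3/2*(b*(1-b))*(1+3*(b*(1-b)))*p))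
          ≤ (3/4*((n-1)*b)*(1-b) * (Real.exp (n*(b*(p/2+p^2/4))) * s)) * Real.exp (n * -(3/2*(b*(1-b))*(1+3*(b*(1-b)))*p)) :=
            mul_le_mul_of_nonneg_right k2 hE.le
        _ = 3/4*((n-1)*b)*(1-b)*s * (Real.exp (n * -(3/2*(b*(1-b))*(1+3*(b*(1-b)))*p)) * Real.exp (n*(b*(p/2+p^2/4)))) := by ring
        _ ≤ _ := mul_le_mul_of_nonneg_left h (mul_nonneg (by linarith) s0)
    · have h := pow_le_pow_left₀ (Real.exp_pos _).le (Z_big hb4 hb2 hp0 hp1) n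
      rw [← hZ, ← Real.exp_nat_mul] at h
      have k0 : 14 ≤ (n-1)*b := by nlinarith
      have k1 : 1 ≤ 3/4*((n-1)*b)*(1-b) := by
        have := mul_le_mul k0 (by linarith : 1/2 ≤ 1 - b) (by norm_num) (by linarith)
        linarith
      have k2 : 1/4 ≤ 3/4*((n-1)*b)*(1-b)*s := by
        have := mul_le_mul k1 s14 (by norm_num) (by linarith)
        linarith
      exact mul_le_mul k2 h hE.le (by linarith)
  refine main.trans ?_
  have k : 3/4*((n-1)*b)*(1-b)*s*Z^n ≤ 3/4*((n-1)*b)*(1-b)*s*Z^(n-2) := by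
    refine mul_le_mul_of_nonneg_left hZn ?_
    have : 0 ≤ ((n:ℝ)-1)*b := mul_nonneg (by linarith) hb.le
    have : 0 ≤ 1 - b := by linarith
    have : 0 ≤ s := by linarith
    positivity
  refine k.trans (le_of_eq ?_)
  rw [hsd, hZ]
  simp only [Bool.false_eq_true, if_false]
  push_cast
  ring

theorem ii_large (hn : 60 ≤ n) (hp : p ∈ Set.Ioc (0:ℝ) 1) (hl : 0 < lam) (h2 : lam ≤ 433/1000)
    (Yhat : (Fin n → Fin n → Bool × ℝ) → Fin n → Fin n → ℝ) :
    Goal2 n p lam Yhat ((1/(4*(n:ℝ))) * Real.exp (-2*lam^2*(4*lam^2 + 1)*p*(n:ℝ))) := by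
  rcases le_total (lam^2*n) (9/10) with h | h
  · exact ii_large_a hn hp hl (by linarith) h Yhat
  · exact ii_large_b hn hp hl h2 h Yhat

end GLB

end

section
open MeasureTheory
namespace GLB
/-- all labels carry sign blocks and later labels carry arrows -/
noncomputable def rt (K : ℕ) : Design (Fin (K+2)) where
  μ := fun _ => 1/((K:ℝ)+2)
  D := fun _ => true
  A := fun j i => decide (i.val < j.val ∧ 2 ≤ j.val)
  w := 1/2
  l0 := 0
  l1 := 1

lemma kk2 {L : Type} [Fintype L] [DecidableEq L] (ℓ : Fin 2 → L) (l : L) :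
    kk ℓ l = (if ℓ 0 = l then 1 else 0) + (if ℓ 1 = l then 1 else 0) := by
  simp only [kk, Finset.card_filter, Fin.sum_univ_two]

lemma kA2 {L : Type} [Fintype L] [DecidableEq L] (d : Design L) (ℓ : Fin 2 → L) (l : L) :
    d.kA ℓ l = (if d.A l (ℓ 0) = true then 1 else 0) + (if d.A l (ℓ 1) = true then 1 else 0) := by
  simp only [Design.kA, Finset.card_filter, Fin.sum_univ_two]

lemma rt_val (K : ℕ) (p : ℝ) (ℓ : Fin 2 → Fin (K+2)) :
  (∑ l, if (rt K).D l = true then (kk ℓ l:ℝ)^2*(1/2*(1-p/2)^(kk ℓ l^2)) else 0) + ∑ b, ((rt K).kA ℓ b:ℝ)*(2*kk ℓ b)*(2*(rt K).w*(1-(rt K).w)*(1-p/2)^(2*kk ℓ b)) =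
    if ℓ 0 = ℓ 1 then 2*(1-p/2)^4 else (1-p/2) + if 2 ≤ (ℓ 0).val ∨ 2 ≤ (ℓ 1).val then (1-p/2)^2 else 0 := by
  simp only [kA2, kk2]
  generalize ℓ 0 = a
  generalize ℓ 1 = b
  have hw : (rt K).w = 1/2 := rfl
  have hD : ∀ l, (rt K).D l = true := fun _ => rfl
  have hA : ∀ i j, (rt K).A i j = true ↔ (j.val < i.val ∧ 2 ≤ i.val) := by
    intro i j; simp only [rt, decide_eq_true_eq]
  simp only [hw, hD, hA, if_true]
  generalize 1 - p/2 = x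
  by_cases hab : a = b
  · subst hab
    rw [if_pos rfl, Finset.sum_eq_single a, Finset.sum_eq_zero]
    · simp; ring
    · intro l _
      by_cases h : a = l
      · subst h; simp
      · simp [h]
    · intro l _ hl; simp [hl.symm]
    · simp
  · rw [if_neg hab]
    have e1 : (∑ l, (((if a = l then 1 else 0) + (if b = l then 1 else 0) : ℕ):ℝ)^2 * (1/2 * x^(((if a = l then 1 else 0) + (if b = l then 1 else 0))^2))) = x := by
      rw [Finset.sum_eq_add a b hab]
      · simp [hab, Ne.symm hab]; ring
      · intro l _ hl; simp [hl.1.symm, hl.2.symm]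
      · simp
      · simp
    rw [e1]
    congr 1
    rw [Finset.sum_eq_add a b hab]
    · have hab' : a.val ≠ b.val := fun h => hab (Fin.ext h)
      rcases lt_or_gt_of_ne hab' with h | h
      · by_cases h2 : 2 ≤ b.val
        · simp [hab, Ne.symm hab, h, h2, not_lt.2 h.le]; ring
        · have : ¬ 2 ≤ a.val := by omega
          simp [hab, Ne.symm hab, h2, this]
      · by_cases h2 : 2 ≤ a.val
        · simp [hab, Ne.symm hab, h, h2, not_lt.2 h.le]; ring
        · have : ¬ 2 ≤ b.val := by omega
          simp [hab, Ne.symm hab, h2, this]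
    · intro l _ hl; simp [hl.1.symm, hl.2.symm]
    · simp
    · simp

lemma rt_sum (K : ℕ) (F : Fin (K+2) → Fin (K+2) → ℝ) : ∑ ℓ : Fin 2 → Fin (K+2), (∏ i, (rt K).μ (ℓ i)) * F (ℓ 0) (ℓ 1) =
   (1/((K:ℝ)+2))^2 * ∑ a, ∑ b, F a b := by
  rw [← Fintype.sum_prod_type', Finset.mul_sum]
  refine Fintype.sum_equiv (finTwoArrowEquiv _) _ _ fun ℓ => ?_
  simp [rt, finTwoArrowEquiv]

lemma rt_ok {K : ℕ} {lam : ℝ} (hl : 0 ≤ lam) (h : lam ≤ 1/((K:ℝ)+2)) : (rt K).Ok lam where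
  pos := by intro l; simp only [rt]; positivity
  sum := by simp only [rt, Finset.sum_const, Finset.card_univ, Fintype.card_fin, nsmul_eq_mul]; push_cast; field_simp
  hD := by intro l _; exact h
  hA := by
    intro b l hA
    simp only [rt, decide_eq_true_eq] at hA
    have hc : 2 ≤ b.val := hA.2
    have h1 : 2 * (1/((K:ℝ)+2)) ≤ (rt K).μA b := by
      unfold Design.μA
      have h01 : (0 : Fin (K+2)) ≠ 1 := by simp
      refine le_trans (le_of_eq ?_) (Finset.sum_le_sum_of_subset_of_nonneg (Finset.subset_univ {0, 1}) ?_)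
      · rw [Finset.sum_pair h01]
        have a0 : (rt K).A b 0 = true := by
          simp only [rt, decide_eq_true_eq]
          refine ⟨?_, hc⟩
          first | (rw [Fin.val_zero]; omega) | (rw [Fin.val_one]; omega)
        have a1 : (rt K).A b 1 = true := by
          simp only [rt, decide_eq_true_eq]
          refine ⟨?_, hc⟩
          first | (rw [Fin.val_zero]; omega) | (rw [Fin.val_one]; omega)
        rw [if_pos a0, if_pos a1]; simp only [rt]; ring
      · intro i _ _
        split_ifs
        · simp only [rt]; positivity
        · exact le_rfl
    have h2 : (0:ℝ) < 1/((K:ℝ)+2) := by positivity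
    have h3 : (rt K).w = 1/2 := rfl
    have h4 : (rt K).μ b = 1/((K:ℝ)+2) := rfl
    rw [h3, h4]
    generalize 1/((K:ℝ)+2) = u at *
    nlinarith
  irr := by intro b; simp [rt]
  asym := by intro b l h; simp only [rt, decide_eq_true_eq, decide_eq_false_iff_not] at *; omega
  h0 := by simp [rt]
  h1 := by simp [rt]
  hd := by intro h; exact absurd h (by simp [rt])
  hlam := by simp only [rt]; nlinarith
  w0 := le_refl _
  w1 := by simp only [rt]; norm_num

variable {n : ℕ} {p lam : ℝ}

theorem RT (K : ℕ) (hp : p ∈ Set.Ioc (0:ℝ) 1) (hl : 0 < lam) (h : lam ≤ 1/((K:ℝ)+2))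
    (Yhat : (Fin 2 → Fin 2 → Bool × ℝ) → Fin 2 → Fin 2 → ℝ) (r : ℝ)
    (hr : ((2:ℕ):ℝ)^2 * r ≤ (1/((K:ℝ)+2))^2 * ∑ a : Fin (K+2), ∑ b : Fin (K+2),
      if a = b then 2*(1-p/2)^4 else (1-p/2) + if 2 ≤ a.val ∨ 2 ≤ b.val then (1-p/2)^2 else 0) :
    Goal2 2 p lam Yhat r := by
  refine G2 hp hl (rt_ok hl.le h) (by norm_num) Yhat r (hr.trans (le_of_eq ?_))
  simp only [rt_val K]
  exact (rt_sum K (fun a b => if a = b then 2*(1-p/2)^4 else (1-p/2) + if 2 ≤ a.val ∨ 2 ≤ b.val then (1-p/2)^2 else 0)).symm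

theorem ii_two (hp : p ∈ Set.Ioc (0:ℝ) 1) (hl : 0 < lam) (h2 : lam ≤ 1/2)
    (Yhat : (Fin 2 → Fin 2 → Bool × ℝ) → Fin 2 → Fin 2 → ℝ) :
    Goal2 2 p lam Yhat ((1/(4*((2:ℕ):ℝ))) * Real.exp (-2*lam^2*(4*lam^2 + 1)*p*((2:ℕ):ℝ))) := by
  have hh := Real.exp_le_one_iff.2 (arg_nonpos (n := 2) (lam := lam) hp)
  obtain ⟨hp0, hp1⟩ := id hp
  rcases le_or_gt lam (1/4) with h | h4
  · refine RT 2 hp hl (by norm_num; linarith) Yhat _ ?_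
    have e : (∑ a : Fin 4, ∑ b : Fin 4, if a = b then 2*(1-p/2)^4 else (1-p/2) + if 2 ≤ a.val ∨ 2 ≤ b.val then (1-p/2)^2 else 0) = 8*(1-p/2)^4 + 12*(1-p/2) + 10*(1-p/2)^2 := by
      simp [Fin.sum_univ_four]; try ring
    refine le_trans ?_ (le_of_eq (congrArg _ e.symm))
    push_cast
    have hx : 1/2 ≤ 1 - p/2 := by linarith
    push_cast at hh
    generalize 1 - p/2 = x at hx ⊢
    have h1 : (1/4:ℝ) ≤ x^2 := by nlinarith
    have h2 : (1/16:ℝ) ≤ x^4 := by nlinarith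
    refine le_trans (mul_le_mul_of_nonneg_left (mul_le_mul_of_nonneg_left hh (by norm_num)) (by norm_num)) ?_
    linarith
  rcases le_or_gt lam (1/3) with h | h3
  · refine RT 1 hp hl (by norm_num; linarith) Yhat _ ?_
    have e : (∑ a : Fin 3, ∑ b : Fin 3, if a = b then 2*(1-p/2)^4 else (1-p/2) + if 2 ≤ a.val ∨ 2 ≤ b.val then (1-p/2)^2 else 0) = 6*(1-p/2)^4 + 6*(1-p/2) + 4*(1-p/2)^2 := by
      simp [Fin.sum_univ_three]; try ring
    refine le_trans ?_ (le_of_eq (congrArg _ e.symm))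
    push_cast
    have hc : 5/32 ≤ 2*lam^2*(4*lam^2+1) := by
      have : (1/16:ℝ) ≤ lam^2 := by nlinarith
      nlinarith
    have he : Real.exp (-2*lam^2*(4*lam^2 + 1)*p*2) * (1 + 5/16*p) ≤ 1 := by
      have h1 := Real.add_one_le_exp (2*(2*lam^2*(4*lam^2+1))*p)
      have h2 : 1 + 5/16*p ≤ Real.exp (2*(2*lam^2*(4*lam^2+1))*p) := by
        have := mul_le_mul_of_nonneg_right hc hp0.le; linarith
      refine (mul_le_mul_of_nonneg_left h2 (Real.exp_pos _).le).trans (le_of_eq ?_)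
      rw [← Real.exp_add, Real.exp_eq_one_iff]; ring
    have hb : 1 ≤ (12*(1-p/2)^4 + 12*(1-p/2) + 8*(1-p/2)^2)/9 * (1 + 5/16*p) := by
      nlinarith [bern hp0.le hp1 0 5, bern hp0.le hp1 1 4, bern hp0.le hp1 2 3, bern hp0.le hp1 3 2, bern hp0.le hp1 4 1, bern hp0.le hp1 5 0]
    have := le_of_mul_le_mul_right (he.trans hb) (by positivity)
    norm_num at this ⊢; linarith
  · refine RT 0 hp hl (by norm_num; linarith) Yhat _ ?_
    have e : (∑ a : Fin 2, ∑ b : Fin 2, if a = b then 2*(1-p/2)^4 else (1-p/2) + if 2 ≤ a.val ∨ 2 ≤ b.val then (1-p/2)^2 else 0) = 4*(1-p/2)^4 + 2*(1-p/2) + 0*(1-p/2)^2 := by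
      simp [Fin.sum_univ_two]; try ring
    refine le_trans ?_ (le_of_eq (congrArg _ e.symm))
    push_cast
    have hc : 32/100 ≤ 2*lam^2*(4*lam^2+1) := by
      have : (1/9:ℝ) ≤ lam^2 := by nlinarith
      nlinarith
    have he : Real.exp (-2*lam^2*(4*lam^2 + 1)*p*2) * (1 + 64/100*p + (64/100*p)^2/2) ≤ 1 := by
      have h1 := Real.quadratic_le_exp_of_nonneg (x := 64/100*p) (by positivity)
      have h2 : 1 + 64/100*p + (64/100*p)^2/2 ≤ Real.exp (2*(2*lam^2*(4*lam^2+1))*p) := by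
        refine h1.trans (Real.exp_le_exp.2 ?_)
        have := mul_le_mul_of_nonneg_right hc hp0.le; linarith
      refine (mul_le_mul_of_nonneg_left h2 (Real.exp_pos _).le).trans (le_of_eq ?_)
      rw [← Real.exp_add, Real.exp_eq_one_iff]; ring
    have hb : 1 ≤ (2*(1-p/2)^4 + (1-p/2)) * (1 + 64/100*p + (64/100*p)^2/2) := by
      nlinarith [bern hp0.le hp1 0 8, bern hp0.le hp1 1 7, bern hp0.le hp1 2 6, bern hp0.le hp1 3 5, bern hp0.le hp1 4 4, bern hp0.le hp1 5 3, bern hp0.le hp1 6 2, bern hp0.le hp1 7 1, bern hp0.le hp1 8 0]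
    have := le_of_mul_le_mul_right (he.trans hb) (by positivity)
    norm_num at this ⊢; linarith

theorem ii_one (hp : p ∈ Set.Ioc (0:ℝ) 1) (hl : 0 < lam) (h2 : lam ≤ 1/2)
    (Yhat : (Fin 1 → Fin 1 → Bool × ℝ) → Fin 1 → Fin 1 → ℝ) :
    Goal2 1 p lam Yhat ((1/(4*((1:ℕ):ℝ))) * Real.exp (-2*lam^2*(4*lam^2 + 1)*p*((1:ℕ):ℝ))) := by
  have hh := Real.exp_le_one_iff.2 (arg_nonpos (n := 1) (lam := lam) hp)
  obtain ⟨hp0, hp1⟩ := id hp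
  refine G2 hp hl (rs_ok (K := 0) hl.le (by norm_num; linarith)) le_rfl Yhat _ ?_
  have k1 : ∀ (ℓ : Fin 1 → Fin (0+2)) l, kk ℓ l = if ℓ 0 = l then 1 else 0 := by
    intro ℓ l; simp only [kk, Finset.card_filter, Fin.sum_univ_one]
  have k2 : ∀ (ℓ : Fin 1 → Fin (0+2)) l, (rs 0).kA ℓ l = 0 := by
    intro ℓ l; simp [Design.kA, rs]
  simp only [k1, k2]
  rw [Fintype.sum_equiv (Equiv.funUnique (Fin 1) (Fin (0+2))) _ (fun a => 1/4 * (1-p/2)) ?_]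
  · rw [Finset.sum_const, Finset.card_univ, Fintype.card_fin]; 
    have hh2 : Real.exp (-(2 * lam ^ 2 * (4 * lam ^ 2 + 1) * p)) ≤ 1 :=
      Real.exp_le_one_iff.2 (neg_nonpos.2 (by positivity))
    push_cast; norm_num; linarith
  · intro ℓ
    simp [rs, Equiv.funUnique]
    have : ∀ a : Fin 2, a = 0 ∨ a = 1 := by decide
    rcases this (ℓ 0) with h | h <;> simp [h] <;> ring
theorem ii_S (hn : 3 ≤ n) (hp : p ∈ Set.Ioc (0:ℝ) 1) (hl : 42/100 ≤ lam) (h2 : lam ≤ 1/2)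
    (Yhat : (Fin n → Fin n → Bool × ℝ) → Fin n → Fin n → ℝ) :
    Goal2 n p lam Yhat ((1/(4*(n:ℝ))) * Real.exp (-2*lam^2*(4*lam^2 + 1)*p*(n:ℝ))) := by
  obtain ⟨hp0, hp1⟩ := id hp
  obtain ⟨k, rfl⟩ : ∃ k, n = (k+1)+1+1 := ⟨n-3, by omega⟩
  refine S2 (m := k+1+1) hp (by linarith) h2 Yhat _ ?_
  rw [Nat.add_sub_cancel]
  have hl0 : 0 < lam := by linarith
  have hs0 : 0 ≤ (1-p/2)^2 := sq_nonneg _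
  have hc : 60/100 ≤ 2*lam^2*(4*lam^2+1) := by
    have : (1764/10000:ℝ) ≤ lam^2 := by nlinarith
    nlinarith
  have hcl : lam ≤ 2*lam^2*(4*lam^2+1) := by linarith
  have hB : Real.exp (-(2*lam^2*(4*lam^2+1))*p) ≤ 1 - lam + lam*(1-p/2)^2 := by
    refine le_trans (Real.exp_le_exp.2 (?_ : _ ≤ -(lam*p))) ((exp_neg_le (by positivity)).trans ?_)
    · have := mul_le_mul_of_nonneg_right hcl hp0.le; linarith
    · nlinarith [mul_nonneg (mul_nonneg hl0.le (by linarith : 0 ≤ 1/2 - lam)) (sq_nonneg p)]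
  have hBm := pow_le_pow_left₀ (Real.exp_pos _).le hB (k+1)
  have hbase : 1 ≤ 4*(lam*(1-lam)*(1-p/2)*(1-lam+2*(lam*(1-p/2)^2))) * Real.exp (2*(2*lam^2*(4*lam^2+1))*p) := by
    have e1 := exp_cubic (y := 12/10*p) (by positivity)
    have e2 : Real.exp (12/10*p) ≤ Real.exp (2*(2*lam^2*(4*lam^2+1))*p) := by
      refine Real.exp_le_exp.2 ?_
      have := mul_le_mul_of_nonneg_right hc hp0.le; linarith
    have e3 : 97/100 ≤ 4*(lam*(1-lam)) := by nlinarith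
    have q : ∀ l : ℝ, (l = 42/100 ∨ l = 1/2) → 1 ≤ 97/100*((1-p/2)*(1-l+2*(l*(1-p/2)^2)))*(1 + 12/10*p + (12/10*p)^2/2 + (12/10*p)^3/6) := by
      intro l hl
      rcases hl with rfl | rfl <;>
      nlinarith [bern hp0.le hp1 0 8, bern hp0.le hp1 1 7, bern hp0.le hp1 2 6, bern hp0.le hp1 3 5, bern hp0.le hp1 4 4, bern hp0.le hp1 5 3, bern hp0.le hp1 6 2, bern hp0.le hp1 7 1, bern hp0.le hp1 8 0]
    have q1 := q _ (Or.inl rfl)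
    have q2 := q _ (Or.inr rfl)
    have q3 : 1 ≤ 97/100*((1-p/2)*(1-lam+2*(lam*(1-p/2)^2)))*(1 + 12/10*p + (12/10*p)^2/2 + (12/10*p)^3/6) := by
      have r1 := mul_le_mul_of_nonneg_left q1 (by linarith : 0 ≤ (1/2 - lam))
      have r2 := mul_le_mul_of_nonneg_left q2 (by linarith : 0 ≤ (lam - 42/100))
      linarith
    have hT : 0 ≤ (1-p/2)*(1-lam+2*(lam*(1-p/2)^2)) :=
      mul_nonneg (by linarith) (by have := mul_nonneg hl0.le hs0; linarith)
    have hE : 0 ≤ 1 + 12/10*p + (12/10*p)^2/2 + (12/10*p)^3/6 := by positivity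
    calc (1:ℝ) ≤ _ := q3
      _ ≤ 4*(lam*(1-lam))*((1-p/2)*(1-lam+2*(lam*(1-p/2)^2))) * Real.exp (2*(2*lam^2*(4*lam^2+1))*p) :=
        mul_le_mul (mul_le_mul_of_nonneg_right e3 hT) (e1.trans e2) hE (mul_nonneg (by linarith) hT)
      _ = _ := by ring
  have hW : 0 ≤ lam*(1-lam)*(1-p/2) := mul_nonneg (mul_nonneg hl0.le (by linarith)) (by linarith)
  have key : Real.exp (-2*lam^2*(4*lam^2 + 1)*p*((k+1+1+1:ℕ):ℝ)) ≤ 4*(lam*(1-lam)*(1-p/2)*(1-lam+2*(lam*(1-p/2)^2))) * (1-lam+lam*(1-p/2)^2)^(k+1) := by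
    have hexp : Real.exp (-2*lam^2*(4*lam^2 + 1)*p*((k+1+1+1:ℕ):ℝ)) * Real.exp (2*(2*lam^2*(4*lam^2+1))*p) = Real.exp (-(2*lam^2*(4*lam^2+1))*p)^(k+1) := by
      rw [← Real.exp_add, ← Real.exp_nat_mul]; congr 1; push_cast; ring
    have hT : 0 ≤ 4*(lam*(1-lam)*(1-p/2)*(1-lam+2*(lam*(1-p/2)^2))) :=
      mul_nonneg (by norm_num) (mul_nonneg hW (by have := mul_nonneg hl0.le hs0; linarith))
    calc _ ≤ Real.exp (-2*lam^2*(4*lam^2 + 1)*p*((k+1+1+1:ℕ):ℝ)) * (4*(lam*(1-lam)*(1-p/2)*(1-lam+2*(lam*(1-p/2)^2))) * Real.exp (2*(2*lam^2*(4*lam^2+1))*p)) :=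
          le_mul_of_one_le_right (Real.exp_pos _).le hbase
      _ = 4*(lam*(1-lam)*(1-p/2)*(1-lam+2*(lam*(1-p/2)^2))) * Real.exp (-(2*lam^2*(4*lam^2+1))*p)^(k+1) := by rw [← hexp]; ring
      _ ≤ _ := mul_le_mul_of_nonneg_left hBm hT
  have hn0 : (0:ℝ) < ((k+1+1+1:ℕ):ℝ) := by positivity
  have hB0 : 0 ≤ (1-lam+lam*(1-p/2)^2)^(k+1) := le_trans (by positivity) hBm
  have hlow : lam*(1-lam)*(1-p/2)*(1-lam+2*(lam*(1-p/2)^2)) * (1-lam+lam*(1-p/2)^2)^(k+1) ≤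
      lam*(1-lam)*(1-p/2)*((1-lam+lam*(1-p/2)^2)^(k+1+1) + ((k+1+1:ℕ):ℝ)*(lam*(1-p/2)^2*(1-lam+lam*(1-p/2)^2)^(k+1))) := by
    rw [mul_assoc]
    refine mul_le_mul_of_nonneg_left ?_ hW
    rw [pow_succ _ (k+1)]
    have hk : (1:ℝ) ≤ ((k+1+1:ℕ):ℝ) := by push_cast; linarith [Nat.cast_nonneg (α := ℝ) k]
    have := mul_le_mul_of_nonneg_right hk (mul_nonneg (mul_nonneg hl0.le hs0) hB0)
    linarith
  have e : (((k+1+1+1:ℕ):ℝ))^2 * ((1/(4*((k+1+1+1:ℕ):ℝ))) * Real.exp (-2*lam^2*(4*lam^2 + 1)*p*((k+1+1+1:ℕ):ℝ))) = ((k+1+1+1:ℕ):ℝ) * (1/4*Real.exp (-2*lam^2*(4*lam^2 + 1)*p*((k+1+1+1:ℕ):ℝ))) := by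
    field_simp
  refine le_trans (le_of_eq e) (mul_le_mul_of_nonneg_left ?_ hn0.le)
  refine le_trans ?_ hlow
  linarith

theorem part_ii (hn : 1 ≤ n) (hp : p ∈ Set.Ioc (0:ℝ) 1) (hl : 0 < lam) (h2 : lam ≤ 1/2)
    (Yhat : (Fin n → Fin n → Bool × ℝ) → Fin n → Fin n → ℝ) :
    Goal2 n p lam Yhat ((1/(4*(n:ℝ))) * Real.exp (-2*lam^2*(4*lam^2 + 1)*p*(n:ℝ))) := by
  by_cases h1 : n = 1
  · subst h1; exact ii_one hp hl h2 Yhat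
  by_cases h2' : n = 2
  · subst h2'; exact ii_two hp hl h2 Yhat
  rcases le_total lam (42/100) with h | h
  · by_cases h60 : 60 ≤ n
    · exact ii_large h60 hp hl (by linarith) Yhat
    · refine t2All_sound hn tab2 3 tab2_ok (by omega) ?_ hp hl (by push_cast; linarith) Yhat
      have : tab2.length = 57 := by decide +kernel
      omega
  · exact ii_S (by omega) hp h h2 Yhat
end GLB

end

/-- minimax lower bounds over `F_λ` for graphon estimation.  For every estimator
`Yhat` there is `f ∈ F_λ` with
`P(max_{i,j} |Ŷ_ij − f(θ_i,θ_j)| ≥ 1/2) ≥ (1/2)·exp(−2λ²(4λ²+1)pn)`, and there is `f ∈ F_λ`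
whose MSE is at least `(1/(4n))·exp(−2λ²(4λ²+1)pn)`. -/
theorem stmt_2 (n : ℕ) (hn : 1 ≤ n) (p : ℝ) (hp : p ∈ Set.Ioc (0:ℝ) 1)
    (lam : ℝ) (hlam : lam ∈ Set.Ioc (0:ℝ) (1/2))
    (Yhat : (Fin n → Fin n → Bool × ℝ) → Fin n → Fin n → ℝ) (hYhat : Measurable Yhat) :
    (∃ f : ℝ → ℝ → ℝ, MemFLam lam f ∧
      ENNReal.ofReal ((1/2) * Real.exp (-2*lam^2*(4*lam^2 + 1)*p*(n:ℝ))) ≤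
        graphonMeasure n {ω | ∃ i j : Fin n,
          (1/2 : ℝ) ≤ |Yhat (graphonObs p f ω) i j - f (ω.1 i) (ω.1 j)|}) ∧
    (∃ f : ℝ → ℝ → ℝ, MemFLam lam f ∧
      (1/(4*(n:ℝ))) * Real.exp (-2*lam^2*(4*lam^2 + 1)*p*(n:ℝ)) ≤
        ∫ ω, (1/(n:ℝ)^2) * ∑ i, ∑ j,
          (Yhat (graphonObs p f ω) i j - f (ω.1 i) (ω.1 j))^2 ∂(graphonMeasure n)) := by
  exact ⟨GLB.part_i hn hp hlam.1 hlam.2 Yhat, GLB.part_ii hn hp hlam.1 hlam.2 Yhat⟩
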